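/- arXiv:1802.05111 — 3 statements merged into one kernel-verified Lean document; each statement's English description precedes it below -/
import Mathlib

section
/- There exists an absolute constant c₀ > 0 such that the following holds. Let s₁, s₂ be positive integers and let t₁, t₂, n be integers. Set 𝒞 = ∑_{x mod [s₁,s₂]} S(t₁x, 1; s₁) S(t₂x, 1; s₂) e( n x / [s₁,s₂] ), write s_i = w_i (s₁,s₂) for i = 1,2, and set Δ = w₂² t₁ − w₁² t₂. Then |𝒞| ≤ 2^{c₀ ω([s₁,s₂])} ( s₁ s₂ [s₁,s₂] )^{1/2} · gcd(Δ, n, s₁, s₂) / gcd(n, s₁, s₂)^{1/2}. -/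
open Complex

/-- `e(x) = exp(2πix)`. -/
noncomputable def e (x : ℝ) : ℂ := Complex.exp (2 * Real.pi * Complex.I * x)

/-- The Kloosterman sum `S(a,b;c) = ∑_{x mod c, (x,c)=1} e((ax + b x̄)/c)`. -/
noncomputable def klo (a b : ℤ) (c : ℕ) : ℂ :=
  ∑ x ∈ Finset.range c, if Nat.gcd x c = 1 then
    e (((a * x + b * ((((x : ZMod c))⁻¹).val : ℤ) : ℤ) : ℝ) / (c : ℝ))
  else 0

/-- `Δ = w₂² t₁ − w₁² t₂` where `s_i = w_i · (s₁,s₂)`. -/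
def Delta (s₁ s₂ : ℕ) (t₁ t₂ : ℤ) : ℤ :=
  ((s₂ / Nat.gcd s₁ s₂ : ℕ) : ℤ) ^ 2 * t₁ - ((s₁ / Nat.gcd s₁ s₂ : ℕ) : ℤ) ^ 2 * t₂

section Stepanov

open Polynomial

variable {K : Type*} [Field K] {a b : K[X]}

/-- Both coordinates have degree at most `d`. -/
def CoordDegLE (d : ℕ) (z : QuadraticAlgebra K[X] a b) : Prop :=
  z.re.natDegree ≤ d ∧ z.im.natDegree ≤ d

lemma natDegree_curve_le {p : ℕ} (hp : 1 ≤ p) (e : K) :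
    (C (2 * e) + X ^ p - X : K[X]).natDegree ≤ p := by
  compute_degree
  omega

lemma CoordDegLE.mono {d d' : ℕ} (h : d ≤ d') {z : QuadraticAlgebra K[X] a b}
    (hz : CoordDegLE d z) : CoordDegLE d' z :=
  ⟨hz.1.trans h, hz.2.trans h⟩

lemma CoordDegLE.mul {p : ℕ} (ha : a.natDegree ≤ 0) (hb : b.natDegree ≤ p) {d d' : ℕ} {z w : QuadraticAlgebra K[X] a b}
    (hz : CoordDegLE d z) (hw : CoordDegLE d' w) : CoordDegLE (d + d' + p) (z * w) := by
  constructor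
  · rw [QuadraticAlgebra.re_mul]
    refine (natDegree_add_le _ _).trans (max_le ?_ ?_)
    · exact (natDegree_mul_le_of_le hz.1 hw.1).trans (by omega)
    · refine (natDegree_mul_le_of_le (natDegree_mul_le_of_le ha hz.2) hw.2).trans (by omega)
  · rw [QuadraticAlgebra.im_mul]
    refine (natDegree_add_le _ _).trans (max_le ((natDegree_add_le _ _).trans (max_le ?_ ?_)) ?_)
    · exact (natDegree_mul_le_of_le hz.1 hw.2).trans (by omega)
    · exact (natDegree_mul_le_of_le hz.2 hw.1).trans (by omega)
    · exact (natDegree_mul_le_of_le (natDegree_mul_le_of_le hb hz.2) hw.2).trans (by omega)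

lemma CoordDegLE.omega_mul {p : ℕ} (ha : a.natDegree ≤ 0) (hb : b.natDegree ≤ p) {d : ℕ} {z : QuadraticAlgebra K[X] a b}
    (hz : CoordDegLE d z) : CoordDegLE (p + d) (QuadraticAlgebra.omega * z) := by
  have := CoordDegLE.mul (d := 0) ha hb (z := (QuadraticAlgebra.omega : QuadraticAlgebra K[X] a b))
    (by simp [CoordDegLE]) hz
  exact this.mono (by omega)

lemma CoordDegLE.omega_pow_mul {p : ℕ} (ha : a.natDegree ≤ 0) (hb : b.natDegree ≤ p) {d : ℕ} (n : ℕ) {z : QuadraticAlgebra K[X] a b}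
    (hz : CoordDegLE d z) : CoordDegLE (p * n + d) (QuadraticAlgebra.omega ^ n * z) := by
  induction n with
  | zero => simpa using hz
  | succ n ih =>
    rw [pow_succ' QuadraticAlgebra.omega, mul_assoc]
    exact (ih.omega_mul ha hb).mono (by rw [Nat.mul_succ]; omega)

lemma CoordDegLE.C_mul {d d' : ℕ} {f : K[X]} (hf : f.natDegree ≤ d)
    {z : QuadraticAlgebra K[X] a b} (hz : CoordDegLE d' z) :
    CoordDegLE (d + d') (algebraMap K[X] (QuadraticAlgebra K[X] a b) f * z) := by
  rw [← Algebra.smul_def]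
  exact ⟨natDegree_mul_le_of_le hf hz.1, natDegree_mul_le_of_le hf hz.2⟩

lemma CoordDegLE.sum {d : ℕ} {ι : Type*} (s : Finset ι) (f : ι → QuadraticAlgebra K[X] a b)
    (h : ∀ i ∈ s, CoordDegLE d (f i)) : CoordDegLE d (∑ i ∈ s, f i) := by
  classical
  induction s using Finset.induction_on with
  | empty => simp [CoordDegLE]
  | insert a s ha ih =>
    rw [Finset.sum_insert ha]
    have h1 := h a (by simp)
    have h2 := ih fun i hi => h i (by simp [hi])
    exact ⟨(natDegree_add_le _ _).trans (max_le h1.1 h2.1),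
      (natDegree_add_le _ _).trans (max_le h1.2 h2.2)⟩

lemma CoordDegLE.C_smul {d : ℕ} (c : K) {z : QuadraticAlgebra K[X] a b}
    (hz : CoordDegLE d z) : CoordDegLE d (c • z) :=
  ⟨(natDegree_smul_le _ _).trans hz.1, (natDegree_smul_le _ _).trans hz.2⟩

/-- Evaluation at a point of the curve. -/
def curveEval (τ x : K) (hx : x ^ 2 = a.eval τ + b.eval τ * x) :
    QuadraticAlgebra K[X] a b →+* K where
  toFun z := z.re.eval τ + z.im.eval τ * x
  map_one' := by simp [QuadraticAlgebra.re_one, QuadraticAlgebra.im_one]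
  map_zero' := by simp
  map_add' z w := by simp; ring
  map_mul' z w := by
    simp only [QuadraticAlgebra.re_mul, QuadraticAlgebra.im_mul, eval_add, eval_mul]
    linear_combination (-eval τ z.im * eval τ w.im) * hx

lemma curveRing_eq_zero_of_sq {p : ℕ} (hp : 1 < p) {e : K} (ha : a = -C (e ^ 2))
    (hb : b = C (2 * e) + X ^ p - X)
    {z : QuadraticAlgebra K[X] a b} (hz : z * z = 0) : z = 0 := by
  have h1 := congrArg QuadraticAlgebra.re hz
  have h3 := congrArg QuadraticAlgebra.im hz
  simp only [QuadraticAlgebra.re_mul, QuadraticAlgebra.im_mul, QuadraticAlgebra.re_zero,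
    QuadraticAlgebra.im_zero] at h1 h3
  set u := z.re with hu
  set v := z.im with hv
  by_cases hv0 : v = 0
  · have : u = 0 := by simpa [hv0] using h1
    ext1
    · simpa [← hu] using this
    · simpa [← hv] using hv0
  · exfalso
    have h4 : 2 * u + b * v = 0 := by
      have : v * (2 * u + b * v) = 0 := by linear_combination h3
      exact (mul_eq_zero.mp this).resolve_left hv0
    have h5 : b ^ 2 = C (4 * e ^ 2) := by
      have : v ^ 2 * (b ^ 2 - C (4 * e ^ 2)) = 0 := by
        have hC : (C (4 * e ^ 2) : K[X]) = 4 * C (e ^ 2) := by simp [map_ofNat]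
        rw [ha] at h1
        rw [hC]
        linear_combination 4 * h1 + (b * v - 2 * u) * h4
      have := (mul_eq_zero.mp this).resolve_left (pow_ne_zero 2 hv0)
      exact sub_eq_zero.mp this
    have hdeg : b.natDegree = p := by
      have h6 : b = X ^ p + (C (2 * e) - X) := by rw [hb]; ring
      have h7 : (C (2 * e) - X : K[X]).natDegree ≤ 1 := by compute_degree
      rw [h6, natDegree_add_eq_left_of_natDegree_lt (by rw [natDegree_X_pow]; omega),
        natDegree_X_pow]
    have := congrArg natDegree h5
    rw [natDegree_pow, hdeg, natDegree_C] at this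
    omega

lemma CoordDegLE.eq_zero_of_X_pow_dvd {d Q : ℕ} {z : QuadraticAlgebra K[X] a b}
    (hz : CoordDegLE d z) (hd : d < Q)
    (h : algebraMap K[X] (QuadraticAlgebra K[X] a b) (X ^ Q) ∣ z) : z = 0 := by
  rw [QuadraticAlgebra.algebraMap_dvd_iff] at h
  ext1
  · exact eq_zero_of_dvd_of_natDegree_lt h.1 (by rw [natDegree_X_pow]; exact hz.1.trans_lt hd)
  · exact eq_zero_of_dvd_of_natDegree_lt h.2 (by rw [natDegree_X_pow]; exact hz.2.trans_lt hd)

lemma curveRing_charP (p : ℕ) [CharP K p] : CharP (QuadraticAlgebra K[X] a b) p :=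
  charP_of_injective_ringHom (f := (algebraMap K[X] (QuadraticAlgebra K[X] a b)).comp C)
    ((QuadraticAlgebra.algebraMap_injective).comp C_injective) p

lemma curveRing_independent_aux {p : ℕ} [Fact p.Prime] [CharP K p] {e : K}
    (ha : a = -C (e ^ 2)) (hb : b = C (2 * e) + X ^ p - X) (he : e ≠ 0) {k d : ℕ} (hd : 2 * d + p < p ^ k) {z z' : QuadraticAlgebra K[X] a b}
    (hz : CoordDegLE d z) (hz' : CoordDegLE d z')
    (h : algebraMap K[X] (QuadraticAlgebra K[X] a b) (X ^ p ^ k) ∣ z + z' * QuadraticAlgebra.omega ^ p ^ k) :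
    z = 0 ∧ z' = 0 := by
  have hp : p.Prime := Fact.out
  have := curveRing_charP (a := a) (b := b) p
  have hda : a.natDegree ≤ 0 := by rw [ha]; simp
  have hdb : b.natDegree ≤ p := by rw [hb]; exact natDegree_curve_le hp.one_le e
  set Q := p ^ k with hQ
  let A := algebraMap K[X] (QuadraticAlgebra K[X] a b)
  set ω : QuadraticAlgebra K[X] a b := QuadraticAlgebra.omega with hω
  set w : QuadraticAlgebra K[X] a b := ω - A (C e) with hw
  have hωω : ω * ω = A (-C (e ^ 2)) + A (C (2 * e) + X ^ p - X) * ω := by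
    rw [← ha, ← hb, hω, QuadraticAlgebra.omega_mul_omega_eq_add, Algebra.smul_def]
    simp [A, Algebra.smul_def]
  have hwQ : ω ^ Q = w ^ Q + A (C (e ^ Q)) := by
    rw [hw, hQ, sub_pow_char_pow, map_pow, map_pow]; ring
  have hww : w * w = A X * (A (X ^ (p - 1) - 1) * ω) := by
    have : A (X ^ p) = A X * A (X ^ (p - 1)) := by
      rw [← map_mul, ← pow_succ', Nat.sub_add_cancel hp.one_le]
    rw [hw]
    simp only [map_add, map_sub, map_neg, map_mul, map_one, map_ofNat] at hωω this ⊢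
    rw [this] at hωω
    have h5 : A (C (e ^ 2)) = A (C e) ^ 2 := by simp
    rw [h5] at hωω
    linear_combination hωω
  have hwwQ : w ^ Q * w ^ Q = A (X ^ Q) * (A ((X ^ (p - 1) - 1) ^ Q) * ω ^ Q) := by
    rw [← mul_pow, hww, mul_pow, mul_pow, map_pow, map_pow]
  obtain ⟨Z, hZ⟩ : ∃ Z, Z = z + A (C (e ^ Q)) * z' := ⟨_, rfl⟩
  have hZd : CoordDegLE d Z := by
    rw [hZ]
    have := CoordDegLE.C_mul (d := 0) (f := C (e ^ Q)) (by simp) hz'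
    rw [zero_add] at this
    exact ⟨(natDegree_add_le _ _).trans (max_le hz.1 this.1),
      (natDegree_add_le _ _).trans (max_le hz.2 this.2)⟩
  have h' : A (X ^ Q) ∣ Z + z' * w ^ Q := by
    convert h using 1
    rw [hZ, hwQ]; ring
  have hZ0 : Z = 0 := by
    refine curveRing_eq_zero_of_sq hp.one_lt ha hb ?_
    refine (hZd.mul hda hdb hZd).eq_zero_of_X_pow_dvd (Q := Q) (by omega) ?_
    have h6 : A (X ^ Q) ∣ z' ^ 2 * (w ^ Q * w ^ Q) := by
      rw [hwwQ]; exact ⟨z' ^ 2 * (A ((X ^ (p - 1) - 1) ^ Q) * ω ^ Q), by ring⟩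
    have h7 := dvd_add (h'.mul_right (Z - z' * w ^ Q)) h6
    convert h7 using 1
    ring
  have hz'0 : z' = 0 := by
    refine curveRing_eq_zero_of_sq hp.one_lt ha hb ?_
    refine (hz'.mul hda hdb hz').eq_zero_of_X_pow_dvd (Q := Q) (by omega) ?_
    rw [hZ0, zero_add] at h'
    obtain ⟨v, hv⟩ := h'
    have hX : A (X ^ Q) ≠ 0 := by
      simp only [A, ne_eq]
      rw [map_eq_zero_iff _ QuadraticAlgebra.algebraMap_injective]
      exact pow_ne_zero _ X_ne_zero
    have hcancel : ∀ y y' : QuadraticAlgebra K[X] a b, A (X ^ Q) * y = A (X ^ Q) * y' → y = y' := by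
      intro y y' hy
      simp only [A, ← Algebra.smul_def] at hy
      exact smul_right_injective _ (pow_ne_zero Q (X_ne_zero (R := K))) hy
    have h8 : z' * z' * (A ((X ^ (p - 1) - 1) ^ Q) * ω ^ Q) = A (X ^ Q) * (v * v) := by
      apply hcancel
      linear_combination (z' * w ^ Q + A (X ^ Q) * v) * hv - z' * z' * hwwQ
    have h9 : ω * (A (C (2 * e) + X ^ p - X) - ω) = A (C (e ^ 2)) := by
      have : A (-C (e ^ 2)) = - A (C (e ^ 2)) := map_neg _ _
      linear_combination -hωω - this
    have h10 : A (X ^ Q) ∣ A (C (e ^ 2) ^ Q * (X ^ (p - 1) - 1) ^ Q) * (z' * z') := by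
      refine ⟨v * v * (A (C (2 * e) + X ^ p - X) - ω) ^ Q, ?_⟩
      rw [map_mul, map_pow, ← h9, mul_pow]
      linear_combination (A (C (2 * e) + X ^ p - X) - ω) ^ Q * h8
    have hcop : IsCoprime (X ^ Q : K[X]) (C (e ^ 2) ^ Q * (X ^ (p - 1) - 1) ^ Q) := by
      refine IsCoprime.mul_right (IsCoprime.pow ?_) (IsCoprime.pow ?_)
      · exact ⟨0, C ((e ^ 2)⁻¹), by
          rw [zero_mul, zero_add, ← map_mul, inv_mul_cancel₀ (pow_ne_zero 2 he), map_one]⟩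
      · refine ⟨X ^ (p - 2), -1, ?_⟩
        rw [← pow_succ, show p - 2 + 1 = p - 1 by have := hp.two_le; omega]
        ring
    rw [QuadraticAlgebra.algebraMap_dvd_iff] at h10 ⊢
    rw [← Algebra.smul_def, QuadraticAlgebra.re_smul, QuadraticAlgebra.im_smul, smul_eq_mul,
      smul_eq_mul] at h10
    exact ⟨hcop.dvd_of_dvd_mul_left h10.1, hcop.dvd_of_dvd_mul_left h10.2⟩
  refine ⟨?_, hz'0⟩
  rw [hz'0, mul_zero, add_zero] at hZ
  rw [← hZ, hZ0]

lemma curveRing_independent {p : ℕ} [Fact p.Prime] [CharP K p] {e : K}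
    (ha : a = -C (e ^ 2)) (hb : b = C (2 * e) + X ^ p - X) (he : e ≠ 0) {k d : ℕ} (hd : 2 * d + p < p ^ k) (I : ℕ) (u u' : ℕ → QuadraticAlgebra K[X] a b)
    (hu : ∀ i, CoordDegLE d (u i)) (hu' : ∀ i, CoordDegLE d (u' i))
    (h : ∑ i ∈ Finset.range I, algebraMap K[X] (QuadraticAlgebra K[X] a b) (X ^ p ^ k) ^ i *
      (u i + u' i * QuadraticAlgebra.omega ^ p ^ k) = 0) :
    ∀ i < I, u i = 0 ∧ u' i = 0 := by
  induction I generalizing u u' with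
  | zero => simp
  | succ I ih =>
    rw [Finset.sum_range_succ'] at h
    simp only [pow_succ', mul_assoc, ← Finset.mul_sum] at h
    have h0 := curveRing_independent_aux ha hb he hd (hu 0) (hu' 0) (by
      rw [pow_zero, one_mul] at h
      rw [add_comm] at h
      rw [eq_neg_of_add_eq_zero_left h]
      exact (Dvd.intro _ rfl).neg_right)
    rw [h0.1, h0.2, zero_mul, add_zero, mul_zero, add_zero, ← Algebra.smul_def] at h
    have h1 := (smul_eq_zero.mp h).resolve_left (pow_ne_zero _ X_ne_zero)
    have := ih (fun i => u (i + 1)) (fun i => u' (i + 1)) (fun i => hu _) (fun i => hu' _) h1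
    intro i hi
    cases i with
    | zero => exact h0
    | succ i => exact this i (by omega)

/-- More than `2 * M` elements whose coordinates have degree less than `M` are linearly dependent. -/
lemma exists_relation_of_coordDegLE {ι : Type*} {M : ℕ} (S : Finset ι)
    (B : ι → QuadraticAlgebra K[X] a b) (hB : ∀ s ∈ S, CoordDegLE M (B s))
    (hM : 2 * (M + 1) < S.card) :
    ∃ γ : ι → K, ∑ s ∈ S, γ s • B s = 0 ∧ ∃ s ∈ S, γ s ≠ 0 := by
  let v : ι → (Fin (M + 1) → K) × (Fin (M + 1) → K) := fun s =>
    (fun m => (B s).re.coeff m, fun m => (B s).im.coeff m)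
  have hv : ¬ LinearIndepOn K v (S : Set ι) := by
    intro h
    have := h.fintype_card_le_finrank
    simp at this
    omega
  rw [not_linearIndepOn_finset_iff] at hv
  obtain ⟨γ, h0, h1⟩ := hv
  refine ⟨γ, ?_, h1⟩
  have hdeg := CoordDegLE.sum S (fun s => γ s • B s) fun s hs => (hB s hs).C_smul (γ s)
  have hre : ∀ z : ι → QuadraticAlgebra K[X] a b, (∑ s ∈ S, z s).re = ∑ s ∈ S, (z s).re :=
    fun z => map_sum (QuadraticAlgebra.reₗ a b) z S
  have him : ∀ z : ι → QuadraticAlgebra K[X] a b, (∑ s ∈ S, z s).im = ∑ s ∈ S, (z s).im :=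
    fun z => map_sum (QuadraticAlgebra.imₗ a b) z S
  ext1
  · ext m
    by_cases hm : m ≤ M
    · have := congrFun (congrArg Prod.fst h0) ⟨m, by omega⟩
      simpa [v, hre, Prod.fst_sum, Finset.sum_apply, finsetSum_coeff] using this
    · rw [coeff_eq_zero_of_natDegree_lt (by have := hdeg.1; omega)]
      simp
  · ext m
    by_cases hm : m ≤ M
    · have := congrFun (congrArg Prod.snd h0) ⟨m, by omega⟩
      simpa [v, him, Prod.snd_sum, Finset.sum_apply, finsetSum_coeff] using this
    · rw [coeff_eq_zero_of_natDegree_lt (by have := hdeg.2; omega)]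
      simp

lemma coeff_eq_zero_of_sum_omega {J : ℕ} (c : ℕ → ℕ → K)
    (h : ∑ j ∈ Finset.range J, ∑ ε ∈ Finset.range 2, c j ε •
      ((QuadraticAlgebra.omega : QuadraticAlgebra K[X] a b) ^ ε *
        algebraMap K[X] (QuadraticAlgebra K[X] a b) (X ^ j)) = 0) :
    ∀ j < J, ∀ ε < 2, c j ε = 0 := by
  have hre : ∀ z : ℕ → QuadraticAlgebra K[X] a b,
      (∑ s ∈ Finset.range J, z s).re = ∑ s ∈ Finset.range J, (z s).re :=
    fun z => map_sum (QuadraticAlgebra.reₗ a b) z _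
  have him : ∀ z : ℕ → QuadraticAlgebra K[X] a b,
      (∑ s ∈ Finset.range J, z s).im = ∑ s ∈ Finset.range J, (z s).im :=
    fun z => map_sum (QuadraticAlgebra.imₗ a b) z _
  have h1 := congrArg QuadraticAlgebra.re h
  have h2 := congrArg QuadraticAlgebra.im h
  simp only [Finset.sum_range_succ (n := 1), Finset.sum_range_one, hre, him] at h1 h2
  simp [QuadraticAlgebra.algebraMap_eq] at h1 h2
  intro j hj ε hε
  interval_cases ε
  · simpa [finsetSum_coeff, coeff_X_pow, hj] using congrArg (fun f => coeff f j) h1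
  · simpa [finsetSum_coeff, coeff_X_pow, hj] using congrArg (fun f => coeff f j) h2

end Stepanov

section Stepanov

open Polynomial

variable {K : Type*} [Field K] {a b : K[X]}

lemma curveEval_smul (τ x : K) (hx : x ^ 2 = a.eval τ + b.eval τ * x) (c : K)
    (z : QuadraticAlgebra K[X] a b) : curveEval τ x hx (c • z) = c * curveEval τ x hx z := by
  simp [curveEval]; ring

lemma curveEval_omega (τ x : K) (hx : x ^ 2 = a.eval τ + b.eval τ * x) :
    curveEval τ x hx QuadraticAlgebra.omega = x := by
  simp [curveEval]

lemma curveEval_algebraMap (τ x : K) (hx : x ^ 2 = a.eval τ + b.eval τ * x) (f : K[X]) :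
    curveEval τ x hx (algebraMap K[X] _ f) = f.eval τ := by
  simp [curveEval]

lemma exists_auxiliary {p : ℕ} [Fact p.Prime] [CharP K p] [IsAlgClosed K] {e δ : K}
    (ha : a = -C (e ^ 2)) (hb : b = C (2 * e) + X ^ p - X) (he : e ≠ 0) {k I J : ℕ}
    (hJ : 2 * (p + J) + p < p ^ k)
    (hIJ : p * (p ^ k + 1) + (p ^ k * J + I) + 1 < 2 * I * J) :
    ∃ W : QuadraticAlgebra K[X] a b, W ≠ 0 ∧
      CoordDegLE (p * (p ^ k + 1) + (J + p ^ k * I)) W ∧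
      ∀ (τ x : K) (hx : x ^ 2 = a.eval τ + b.eval τ * x), τ ^ (p ^ k) ^ 2 = τ + δ →
        x ^ (p ^ k) ^ 2 = x → curveEval τ x hx W = 0 := by
  have hp : p.Prime := Fact.out
  have hda : a.natDegree ≤ 0 := by rw [ha]; simp
  have hdb : b.natDegree ≤ p := by rw [hb]; exact natDegree_curve_le hp.one_le e
  set Q := p ^ k with hQ
  have hQ0 : 0 < Q := pow_pos hp.pos k
  let A := algebraMap K[X] (QuadraticAlgebra K[X] a b)
  let ω : QuadraticAlgebra K[X] a b := QuadraticAlgebra.omega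
  let S := Finset.range I ×ˢ Finset.range J ×ˢ Finset.range 2 ×ˢ Finset.range 2
  let B : ℕ × ℕ × ℕ × ℕ → QuadraticAlgebra K[X] a b := fun s =>
    ω ^ (Q * s.2.2.1 + s.2.2.2) * (A (X ^ (Q * s.2.1) * (X + C δ) ^ s.1) * 1)
  have hone : CoordDegLE 0 (1 : QuadraticAlgebra K[X] a b) := by
    constructor
    · rw [QuadraticAlgebra.re_one]; simp
    · rw [QuadraticAlgebra.im_one]; simp
  have hB : ∀ s ∈ S, CoordDegLE (p * (Q + 1) + (Q * J + I)) (B s) := by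
    rintro ⟨i, j, ε, ε'⟩ hs
    simp only [S, Finset.mem_product, Finset.mem_range] at hs
    obtain ⟨hi, hj, hε, hε'⟩ := hs
    have h1 : (X ^ (Q * j) * (X + C δ) ^ i : K[X]).natDegree ≤ Q * J + I := by
      refine natDegree_mul_le_of_le ((natDegree_X_pow_le _).trans (Nat.mul_le_mul_left Q hj.le)) ?_
      exact (natDegree_pow_le_of_le i (natDegree_X_add_C δ).le).trans (by omega)
    have h2 := (CoordDegLE.C_mul h1 hone).omega_pow_mul hda hdb (Q * ε + ε')
    refine h2.mono ?_
    have : Q * ε ≤ Q * 1 := Nat.mul_le_mul_left Q (by omega)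
    have : p * (Q * ε + ε') ≤ p * (Q + 1) := Nat.mul_le_mul_left p (by omega)
    omega
  obtain ⟨γ, hγ, s₀, hs₀, hγ0⟩ := exists_relation_of_coordDegLE S B hB (by
    simp only [S, Finset.card_product, Finset.card_range]
    nlinarith)
  choose c hc using fun s => IsAlgClosed.exists_pow_nat_eq (γ s) hQ0
  let u : ℕ → ℕ → QuadraticAlgebra K[X] a b := fun ε' i =>
    ∑ j ∈ Finset.range J, ∑ ε ∈ Finset.range 2, c (i, j, ε, ε') • (ω ^ ε * A (X ^ j))
  have hu : ∀ ε' i, CoordDegLE (p + J) (u ε' i) := by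
    intro ε' i
    refine CoordDegLE.sum _ _ fun j hj => CoordDegLE.sum _ _ fun ε hε => CoordDegLE.C_smul _ ?_
    rw [Finset.mem_range] at hj hε
    have h1 : (X ^ j : K[X]).natDegree ≤ J := (natDegree_X_pow_le _).trans hj.le
    have h2 := (CoordDegLE.C_mul h1 hone).omega_pow_mul hda hdb ε
    rw [mul_one] at h2
    refine h2.mono ?_
    have : p * ε ≤ p * 1 := Nat.mul_le_mul_left p (by omega)
    omega
  refine ⟨∑ i ∈ Finset.range I, A (X ^ Q) ^ i * (u 0 i + u 1 i * ω ^ Q), ?_, ?_, ?_⟩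
  · intro hW
    have h1 := curveRing_independent ha hb he hJ I (u 0) (u 1) (hu 0) (hu 1) hW
    obtain ⟨i, j, ε, ε'⟩ := s₀
    simp only [S, Finset.mem_product, Finset.mem_range] at hs₀
    obtain ⟨hi, hj, hε, hε'⟩ := hs₀
    have h2 : u ε' i = 0 := by
      interval_cases ε'
      · exact (h1 i hi).1
      · exact (h1 i hi).2
    have h3 := coeff_eq_zero_of_sum_omega (fun j ε => c (i, j, ε, ε')) h2 j hj ε hε
    apply hγ0
    rw [← hc, h3, zero_pow hQ0.ne']
  · refine CoordDegLE.sum _ _ fun i hi => ?_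
    rw [Finset.mem_range] at hi
    have h0 : (X ^ (Q * i) : K[X]).natDegree ≤ Q * I :=
      (natDegree_X_pow_le _).trans (Nat.mul_le_mul_left Q hi.le)
    have h1 := (hu 0 i)
    have h2 := (hu 1 i).omega_pow_mul hda hdb Q
    have h3 : CoordDegLE (p * Q + (p + J)) (u 0 i + u 1 i * ω ^ Q) := by
      rw [mul_comm (u 1 i)]
      have h1' := h1.mono (show p + J ≤ p * Q + (p + J) by omega)
      exact ⟨(natDegree_add_le _ _).trans (max_le h1'.1 h2.1),
        (natDegree_add_le _ _).trans (max_le h1'.2 h2.2)⟩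
    have h4 := CoordDegLE.C_mul h0 h3
    rw [pow_mul, map_pow] at h4
    exact h4.mono (by rw [Nat.mul_add]; omega)
  · intro τ x hx hτ hxq
    set ev := curveEval τ x hx with hev
    have hevω : ev ω = x := curveEval_omega τ x hx
    have hevA : ∀ f, ev (A f) = f.eval τ := curveEval_algebraMap τ x hx
    have hsmul : ∀ (c : K) z, ev (c • z) = c * ev z := curveEval_smul τ x hx
    have hzero := congrArg ev hγ
    rw [map_zero, map_sum] at hzero
    refine pow_eq_zero_iff hQ0.ne' |>.mp (Eq.trans ?_ hzero)
    simp only [S, Finset.sum_product]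
    simp only [map_sum, map_mul, map_add, map_pow, hsmul, hevA, hevω, hQ, sum_pow_char_pow, mul_pow,
      add_pow_char_pow, B, u, eval_X, eval_C, map_one]
    simp only [← hQ, hc, Finset.sum_range_succ (n := 1), Finset.sum_range_one]
    refine Finset.sum_congr rfl fun i _ => ?_
    rw [Finset.sum_mul, ← Finset.sum_add_distrib, Finset.mul_sum]
    refine Finset.sum_congr rfl fun j _ => ?_
    have h1 : ((τ ^ Q) ^ i) ^ Q = (τ + δ) ^ i := by rw [← hτ]; ring
    have h2 : (x ^ Q) ^ Q = x := by rw [← pow_mul, ← sq, hxq]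
    rw [h1, h2]
    ring

/-- At most about half of the `F_{Q²}`-rational values of `τ` lie below a pair of rational points
of the curve. -/
theorem card_le_of_rational_fibres {p : ℕ} [Fact p.Prime] (hp3 : 3 ≤ p) [CharP K p]
    [IsAlgClosed K] {e δ : K} (he : e ≠ 0) {k : ℕ} (hk : 8 * p ≤ p ^ k) (T : Finset K)
    (hT : ∀ τ ∈ T, τ ^ (p ^ k) ^ 2 = τ + δ)
    (hTx : ∀ τ ∈ T, ∀ x : K, x ^ 2 = (2 * e + τ ^ p - τ) * x - e ^ 2 → x ^ (p ^ k) ^ 2 = x)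
    (hTd : ∀ τ ∈ T, (2 * e + τ ^ p - τ) ^ 2 ≠ 4 * e ^ 2) :
    2 * T.card ≤ (p ^ k) ^ 2 + (10 * p + 3) * p ^ k := by
  set Q := p ^ k with hQ
  obtain ⟨J, hJ⟩ : ∃ J, J = Q / 4 := ⟨_, rfl⟩
  obtain ⟨I, hI⟩ : ∃ I, I = (Q + 1) / 2 + 4 * p := ⟨_, rfl⟩
  have hJ1 : 4 * J ≤ Q := by omega
  have hJ2 : Q ≤ 4 * J + 3 := by omega
  have hI1 : Q + 8 * p ≤ 2 * I := by omega
  have hI2 : 2 * I ≤ Q + 1 + 8 * p := by omega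
  have hJ3 : 2 * p ≤ J := by omega
  have h2 : (2 : K) ≠ 0 := by
    intro h
    have h' : ((2 : ℕ) : K) = 0 := by exact_mod_cast h
    rw [CharP.cast_eq_zero_iff K p] at h'
    have := Nat.le_of_dvd (by norm_num) h'
    omega
  obtain ⟨W, hW0, hWd, hW⟩ := exists_auxiliary (K := K) (δ := δ) (a := -C (e ^ 2))
    (b := C (2 * e) + X ^ p - X) rfl rfl he (k := k) (I := I) (J := J) (by omega) (by
      rw [← hQ]
      have h3 : (Q + 8 * p) * J ≤ 2 * I * J := Nat.mul_le_mul_right J hI1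
      have h4 : p * Q ≤ p * (4 * J + 3) := Nat.mul_le_mul_left p hJ2
      have h5 : 3 * J ≤ p * J := Nat.mul_le_mul_right J hp3
      nlinarith)
  have hzero : ∀ τ ∈ T, W.re.eval τ = 0 ∧ W.im.eval τ = 0 := by
    intro τ hτ
    set s := 2 * e + τ ^ p - τ with hs
    obtain ⟨r, hr⟩ := IsAlgClosed.exists_pow_nat_eq (s ^ 2 - 4 * e ^ 2) (n := 2) (by norm_num)
    have hr0 : r ≠ 0 := by
      rintro rfl
      exact hTd τ hτ (by linear_combination -hr)
    have key : ∀ r : K, r ^ 2 = s ^ 2 - 4 * e ^ 2 →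
        W.re.eval τ + W.im.eval τ * ((s + r) / 2) = 0 := by
      intro r hr
      have hx : ((s + r) / 2) ^ 2 = s * ((s + r) / 2) - e ^ 2 := by
        field_simp
        linear_combination hr
      exact hW τ ((s + r) / 2) (by simp [← hs]; linear_combination hx) (hT τ hτ) (hTx τ hτ _ hx)
    have k1 := key r hr
    have k2 := key (-r) (by rw [neg_sq, hr])
    have him : W.im.eval τ = 0 := by
      have : W.im.eval τ * r = 0 := by
        field_simp at k1 k2
        have : (2 : K) * (W.im.eval τ * r) = 0 := by linear_combination k1 - k2
        exact (mul_eq_zero.mp this).resolve_left h2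
      exact (mul_eq_zero.mp this).resolve_right hr0
    refine ⟨?_, him⟩
    rw [him, zero_mul, add_zero] at k1
    exact k1
  have hcard : T.card ≤ p * (Q + 1) + (J + Q * I) := by
    by_cases hre : W.re = 0
    · have him : W.im ≠ 0 := fun h => hW0 (by ext1 <;> simp [hre, h])
      refine (card_le_degree_of_subset_roots (p := W.im) fun τ hτ => ?_).trans hWd.2
      exact (mem_roots him).mpr (hzero τ hτ).2
    · refine (card_le_degree_of_subset_roots (p := W.re) fun τ hτ => ?_).trans hWd.1
      exact (mem_roots hre).mpr (hzero τ hτ).1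
  have h6 : Q * (2 * I) ≤ Q * (Q + 1 + 8 * p) := Nat.mul_le_mul_left Q hI2
  nlinarith

end Stepanov

section PointCount

open Polynomial

variable {F : Type*} [Field F] [Finite F] {p : ℕ} [Fact p.Prime] [Algebra (ZMod p) F]

omit [Finite F] [Algebra (ZMod p) F] in
lemma card_roots_artinSchreier_le (y : F) (S : Finset F) (hS : ∀ t ∈ S, t ^ p - t = y) :
    S.card ≤ p := by
  have hp : p.Prime := Fact.out
  have hdeg : (X ^ p - X - C y : F[X]).natDegree = p := by
    rw [natDegree_sub_C]
    exact FiniteField.X_pow_card_sub_X_natDegree_eq F hp.one_lt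
  have hne : (X ^ p - X - C y : F[X]) ≠ 0 := by
    intro h
    rw [h, natDegree_zero] at hdeg
    exact hp.ne_zero hdeg.symm
  refine (card_le_degree_of_subset_roots (p := X ^ p - X - C y) fun t ht => ?_).trans hdeg.le
  rw [mem_roots hne]
  simp [hS t ht]

lemma exists_artinSchreier_of_trace_eq_zero (y : F) (hy : Algebra.trace (ZMod p) F y = 0) :
    ∃ t : F, t ^ p - t = y := by
  classical
  have hp : p.Prime := Fact.out
  have := Fintype.ofFinite F
  let φ : F →ₗ[ZMod p] F := (FiniteField.frobeniusAlgHom (ZMod p) F).toLinearMap - LinearMap.id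
  have hφ : ∀ t, φ t = t ^ p - t := fun t => by simp [φ, ZMod.card]
  have hker : Module.finrank (ZMod p) (LinearMap.ker φ) ≤ 1 := by
    have h1 : Nat.card (LinearMap.ker φ) ≤ p := by
      have := card_roots_artinSchreier_le (p := p) (0 : F) (LinearMap.ker φ : Set F).toFinset
        (fun t ht => by
          rw [← hφ]; simpa using ht)
      rwa [← Set.ncard_eq_toFinset_card'] at this
    have h2 := Module.natCard_eq_pow_finrank (K := ZMod p) (V := LinearMap.ker φ)
    rw [h2, Nat.card_zmod] at h1
    by_contra h
    push Not at h
    have := Nat.pow_lt_pow_right hp.one_lt h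
    simp at this
    omega
  have hle : LinearMap.range φ ≤ LinearMap.ker (Algebra.trace (ZMod p) F) := by
    rintro _ ⟨t, rfl⟩
    have h1 : Algebra.trace (ZMod p) F (FiniteField.frobeniusAlgEquivOfAlgebraic (ZMod p) F t)
      = Algebra.trace (ZMod p) F t := Algebra.trace_eq_of_algEquiv _ _
    rw [LinearMap.mem_ker, hφ, map_sub, sub_eq_zero, ← h1]
    simp [ZMod.card]
  have hsurj := Algebra.trace_surjective (ZMod p) F
  have e1 := LinearMap.finrank_range_add_finrank_ker φ
  have e2 := LinearMap.finrank_range_add_finrank_ker (Algebra.trace (ZMod p) F)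
  rw [LinearMap.range_eq_top.mpr hsurj, finrank_top, Module.finrank_self] at e2
  have := Submodule.eq_of_le_of_finrank_le hle (by omega)
  have hy' : y ∈ LinearMap.range φ := by rw [this]; exact hy
  obtain ⟨t, ht⟩ := hy'
  exact ⟨t, by rw [← hφ, ht]⟩

lemma card_artinSchreier_fibre [Fintype F] [DecidableEq F] (y : F)
    (hy : Algebra.trace (ZMod p) F y = 0) :
    p ≤ (Finset.univ.filter fun t : F => t ^ p - t = y).card := by
  have hp : p.Prime := Fact.out
  obtain ⟨t, ht⟩ := exists_artinSchreier_of_trace_eq_zero y hy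
  have hch : CharP F p := charP_of_injective_algebraMap (algebraMap (ZMod p) F).injective p
  have : (Finset.univ.image fun j : ZMod p => t + algebraMap (ZMod p) F j).card = p := by
    rw [Finset.card_image_of_injective, Finset.card_univ, ZMod.card]
    intro i j h
    exact (algebraMap (ZMod p) F).injective (add_left_cancel h)
  refine this.ge.trans (Finset.card_le_card ?_)
  intro s hs
  rw [Finset.mem_image] at hs
  obtain ⟨j, -, rfl⟩ := hs
  have hj : (algebraMap (ZMod p) F j) ^ p = algebraMap (ZMod p) F j := by
    rw [← map_pow, ZMod.pow_card]
  rw [Finset.mem_filter]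
  refine ⟨Finset.mem_univ _, ?_⟩
  rw [add_pow_char, hj, ← ht]
  ring

lemma card_trace_fibre_le [Fintype F] [DecidableEq F] (hp3 : 3 ≤ p) {k : ℕ} (hk : 8 * p ≤ p ^ k)
    (hF : Fintype.card F = (p ^ k) ^ 2) {c : F} (hc : c ≠ 0) (r : ZMod p) :
    p * (Finset.univ.filter fun x : F => x ≠ 0 ∧ Algebra.trace (ZMod p) F (x + c / x) = r).card ≤
      (p ^ k) ^ 2 + (14 * p + 3) * p ^ k := by
  have hp : p.Prime := Fact.out
  have hch : CharP F p := charP_of_injective_algebraMap (algebraMap (ZMod p) F).injective p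
  obtain ⟨y, hy⟩ := Algebra.trace_surjective (ZMod p) F r
  set N := Finset.univ.filter fun x : F => x ≠ 0 ∧ Algebra.trace (ZMod p) F (x + c / x) = r with hN
  let T₁ := Finset.univ.filter fun t : F => ∃ x : F, x ≠ 0 ∧ x ^ 2 - (t ^ p - t + y) * x + c = 0
  have hquad : ∀ t : F, (Finset.univ.filter fun x : F => x ^ 2 - (t ^ p - t + y) * x + c = 0).card
      ≤ 2 := by
    intro t
    have hd : (X ^ 2 - C (t ^ p - t + y) * X + C c : F[X]).natDegree = 2 := by
      compute_degree!
    have hne : (X ^ 2 - C (t ^ p - t + y) * X + C c : F[X]) ≠ 0 := by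
      intro h; rw [h] at hd; simp at hd
    refine (card_le_degree_of_subset_roots
      (p := X ^ 2 - C (t ^ p - t + y) * X + C c) fun x hx => ?_).trans hd.le
    rw [mem_roots hne]
    simpa using hx
  have hpN : p * N.card ≤ 2 * T₁.card := by
    rw [mul_comm p, mul_comm 2]
    refine Finset.card_mul_le_card_mul (fun x t : F => t ^ p - t = x + c / x - y) ?_ ?_
    · intro x hx
      simp only [hN, Finset.mem_filter, Finset.mem_univ, true_and] at hx
      refine (card_artinSchreier_fibre (x + c / x - y)
        (by rw [map_sub, hx.2, hy, sub_self])).trans (Finset.card_le_card ?_)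
      intro t ht
      simp only [T₁, Finset.mem_bipartiteAbove, Finset.mem_filter, Finset.mem_univ, true_and]
        at ht ⊢
      refine ⟨⟨x, hx.1, ?_⟩, ht⟩
      rw [ht]
      field_simp [hx.1]
      ring
    · intro t ht
      refine le_trans (Finset.card_le_card ?_) (hquad t)
      intro x hx
      simp only [hN, Finset.mem_bipartiteBelow, Finset.mem_filter, Finset.mem_univ, true_and]
        at hx ⊢
      rw [hx.2]
      field_simp [hx.1.1]
      ring
  -- passage to the algebraic closure
  classical
  let K := AlgebraicClosure F
  let ι := algebraMap F K
  have hι : Function.Injective ι := ι.injective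
  have hchK : CharP K p := charP_of_injective_algebraMap hι p
  obtain ⟨e, he⟩ := IsAlgClosed.exists_pow_nat_eq (ι c) (n := 2) (by norm_num)
  have he0 : e ≠ 0 := by
    rintro rfl
    apply hc
    apply hι
    rw [← he]; simp
  obtain ⟨t₀, ht₀⟩ : ∃ t₀ : K, t₀ ^ p - t₀ + ι y = 2 * e := by
    have hdeg : (X ^ p - X - C (2 * e - ι y) : K[X]).natDegree = p := by
      rw [natDegree_sub_C]
      exact FiniteField.X_pow_card_sub_X_natDegree_eq K hp.one_lt
    obtain ⟨t, ht⟩ := IsAlgClosed.exists_root (X ^ p - X - C (2 * e - ι y) : K[X])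
      (by rw [degree_eq_natDegree (by intro h; rw [h] at hdeg; simp at hdeg; exact hp.ne_zero hdeg.symm), hdeg]
          exact_mod_cast hp.ne_zero)
    refine ⟨t, ?_⟩
    simp [IsRoot] at ht
    linear_combination ht
  let G := T₁.filter fun t => (t ^ p - t + y) ^ 2 ≠ 4 * c
  let E := T₁.filter fun t => ¬ (t ^ p - t + y) ^ 2 ≠ 4 * c
  have hGE : G.card + E.card = T₁.card := Finset.card_filter_add_card_filter_not _
  have hlin : ∀ t : F, 2 * e + (ι t - t₀) ^ p - (ι t - t₀) = ι (t ^ p - t + y) := by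
    intro t
    rw [sub_pow_char, map_add, map_sub, map_pow]
    linear_combination -ht₀
  have hq : ∀ t : F, t ^ (p ^ k) ^ 2 = t := fun t => by rw [← hF]; exact FiniteField.pow_card t
  have hE : E.card ≤ 2 * p := by
    have hE' : ∀ t ∈ E, (t ^ p - t + y) ^ 2 = 4 * c := fun t ht => by
      simp only [E, Finset.mem_filter, not_not] at ht
      exact ht.2
    clear_value E
    have hsub : E ⊆ (E.filter fun t => ι (t ^ p - t) = 2 * e - ι y) ∪
        (E.filter fun t => ι (t ^ p - t) = - (2 * e) - ι y) := by
      intro t ht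
      have h1 : (ι (t ^ p - t) - (2 * e - ι y)) * (ι (t ^ p - t) - (-(2 * e) - ι y)) = 0 := by
        have := congrArg ι (hE' t ht)
        simp only [map_sub, map_add, map_mul, map_pow, map_ofNat] at this ⊢
        linear_combination this - 4 * he
      rw [Finset.mem_union, Finset.mem_filter, Finset.mem_filter]
      rcases mul_eq_zero.mp h1 with h | h
      · exact Or.inl ⟨ht, sub_eq_zero.mp h⟩
      · exact Or.inr ⟨ht, sub_eq_zero.mp h⟩
    have hfib : ∀ z : K, (E.filter fun t => ι (t ^ p - t) = z).card ≤ p := by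
      intro z
      rcases (E.filter fun t => ι (t ^ p - t) = z).eq_empty_or_nonempty with h | ⟨s, hs⟩
      · rw [h]
        simp
      · refine card_roots_artinSchreier_le (s ^ p - s) _ fun t ht => ?_
        rw [Finset.mem_filter] at hs ht
        exact hι (ht.2.trans hs.2.symm)
    refine (Finset.card_le_card hsub).trans ((Finset.card_union_le _ _).trans ?_)
    linarith [hfib (2 * e - ι y), hfib (- (2 * e) - ι y)]
  have hG : 2 * G.card ≤ (p ^ k) ^ 2 + (10 * p + 3) * p ^ k := by
    have hinj : Function.Injective fun t : F => ι t - t₀ := fun s t h => hι (by simpa using h)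
    rw [← Finset.card_image_of_injective G hinj]
    apply card_le_of_rational_fibres hp3 he0 (δ := t₀ - t₀ ^ (p ^ k) ^ 2) hk
    · intro τ hτ
      obtain ⟨t, ht, rfl⟩ := Finset.mem_image.mp hτ
      rw [← pow_mul, sub_pow_char_pow, pow_mul, ← map_pow, hq]
      ring
    · intro τ hτ x hx
      obtain ⟨t, ht, rfl⟩ := Finset.mem_image.mp hτ
      rw [hlin] at hx
      simp only [G, T₁, Finset.mem_filter] at ht
      obtain ⟨x', hx'0, hx'⟩ := ht.1.2
      have h1 : (x - ι x') * (x - ι (t ^ p - t + y - x')) = 0 := by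
        have := congrArg ι hx'
        simp only [map_sub, map_add, map_mul, map_pow, map_zero] at this hx ⊢
        linear_combination hx - he - this
      rcases mul_eq_zero.mp h1 with h | h
      · rw [sub_eq_zero.mp h, ← map_pow, hq]
      · rw [sub_eq_zero.mp h, ← map_pow, hq]
    · intro τ hτ
      obtain ⟨t, ht, rfl⟩ := Finset.mem_image.mp hτ
      rw [hlin, he]
      simp only [G, Finset.mem_filter] at ht
      intro h
      apply ht.2
      apply hι
      rw [map_mul, map_ofNat, map_pow, h]
  have hQ : 1 ≤ p ^ k := Nat.one_le_pow _ _ hp.pos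
  nlinarith [Nat.mul_le_mul_left p hQ]

lemma norm_sum_trace_le [Fintype F] [DecidableEq F] (hp3 : 3 ≤ p) {k : ℕ} (hk : 8 * p ≤ p ^ k)
    (hF : Fintype.card F = (p ^ k) ^ 2) {c : F} (hc : c ≠ 0) {ψ : AddChar (ZMod p) ℂ}
    (hψ : ψ ≠ 1) :
    ‖∑ x : F with x ≠ 0, ψ (Algebra.trace (ZMod p) F (x + c / x))‖ ≤
      (14 * p + 4) * (p : ℝ) ^ k := by
  have hp : p.Prime := Fact.out
  have hp0 : (0 : ℝ) < p := by exact_mod_cast hp.pos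
  set N : ZMod p → ℕ := fun r =>
    (Finset.univ.filter fun x : F => x ≠ 0 ∧ Algebra.trace (ZMod p) F (x + c / x) = r).card with hN
  set B : ℝ := (((p : ℝ) ^ k) ^ 2 + (14 * p + 3) * (p : ℝ) ^ k) / p with hB
  have hNB : ∀ r, (N r : ℝ) ≤ B := by
    intro r
    have h := card_trace_fibre_le hp3 hk hF hc r
    rw [hB, le_div_iff₀ hp0, mul_comm]
    exact_mod_cast h
  have hsum : ∑ r, (N r : ℝ) = ((p : ℝ) ^ k) ^ 2 - 1 := by
    have h1 : (Finset.univ.filter fun x : F => x ≠ 0).card = ∑ r, N r := by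
      rw [Finset.card_eq_sum_card_fiberwise
        (f := fun x => Algebra.trace (ZMod p) F (x + c / x)) (t := Finset.univ) (by simp)]
      simp [hN, Finset.filter_filter]
    have h2 : (Finset.univ.filter fun x : F => x ≠ 0).card + 1 = (p ^ k) ^ 2 := by
      rw [← hF, Finset.filter_ne', Finset.card_erase_of_mem (Finset.mem_univ _), Finset.card_univ]
      exact Nat.sub_add_cancel Fintype.card_pos
    have h3 : (∑ r, N r) + 1 = (p ^ k) ^ 2 := by rw [← h1, h2]
    rw [eq_sub_iff_add_eq]
    exact_mod_cast h3
  have hfib : ∑ x : F with x ≠ 0, ψ (Algebra.trace (ZMod p) F (x + c / x)) =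
      ∑ r, (N r : ℂ) * ψ r := by
    rw [← Finset.sum_fiberwise_of_maps_to (g := fun x => Algebra.trace (ZMod p) F (x + c / x))
      (t := Finset.univ) (by simp)]
    refine Finset.sum_congr rfl fun r _ => ?_
    rw [Finset.sum_congr rfl (g := fun _ => ψ r) (by
      intro x hx
      rw [(Finset.mem_filter.mp hx).2])]
    simp [hN, Finset.filter_filter]
  have h0 : ∑ r, ψ r = 0 := AddChar.sum_eq_zero_of_ne_one hψ
  have : ∑ r, (N r : ℂ) * ψ r = -∑ r, ((B - N r : ℝ) : ℂ) * ψ r := by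
    have : ∑ r, ((B - N r : ℝ) : ℂ) * ψ r = B * ∑ r, ψ r - ∑ r, (N r : ℂ) * ψ r := by
      rw [Finset.mul_sum, ← Finset.sum_sub_distrib]
      refine Finset.sum_congr rfl fun r _ => ?_
      push_cast
      ring
    rw [this, h0]
    ring
  rw [hfib, this, norm_neg]
  refine (norm_sum_le _ _).trans ?_
  have hQ : 1 ≤ (p : ℝ) ^ k := one_le_pow₀ (by exact_mod_cast hp.one_le)
  calc ∑ r, ‖((B - N r : ℝ) : ℂ) * ψ r‖ = ∑ r, (B - N r) := by
        refine Finset.sum_congr rfl fun r _ => ?_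
        rw [norm_mul, AddChar.norm_apply, mul_one, Complex.norm_real, Real.norm_of_nonneg]
        linarith [hNB r]
    _ = p * B - (((p : ℝ) ^ k) ^ 2 - 1) := by
        rw [Finset.sum_sub_distrib, hsum]
        simp [ZMod.card]
    _ ≤ (14 * p + 4) * (p : ℝ) ^ k := by
        rw [hB, mul_div_cancel₀ _ hp0.ne']
        nlinarith

end PointCount

section EulerProduct

open Polynomial UniqueFactorizationMonoid

variable {k : Type*} [Field k] [Finite k]

lemma finite_setOf_monic_natDegree_eq (n : ℕ) :
    {h : k[X] | h.Monic ∧ h.natDegree = n}.Finite := by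
  have : Finite (degreeLT k n) := Finite.of_equiv _ (degreeLTEquiv k n).symm.toEquiv
  exact Finite.of_equiv _ (monicEquivDegreeLT (R := k) n).symm

/-- The finite set of monic polynomials of degree `n` over a finite field. -/
noncomputable def monics (k : Type*) [Field k] [Finite k] (n : ℕ) : Finset k[X] :=
  (finite_setOf_monic_natDegree_eq n).toFinset

lemma mem_monics {n : ℕ} {h : k[X]} : h ∈ monics k n ↔ h.Monic ∧ h.natDegree = n := by
  simp [monics]

open scoped Classical in
/-- The finite set of monic irreducible polynomials of degree at most `n`. -/
noncomputable def monicPrimes (k : Type*) [Field k] [Finite k] (n : ℕ) : Finset k[X] :=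
  ((Finset.range (n + 1)).biUnion (monics k)).filter Irreducible

lemma mem_monicPrimes {n : ℕ} {P : k[X]} :
    P ∈ monicPrimes k n ↔ P.Monic ∧ P.natDegree ≤ n ∧ Irreducible P := by
  simp only [monicPrimes, Finset.mem_filter, Finset.mem_biUnion, Finset.mem_range, mem_monics]
  constructor
  · rintro ⟨⟨d, hd, hm, rfl⟩, hi⟩
    exact ⟨hm, by omega, hi⟩
  · rintro ⟨hm, hd, hi⟩
    exact ⟨⟨_, by omega, hm, rfl⟩, hi⟩

open scoped Classical in
lemma sum_natDegree_monicPrimes {n : ℕ} {h : k[X]} (hh : h ∈ monics k n) :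
    ∑ P ∈ monicPrimes k n, ∑ m ∈ Finset.Icc 1 n, (if P ^ m ∣ h then P.natDegree else 0) = n := by
  obtain ⟨hm, hn⟩ := mem_monics.mp hh
  have h0 : h ≠ 0 := hm.ne_zero
  have hsub : (normalizedFactors h).toFinset ⊆ monicPrimes k n := by
    intro P hP
    have hP' := Multiset.mem_toFinset.mp hP
    have hi := irreducible_of_normalized_factor _ hP'
    have hPm : P.Monic := by
      rw [← normalize_normalized_factor _ hP']
      exact monic_normalize hi.ne_zero
    exact mem_monicPrimes.mpr
      ⟨hPm, hn ▸ natDegree_le_of_dvd (dvd_of_mem_normalizedFactors hP') h0, hi⟩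
  have hinner : ∀ P ∈ monicPrimes k n,
      ∑ m ∈ Finset.Icc 1 n, (if P ^ m ∣ h then P.natDegree else 0) =
        (normalizedFactors h).count P * P.natDegree := by
    intro P hP
    obtain ⟨hPm, -, hi⟩ := mem_monicPrimes.mp hP
    have hdvd : ∀ m, P ^ m ∣ h ↔ m ≤ (normalizedFactors h).count P := by
      intro m
      rw [pow_dvd_iff_le_emultiplicity, emultiplicity_eq_count_normalizedFactors hi h0,
        hPm.normalize_eq_self]
      simp
    have hcn : (normalizedFactors h).count P ≤ n := by
      have := natDegree_le_of_dvd ((hdvd _).mpr le_rfl) h0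
      rw [natDegree_pow, hn] at this
      exact (Nat.le_mul_of_pos_right _ hi.natDegree_pos).trans this
    rw [← Finset.sum_filter, Finset.sum_const, smul_eq_mul]
    congr 1
    have : (Finset.Icc 1 n).filter (fun m => P ^ m ∣ h) =
        Finset.Icc 1 ((normalizedFactors h).count P) := by
      ext m
      simp only [Finset.mem_filter, Finset.mem_Icc, hdvd]
      omega
    rw [this]
    simp
  rw [Finset.sum_congr rfl hinner]
  have hprod : h = (normalizedFactors h).prod := by
    rw [prod_normalizedFactors_eq h0, hm.normalize_eq_self]
  conv_rhs => rw [← hn, hprod, natDegree_multiset_prod _ (zero_notMem_normalizedFactors h),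
    Finset.sum_multiset_map_count]
  symm
  refine Finset.sum_subset hsub fun P _ hP => ?_
  rw [Multiset.count_eq_zero_of_notMem fun h => hP (Multiset.mem_toFinset.mpr h), zero_smul]

variable (Λ : k[X] → ℂ)

open scoped Classical in
lemma sum_monics_pow_dvd (hmul : ∀ f g : k[X], f.Monic → g.Monic → Λ (f * g) = Λ f * Λ g)
    (h1 : Λ 1 = 1) {P : k[X]} (hP : P.Monic) (n m : ℕ) :
    ∑ h ∈ monics k n, (if P ^ m ∣ h then Λ h else 0) =
      if m * P.natDegree ≤ n then Λ P ^ m * ∑ h ∈ monics k (n - m * P.natDegree), Λ h else 0 := by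
  have hpow : ∀ m, Λ (P ^ m) = Λ P ^ m := by
    intro m
    induction m with
    | zero => simp [h1]
    | succ m ih => rw [pow_succ, hmul _ _ (hP.pow m) hP, ih, pow_succ]
  rw [← Finset.sum_filter]
  split_ifs with hle
  · rw [Finset.mul_sum]
    symm
    refine Finset.sum_bij (fun g _ => P ^ m * g) ?_ ?_ ?_ ?_
    · intro g hg
      obtain ⟨hgm, hgd⟩ := mem_monics.mp hg
      rw [Finset.mem_filter, mem_monics]
      refine ⟨⟨(hP.pow m).mul hgm, ?_⟩, dvd_mul_right _ _⟩
      rw [(hP.pow m).natDegree_mul hgm, natDegree_pow, hgd]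
      omega
    · intro g _ g' _ h
      exact mul_left_cancel₀ (hP.pow m).ne_zero h
    · intro h hh
      rw [Finset.mem_filter, mem_monics] at hh
      obtain ⟨⟨hm, hd⟩, g, rfl⟩ := hh
      have hgm := (hP.pow m).of_mul_monic_left hm
      refine ⟨g, mem_monics.mpr ⟨hgm, ?_⟩, rfl⟩
      rw [(hP.pow m).natDegree_mul hgm, natDegree_pow] at hd
      omega
    · intro g hg
      rw [hmul _ _ (hP.pow m) (mem_monics.mp hg).1, hpow]
  · rw [Finset.filter_false_of_mem, Finset.sum_empty]
    intro h hh hdvd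
    obtain ⟨hm, hd⟩ := mem_monics.mp hh
    have := natDegree_le_of_dvd hdvd hm.ne_zero
    rw [natDegree_pow] at this
    omega

lemma sum_Icc_multiples {d n : ℕ} (hd : 0 < d) (f : ℕ → ℕ → ℂ) :
    ∑ m ∈ Finset.Icc 1 n, (if m * d ≤ n then f (m * d) m else 0) =
      ∑ j ∈ Finset.Icc 1 n, if d ∣ j then f j (j / d) else 0 := by
  rw [← Finset.sum_filter, ← Finset.sum_filter]
  refine Finset.sum_bij (fun m _ => m * d) ?_ ?_ ?_ ?_
  · intro m hm
    simp only [Finset.mem_filter, Finset.mem_Icc] at hm ⊢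
    exact ⟨⟨by nlinarith, hm.2⟩, dvd_mul_left _ _⟩
  · intro m _ m' _ h
    exact Nat.eq_of_mul_eq_mul_right hd h
  · intro j hj
    simp only [Finset.mem_filter, Finset.mem_Icc] at hj
    obtain ⟨⟨h1, h2⟩, m, rfl⟩ := hj
    refine ⟨m, ?_, mul_comm _ _⟩
    simp only [Finset.mem_filter, Finset.mem_Icc]
    rw [mul_comm m d]
    refine ⟨⟨?_, ?_⟩, h2⟩
    · by_contra h
      simp at h
      simp [h] at h1
    · nlinarith
  · intro m _
    rw [Nat.mul_div_cancel _ hd]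

open scoped Classical in
/-- The logarithmic derivative of the Euler product of a completely multiplicative function. -/
lemma natCast_mul_sum_monics
    (hmul : ∀ f g : k[X], f.Monic → g.Monic → Λ (f * g) = Λ f * Λ g)
    (h1 : Λ 1 = 1) (n : ℕ) :
    n * ∑ h ∈ monics k n, Λ h =
      ∑ j ∈ Finset.Icc 1 n,
        (∑ P ∈ monicPrimes k n, if P.natDegree ∣ j then
          P.natDegree * Λ P ^ (j / P.natDegree) else 0) * ∑ h ∈ monics k (n - j), Λ h := by
  calc n * ∑ h ∈ monics k n, Λ h
      = ∑ h ∈ monics k n, ∑ P ∈ monicPrimes k n, ∑ m ∈ Finset.Icc 1 n,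
          (P.natDegree : ℂ) * (if P ^ m ∣ h then Λ h else 0) := by
        rw [Finset.mul_sum]
        refine Finset.sum_congr rfl fun h hh => ?_
        have := congrArg (Nat.cast : ℕ → ℂ) (sum_natDegree_monicPrimes hh)
        rw [← this]
        push_cast
        rw [Finset.sum_mul]
        refine Finset.sum_congr rfl fun P _ => ?_
        rw [Finset.sum_mul]
        refine Finset.sum_congr rfl fun m _ => ?_
        split_ifs <;> simp
    _ = ∑ P ∈ monicPrimes k n, ∑ m ∈ Finset.Icc 1 n, (if m * P.natDegree ≤ n then
          P.natDegree * Λ P ^ m * ∑ h ∈ monics k (n - m * P.natDegree), Λ h else 0) := by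
        rw [Finset.sum_comm]
        refine Finset.sum_congr rfl fun P hP => ?_
        rw [Finset.sum_comm]
        refine Finset.sum_congr rfl fun m _ => ?_
        rw [← Finset.mul_sum, sum_monics_pow_dvd Λ hmul h1 (mem_monicPrimes.mp hP).1]
        split_ifs <;> ring
    _ = _ := by
        rw [Finset.sum_congr rfl fun P hP => sum_Icc_multiples
          (mem_monicPrimes.mp hP).2.2.natDegree_pos
          (fun j m => P.natDegree * Λ P ^ m * ∑ h ∈ monics k (n - j), Λ h), Finset.sum_comm]
        refine Finset.sum_congr rfl fun j _ => ?_
        rw [Finset.sum_mul]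
        refine Finset.sum_congr rfl fun P _ => ?_
        split_ifs <;> ring

end EulerProduct

section LFunction

open Polynomial

lemma minpoly_inv {k E : Type*} [Field k] [Field E] [Algebra k E] {x : E} (hx : IsIntegral k x)
    (hx0 : x ≠ 0) :
    minpoly k x⁻¹ = C ((minpoly k x).coeff 0)⁻¹ * (minpoly k x).reverse := by
  have hc0 : (minpoly k x).coeff 0 ≠ 0 := minpoly.coeff_zero_ne_zero hx hx0
  have hrev : ∀ (f : k[X]) (y : E), y ≠ 0 → (aeval y⁻¹ f.reverse = 0 ↔ aeval y f = 0) := by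
    intro f y hy
    have := invertibleOfNonzero hy
    have h := eval₂_reverse_eq_zero_iff (algebraMap k E) y f
    rwa [invOf_eq_inv] at h
  have hdeg : (C ((minpoly k x).coeff 0)⁻¹ * (minpoly k x).reverse).natDegree =
      (minpoly k x).natDegree := by
    rw [natDegree_C_mul (inv_ne_zero hc0), reverse_natDegree, natTrailingDegree_eq_zero.mpr
      (Or.inr hc0), Nat.sub_zero]
  symm
  apply minpoly.unique k x⁻¹
  · rw [Monic, leadingCoeff_mul, leadingCoeff_C, reverse_leadingCoeff, trailingCoeff,
      natTrailingDegree_eq_zero.mpr (Or.inr hc0)]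
    exact inv_mul_cancel₀ hc0
  · rw [map_mul, (hrev _ x hx0).mpr (minpoly.aeval k x), mul_zero]
  · intro q hq hqx
    have h1 : aeval x q.reverse = 0 := by
      have := (hrev q x⁻¹ (inv_ne_zero hx0)).mpr hqx
      rwa [inv_inv] at this
    have hq0 : q.reverse ≠ 0 := by rw [Ne, reverse_eq_zero]; exact hq.ne_zero
    rw [degree_eq_natDegree (by
      intro h
      rw [h, natDegree_zero] at hdeg
      exact (minpoly.natDegree_pos hx).ne hdeg), degree_eq_natDegree hq.ne_zero, Nat.cast_le]
    rw [hdeg]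
    exact (natDegree_le_natDegree (minpoly.degree_le_of_ne_zero k x hq0 h1)).trans
      (reverse_natDegree_le q)

lemma nextCoeff_minpoly_inv {k E : Type*} [Field k] [Field E] [Algebra k E] {x : E}
    (hx : IsIntegral k x) (hx0 : x ≠ 0) :
    (minpoly k x⁻¹).nextCoeff = (minpoly k x).coeff 1 / (minpoly k x).coeff 0 := by
  have hc0 : (minpoly k x).coeff 0 ≠ 0 := minpoly.coeff_zero_ne_zero hx hx0
  have hd : 0 < (minpoly k x).natDegree := minpoly.natDegree_pos hx
  rw [minpoly_inv hx hx0, nextCoeff_C_mul, ← coeff_one_reverse]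
  have : (minpoly k x).reverse.reverse = minpoly k x := by
    rw [reverse, reverse_natDegree, natTrailingDegree_eq_zero.mpr (Or.inr hc0), Nat.sub_zero,
      reverse, reflect_reflect]
  rw [this]
  field_simp

variable {p : ℕ} [Fact p.Prime]

open scoped Classical in
/-- The completely multiplicative function on monic polynomials over `𝔽_p` whose `L`-function
encodes the Kloosterman sums over all finite extensions. -/
noncomputable def kloostermanWeight (ψ : AddChar (ZMod p) ℂ) (c : ZMod p) (h : (ZMod p)[X]) : ℂ :=
  if h.coeff 0 = 0 then 0 else ψ (-(h.nextCoeff + c * (h.coeff 1 / h.coeff 0)))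

variable (ψ : AddChar (ZMod p) ℂ) (c : ZMod p)

lemma kloostermanWeight_mul {f g : (ZMod p)[X]} (hf : f.Monic) (hg : g.Monic) :
    kloostermanWeight ψ c (f * g) = kloostermanWeight ψ c f * kloostermanWeight ψ c g := by
  unfold kloostermanWeight
  rw [mul_coeff_zero, mul_coeff_one, hf.nextCoeff_mul hg]
  by_cases h1 : f.coeff 0 = 0
  · simp [h1]
  by_cases h2 : g.coeff 0 = 0
  · simp [h2]
  rw [if_neg (mul_ne_zero h1 h2), if_neg h1, if_neg h2, ← AddChar.map_add_eq_mul]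
  congr 1
  field_simp
  ring

lemma kloostermanWeight_one : kloostermanWeight ψ c 1 = 1 := by
  simp [kloostermanWeight, nextCoeff, coeff_one]

variable {E : Type*} [Field E] [Finite E] [Algebra (ZMod p) E]

lemma addChar_trace_eq {x : E} (hx0 : x ≠ 0) :
    ψ (Algebra.trace (ZMod p) E (x + algebraMap (ZMod p) E c / x)) =
      kloostermanWeight ψ c (minpoly (ZMod p) x) ^
        (Module.finrank (ZMod p) E / (minpoly (ZMod p) x).natDegree) := by
  have hx : IsIntegral (ZMod p) x := Algebra.IsIntegral.isIntegral x
  have hc0 : (minpoly (ZMod p) x).coeff 0 ≠ 0 := minpoly.coeff_zero_ne_zero hx hx0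
  have hfin : ∀ y : E, Module.finrank (IntermediateField.adjoin (ZMod p) {y}) E =
      Module.finrank (ZMod p) E / (minpoly (ZMod p) y).natDegree := by
    intro y
    have hy : IsIntegral (ZMod p) y := Algebra.IsIntegral.isIntegral y
    rw [← Module.finrank_mul_finrank (ZMod p) (IntermediateField.adjoin (ZMod p) {y}) E,
      IntermediateField.adjoin.finrank hy, Nat.mul_div_cancel_left _ (minpoly.natDegree_pos hy)]
  have hdeg : (minpoly (ZMod p) x⁻¹).natDegree = (minpoly (ZMod p) x).natDegree := by
    rw [minpoly_inv hx hx0, natDegree_C_mul (inv_ne_zero hc0), reverse_natDegree,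
      natTrailingDegree_eq_zero.mpr (Or.inr hc0), Nat.sub_zero]
  rw [div_eq_mul_inv, ← Algebra.smul_def, map_add, map_smul,
    trace_eq_finrank_mul_minpoly_nextCoeff, trace_eq_finrank_mul_minpoly_nextCoeff,
    nextCoeff_minpoly_inv hx hx0, hfin, hfin, hdeg, kloostermanWeight, if_neg hc0,
    ← AddChar.map_nsmul_eq_pow]
  congr 1
  simp only [nsmul_eq_mul, smul_eq_mul]
  ring

open scoped Classical in
lemma sum_monicPrimes_kloostermanWeight [Fintype E] {n : ℕ} (hn : Module.finrank (ZMod p) E ≤ n) :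
    (∑ P ∈ monicPrimes (ZMod p) n, if P.natDegree ∣ Module.finrank (ZMod p) E then
      P.natDegree * kloostermanWeight ψ c P ^ (Module.finrank (ZMod p) E / P.natDegree) else 0) =
      ∑ x : E with x ≠ 0, ψ (Algebra.trace (ZMod p) E (x + algebraMap (ZMod p) E c / x)) := by
  have hintegral : ∀ x : E, IsIntegral (ZMod p) x := fun x => Algebra.IsIntegral.isIntegral x
  have hdvd : ∀ x : E, (minpoly (ZMod p) x).natDegree ∣ Module.finrank (ZMod p) E := by
    intro x
    exact minpoly.degree_dvd (hintegral x)
  have hpos : 0 < Module.finrank (ZMod p) E := Module.finrank_pos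
  have hsum : ∑ x : E with x ≠ 0,
      ψ (Algebra.trace (ZMod p) E (x + algebraMap (ZMod p) E c / x)) =
      ∑ x : E, kloostermanWeight ψ c (minpoly (ZMod p) x) ^
        (Module.finrank (ZMod p) E / (minpoly (ZMod p) x).natDegree) := by
    rw [Finset.sum_filter]
    refine Finset.sum_congr rfl fun x _ => ?_
    split_ifs with h
    · exact addChar_trace_eq ψ c h
    · rw [not_not] at h
      subst h
      simp [kloostermanWeight, hpos.ne']
  rw [hsum, ← Finset.sum_fiberwise_of_maps_to (g := fun x => minpoly (ZMod p) x)
    (t := monicPrimes (ZMod p) n) (fun x _ => mem_monicPrimes.mpr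
      ⟨minpoly.monic (hintegral x), (Nat.le_of_dvd hpos (hdvd x)).trans hn, minpoly.irreducible (hintegral x)⟩)]
  refine Finset.sum_congr rfl fun P hP => ?_
  obtain ⟨hPm, -, hi⟩ := mem_monicPrimes.mp hP
  rw [Finset.sum_congr rfl (g := fun _ =>
    kloostermanWeight ψ c P ^ (Module.finrank (ZMod p) E / P.natDegree)) (by
      intro x hx
      rw [(Finset.mem_filter.mp hx).2]), Finset.sum_const, nsmul_eq_mul]
  have hroots : Finset.univ.filter (fun x : E => minpoly (ZMod p) x = P) =
      (P.aroots E).toFinset := by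
    ext x
    rw [Finset.mem_filter, Multiset.mem_toFinset, mem_aroots]
    constructor
    · rintro ⟨-, rfl⟩
      exact ⟨hPm.ne_zero, minpoly.aeval _ _⟩
    · rintro ⟨-, h⟩
      exact ⟨Finset.mem_univ _, (minpoly.eq_of_irreducible_of_monic hi h hPm).symm⟩
  split_ifs with h
  · congr 2
    rw [hroots, Multiset.toFinset_card_of_nodup (nodup_roots (PerfectField.separable_of_irreducible hi).map),
      ← natDegree_map (algebraMap (ZMod p) E)]
    rw [hi.natDegree_dvd_iff_dvd_X_pow_card_pow_sub_X, ← Module.natCard_eq_pow_finrank] at h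
    have hsp : (P.map (algebraMap (ZMod p) E)).Splits := by
      refine Splits.of_dvd (IsSplittingField.splits E (X ^ Fintype.card E - X : (ZMod p)[X])) ?_ ?_
      · rw [Ne, Polynomial.map_eq_zero]
        exact FiniteField.X_pow_card_sub_X_ne_zero _ Fintype.one_lt_card
      · rw [Fintype.card_eq_nat_card]
        exact map_dvd (mapRingHom (algebraMap (ZMod p) E)) h
    exact hsp.natDegree_eq_card_roots
  · rw [Finset.card_eq_zero.mpr, Nat.cast_zero, zero_mul]
    rw [Finset.filter_eq_empty_iff]
    rintro x - rfl
    exact h (hdvd x)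

end LFunction

section Weil

open Polynomial

variable {p : ℕ} [Fact p.Prime] (ψ : AddChar (ZMod p) ℂ) (c : ZMod p)

open scoped Classical in
/-- The companion sum of the Kloosterman sum over the extension of degree `j` of `𝔽_p`. -/
noncomputable def extensionSum (j : ℕ) : ℂ :=
  ∑ P ∈ monicPrimes (ZMod p) j, if P.natDegree ∣ j then
    P.natDegree * kloostermanWeight ψ c P ^ (j / P.natDegree) else 0

open scoped Classical in
lemma extensionSum_eq {E : Type*} [Field E] [Fintype E] [Algebra (ZMod p) E] {j : ℕ}
    (hj : Module.finrank (ZMod p) E = j) :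
    extensionSum ψ c j =
      ∑ x : E with x ≠ 0, ψ (Algebra.trace (ZMod p) E (x + algebraMap (ZMod p) E c / x)) := by
  subst hj
  exact sum_monicPrimes_kloostermanWeight ψ c le_rfl

lemma natCast_mul_sum_kloostermanWeight (n : ℕ) :
    n * ∑ h ∈ monics (ZMod p) n, kloostermanWeight ψ c h =
      ∑ j ∈ Finset.Icc 1 n, extensionSum ψ c j *
        ∑ h ∈ monics (ZMod p) (n - j), kloostermanWeight ψ c h := by
  rw [natCast_mul_sum_monics _ (fun f g => kloostermanWeight_mul ψ c) (kloostermanWeight_one ψ c)]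
  refine Finset.sum_congr rfl fun j hj => ?_
  obtain ⟨h1, h2⟩ := Finset.mem_Icc.mp hj
  congr 1
  have hfin : Module.finrank (ZMod p) (GaloisField p j) = j := GaloisField.finrank p (by omega)
  have := Fintype.ofFinite (GaloisField p j)
  have h := sum_monicPrimes_kloostermanWeight ψ c (E := GaloisField p j) (hfin.trans_le h2)
  rw [extensionSum_eq ψ c hfin, ← h, hfin]

lemma sum_kloostermanWeight_zero : ∑ h ∈ monics (ZMod p) 0, kloostermanWeight ψ c h = 1 := by
  have : monics (ZMod p) 0 = {1} := by
    ext h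
    rw [mem_monics, Finset.mem_singleton]
    constructor
    · rintro ⟨hm, hd⟩
      exact hm.natDegree_eq_zero.mp hd
    · rintro rfl
      exact ⟨monic_one, natDegree_one⟩
  rw [this, Finset.sum_singleton, kloostermanWeight_one]

variable {ψ c}

lemma sum_kloostermanWeight_two (hψ : ψ ≠ 1) (hc : c ≠ 0) :
    ∑ h ∈ monics (ZMod p) 2, kloostermanWeight ψ c h = p := by
  have hcoeff : ∀ u v : ZMod p, (X ^ 2 + C u * X + C v).natDegree = 2 ∧
      (X ^ 2 + C u * X + C v).Monic := by
    intro u v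
    constructor
    · compute_degree!
    · monicity!
  have h1 : ∑ h ∈ monics (ZMod p) 2, kloostermanWeight ψ c h =
      ∑ z : ZMod p × ZMod p, kloostermanWeight ψ c (X ^ 2 + C z.2 * X + C z.1) := by
    symm
    refine Finset.sum_nbij' (fun z => X ^ 2 + C z.2 * X + C z.1) (fun h => (h.coeff 0, h.coeff 1))
      ?_ ?_ ?_ ?_ ?_
    · intro z _
      exact mem_monics.mpr ⟨(hcoeff _ _).2, (hcoeff _ _).1⟩
    · simp
    · intro z _
      simp [coeff_X_pow, coeff_X, coeff_C]
    · intro h hh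
      obtain ⟨hm, hd⟩ := mem_monics.mp hh
      conv_rhs => rw [hm.as_sum, hd]
      simp [Finset.sum_range_succ]
      ring
    · simp
  rw [h1, Fintype.sum_prod_type]
  have h2 : ∀ v : ZMod p, ∑ u : ZMod p, kloostermanWeight ψ c (X ^ 2 + C u * X + C v) =
      if v = -c then (p : ℂ) else 0 := by
    intro v
    by_cases hv : v = 0
    · subst hv
      rw [if_neg (by simpa [eq_comm] using hc)]
      exact Finset.sum_eq_zero fun u _ => by simp [kloostermanWeight]
    · have hval : ∀ u : ZMod p, kloostermanWeight ψ c (X ^ 2 + C u * X + C v) =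
          ψ (u * (-(1 + c / v))) := by
        intro u
        have e0 : (X ^ 2 + C u * X + C v).coeff 0 = v := by simp
        have e1 : (X ^ 2 + C u * X + C v).coeff 1 = u := by simp [coeff_X_pow, coeff_C]
        have e2 : (X ^ 2 + C u * X + C v).nextCoeff = u := by
          rw [nextCoeff_of_natDegree_pos (by rw [(hcoeff u v).1]; norm_num), (hcoeff u v).1]
          exact e1
        rw [kloostermanWeight, e0, e1, e2, if_neg hv]
        congr 1
        ring
      simp_rw [hval]
      rw [AddChar.sum_mulShift _ (AddChar.IsPrimitive.of_ne_one hψ), ZMod.card]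
      have hiff : -(1 + c / v) = 0 ↔ v = -c := by
        rw [neg_eq_zero, one_add_div hv, div_eq_zero_iff, or_iff_left hv, eq_neg_iff_add_eq_zero]
      simp only [hiff]
      split_ifs <;> simp
  simp_rw [h2]
  simp

lemma sum_kloostermanWeight_of_three_le (hψ : ψ ≠ 1) {n : ℕ} (hn : 3 ≤ n) :
    ∑ h ∈ monics (ZMod p) n, kloostermanWeight ψ c h = 0 := by
  obtain ⟨t, ht⟩ := AddChar.ne_one_iff.mp hψ
  have hdeg : ∀ (s : ZMod p) (h : (ZMod p)[X]), h ∈ monics (ZMod p) n →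
      h + C s * X ^ (n - 1) ∈ monics (ZMod p) n := by
    intro s h hh
    obtain ⟨hm, hd⟩ := mem_monics.mp hh
    have hlt : (C s * X ^ (n - 1)).degree < h.degree := by
      refine (degree_C_mul_X_pow_le _ _).trans_lt ?_
      rw [degree_eq_natDegree hm.ne_zero, hd]
      exact_mod_cast (by omega : n - 1 < n)
    refine mem_monics.mpr ⟨hm.add_of_left hlt, ?_⟩
    rw [natDegree_add_eq_left_of_degree_lt hlt, hd]
  have hshift : ∀ h ∈ monics (ZMod p) n, kloostermanWeight ψ c (h + C (-t) * X ^ (n - 1)) =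
      ψ t * kloostermanWeight ψ c h := by
    intro h hh
    obtain ⟨hm, hd⟩ := mem_monics.mp hh
    obtain ⟨hm', hd'⟩ := mem_monics.mp (hdeg (-t) h hh)
    have e0 : (h + C (-t) * X ^ (n - 1)).coeff 0 = h.coeff 0 := by
      rw [coeff_add, coeff_C_mul_X_pow, if_neg (by omega), add_zero]
    have e1 : (h + C (-t) * X ^ (n - 1)).coeff 1 = h.coeff 1 := by
      rw [coeff_add, coeff_C_mul_X_pow, if_neg (by omega), add_zero]
    have e2 : (h + C (-t) * X ^ (n - 1)).nextCoeff = h.nextCoeff - t := by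
      rw [nextCoeff_of_natDegree_pos (by omega), nextCoeff_of_natDegree_pos (by omega), hd, hd',
        coeff_add, coeff_C_mul_X_pow, if_pos rfl, sub_eq_add_neg]
    rw [kloostermanWeight, kloostermanWeight, e0, e1, e2]
    split_ifs
    · simp
    · rw [← AddChar.map_add_eq_mul]
      congr 1
      ring
  have hinv : ∑ h ∈ monics (ZMod p) n, kloostermanWeight ψ c h =
      ψ t * ∑ h ∈ monics (ZMod p) n, kloostermanWeight ψ c h := by
    rw [Finset.mul_sum]
    symm
    refine Finset.sum_bij (fun h _ => h + C (-t) * X ^ (n - 1)) (fun h hh => hdeg _ h hh)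
      (fun h _ h' _ e => add_right_cancel e) (fun h hh => ⟨h + C t * X ^ (n - 1), hdeg _ h hh, ?_⟩)
      (fun h hh => (hshift h hh).symm)
    rw [C_neg]
    ring
  have h0 : (ψ t - 1) * ∑ h ∈ monics (ZMod p) n, kloostermanWeight ψ c h = 0 := by
    linear_combination -hinv
  exact (mul_eq_zero.mp h0).resolve_left (sub_ne_zero.mpr ht)

lemma extensionSum_two (hψ : ψ ≠ 1) (hc : c ≠ 0) :
    extensionSum ψ c 2 = 2 * p - extensionSum ψ c 1 ^ 2 := by
  have h1 := natCast_mul_sum_kloostermanWeight ψ c 1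
  have h2 := natCast_mul_sum_kloostermanWeight ψ c 2
  rw [sum_kloostermanWeight_two hψ hc] at h2
  simp [Finset.sum_Icc_succ_top, sum_kloostermanWeight_zero] at h1 h2
  rw [h1] at h2
  linear_combination -h2

lemma extensionSum_add_three (hψ : ψ ≠ 1) (hc : c ≠ 0) (n : ℕ) :
    extensionSum ψ c (n + 3) =
      -extensionSum ψ c 1 * extensionSum ψ c (n + 2) - p * extensionSum ψ c (n + 1) := by
  have h1 := natCast_mul_sum_kloostermanWeight ψ c 1
  have h3 := natCast_mul_sum_kloostermanWeight ψ c (n + 3)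
  rw [sum_kloostermanWeight_of_three_le hψ (by omega), mul_zero, Finset.sum_Icc_succ_top (by omega),
    Finset.sum_Icc_succ_top (by omega), Finset.sum_Icc_succ_top (by omega),
    Finset.sum_eq_zero] at h3
  · simp only [Nat.sub_self, show n + 3 - (n + 2) = 1 by omega, show n + 3 - (n + 1) = 2 by omega,
      sum_kloostermanWeight_zero, sum_kloostermanWeight_two hψ hc, zero_add, mul_one] at h3
    simp [sum_kloostermanWeight_zero] at h1
    rw [h1] at h3
    linear_combination -h3
  · intro j hj
    have := (Finset.mem_Icc.mp hj).2
    rw [sum_kloostermanWeight_of_three_le hψ (by omega), mul_zero]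

lemma exists_frobenius_eigenvalues (hψ : ψ ≠ 1) (hc : c ≠ 0) :
    ∃ α β : ℂ, α + β = -extensionSum ψ c 1 ∧ α * β = p ∧
      ∀ n, extensionSum ψ c (n + 1) = -(α ^ (n + 1) + β ^ (n + 1)) := by
  obtain ⟨r, hr⟩ := IsAlgClosed.exists_pow_nat_eq
    (extensionSum ψ c 1 ^ 2 - 4 * p) (n := 2) (by norm_num)
  set S := extensionSum ψ c 1 with hS
  have hsum : (-S + r) / 2 + (-S - r) / 2 = -S := by ring
  have hprod : (-S + r) / 2 * ((-S - r) / 2) = p := by linear_combination -hr / 4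
  refine ⟨(-S + r) / 2, (-S - r) / 2, hsum, hprod, ?_⟩
  generalize (-S + r) / 2 = α at *
  generalize (-S - r) / 2 = β at *
  have key : ∀ n, extensionSum ψ c (n + 1) = -(α ^ (n + 1) + β ^ (n + 1)) ∧
      extensionSum ψ c (n + 2) = -(α ^ (n + 2) + β ^ (n + 2)) := by
    intro n
    induction n with
    | zero =>
      refine ⟨by rw [zero_add, ← hS]; linear_combination hsum, ?_⟩
      rw [zero_add, extensionSum_two hψ hc, ← hS]
      have : S = -(α + β) := by rw [hsum, neg_neg]
      rw [this, ← hprod]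
      ring
    | succ n ih =>
      refine ⟨ih.2, ?_⟩
      rw [show n + 1 + 2 = n + 3 by ring, extensionSum_add_three hψ hc, ih.1, ih.2, ← hS,
        ← hsum, ← hprod]
      ring
  exact fun n => (key n).1

lemma norm_le_sqrt_of_norm_pow_add_pow_le {α β : ℂ} {q C : ℝ} (hq : 0 < q) (hαβ : α * β = q)
    {k₀ : ℕ} (h : ∀ k, k₀ ≤ k → ‖α ^ (2 * k) + β ^ (2 * k)‖ ≤ C * q ^ k) : ‖α‖ ≤ √q := by
  by_contra hα
  push Not at hα
  have hα0 : 0 < ‖α‖ := (Real.sqrt_nonneg q).trans_lt hα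
  have hα2 : q < ‖α‖ ^ 2 := by
    rw [← Real.sq_sqrt hq.le]
    exact pow_lt_pow_left₀ hα (Real.sqrt_nonneg q) two_ne_zero
  have hn : ‖α‖ * ‖β‖ = q := by rw [← norm_mul, hαβ, Complex.norm_real, Real.norm_of_nonneg hq.le]
  have hβ2 : ‖β‖ ^ 2 ≤ q := by
    have h1 : ‖α‖ ^ 2 * ‖β‖ ^ 2 = q * q := by rw [← mul_pow, hn, sq]
    have h2 : 0 ≤ ‖β‖ ^ 2 := sq_nonneg _
    nlinarith
  have hratio : 1 < ‖α‖ ^ 2 / q := (one_lt_div hq).mpr hα2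
  obtain ⟨k₁, hk₁⟩ := pow_unbounded_of_one_lt (C + 1) hratio
  set k := max k₀ k₁
  have hk : C + 1 < (‖α‖ ^ 2 / q) ^ k :=
    hk₁.trans_le (pow_le_pow_right₀ hratio.le (le_max_right _ _))
  rw [div_pow, lt_div_iff₀ (pow_pos hq k), ← pow_mul] at hk
  have h1 := h k (le_max_left _ _)
  have h2 : ‖α ^ (2 * k)‖ ≤ ‖α ^ (2 * k) + β ^ (2 * k)‖ + ‖β ^ (2 * k)‖ := by
    simpa using norm_sub_le (α ^ (2 * k) + β ^ (2 * k)) (β ^ (2 * k))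
  rw [norm_pow, norm_pow] at h2
  have h3 : ‖β‖ ^ (2 * k) ≤ q ^ k := by
    rw [pow_mul]
    exact pow_le_pow_left₀ (sq_nonneg _) hβ2 k
  linarith

/-- **Weil's bound** for Kloosterman sums over the prime field, for odd primes. -/
lemma norm_kloosterman_le_of_three_le (hp3 : 3 ≤ p) (hψ : ψ ≠ 1) (hc : c ≠ 0) :
    ‖∑ x : ZMod p with x ≠ 0, ψ (x + c / x)‖ ≤ 2 * √p := by
  have hp : p.Prime := Fact.out
  obtain ⟨α, β, hsum, hprod, hpow⟩ := exists_frobenius_eigenvalues hψ hc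
  have hS : extensionSum ψ c 1 = ∑ x : ZMod p with x ≠ 0, ψ (x + c / x) := by
    classical
    rw [extensionSum_eq ψ c (E := ZMod p) (Module.finrank_self _)]
    simp
  have hbound : ∀ k, 4 ≤ k →
      ‖α ^ (2 * k) + β ^ (2 * k)‖ ≤ (14 * p + 4) * (p : ℝ) ^ k := by
    intro k hk
    classical
    have hE : Fintype (GaloisField p (2 * k)) := Fintype.ofFinite _
    have hcard : Fintype.card (GaloisField p (2 * k)) = (p ^ k) ^ 2 := by
      rw [Fintype.card_eq_nat_card, GaloisField.card p _ (by omega), ← pow_mul, mul_comm]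
    have h8 : 8 * p ≤ p ^ k := by
      calc 8 * p ≤ p ^ 3 * p := Nat.mul_le_mul_right p (by nlinarith [Nat.pow_le_pow_left hp3 3])
        _ = p ^ 4 := by ring
        _ ≤ p ^ k := Nat.pow_le_pow_right hp.pos hk
    have h := norm_sum_trace_le hp3 h8 hcard
      (c := algebraMap (ZMod p) (GaloisField p (2 * k)) c) (by simpa using hc) hψ
    have h2 := hpow (2 * k - 1)
    rw [show 2 * k - 1 + 1 = 2 * k by omega,
      extensionSum_eq ψ c (GaloisField.finrank p (by omega))] at h2
    rw [← norm_neg, ← h2]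
    convert h
  have hp0 : (0 : ℝ) < p := by exact_mod_cast hp.pos
  have hα := norm_le_sqrt_of_norm_pow_add_pow_le hp0 (by simpa using hprod) hbound
  have hβ := norm_le_sqrt_of_norm_pow_add_pow_le (α := β) (β := α) hp0 (by simpa [mul_comm] using hprod)
    (fun k hk => by rw [add_comm (β ^ _)]; exact hbound k hk)
  rw [← hS, ← norm_neg, ← hsum]
  exact (norm_add_le _ _).trans (by linarith)

/-- **Weil's bound** for Kloosterman sums over the prime field. -/
theorem norm_kloosterman_le (hψ : ψ ≠ 1) (hc : c ≠ 0) :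
    ‖∑ x : ZMod p with x ≠ 0, ψ (x + c / x)‖ ≤ 2 * √p := by
  have hp : p.Prime := Fact.out
  rcases hp.two_le.lt_or_eq with h | h
  · exact norm_kloosterman_le_of_three_le h hψ hc
  · refine (norm_sum_le _ _).trans ?_
    simp only [AddChar.norm_apply, Finset.sum_const, nsmul_eq_mul, mul_one]
    have : (Finset.univ.filter fun x : ZMod p => x ≠ 0).card ≤ 2 :=
      (Finset.card_le_univ _).trans (by rw [ZMod.card, h])
    have h1 : (1 : ℝ) ≤ √p := Real.one_le_sqrt.mpr (by exact_mod_cast hp.one_le)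
    have : ((Finset.univ.filter fun x : ZMod p => x ≠ 0).card : ℝ) ≤ 2 := by exact_mod_cast this
    linarith

end Weil

section StationaryPhase

variable {N : ℕ} [NeZero N] {ψ : AddChar (ZMod N) ℂ}

/-- Weyl differencing for quadratic Gauss sums. -/
lemma sq_norm_sum_quadratic_le (hψ : ψ.IsPrimitive) (a b : ZMod N) {m : ℕ} (hm : 0 < m)
    (hb : ∀ h : ZMod N, 2 * b * h = 0 → m • h = 0) :
    ‖∑ z : ZMod N, ψ (a * z + b * z ^ 2)‖ ^ 2 ≤ N * m := by
  classical
  set S := ∑ z : ZMod N, ψ (a * z + b * z ^ 2) with hS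
  have h1 : S * (starRingEnd ℂ) S =
      ∑ h : ZMod N, ψ (a * h + b * h ^ 2) * ∑ z : ZMod N, ψ (z * (2 * b * h)) := by
    rw [hS, map_sum, Finset.sum_mul]
    simp_rw [Finset.mul_sum]
    rw [Finset.sum_comm (s := Finset.univ (α := ZMod N))]
    rw [Finset.sum_comm (s := Finset.univ (α := ZMod N))
      (f := fun h z => ψ (a * h + b * h ^ 2) * ψ (z * (2 * b * h)))]
    refine Finset.sum_congr rfl fun z _ => ?_
    rw [← Equiv.sum_comp (Equiv.addRight z)]
    refine Finset.sum_congr rfl fun h _ => ?_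
    rw [← AddChar.map_neg_eq_conj, ← AddChar.map_add_eq_mul, ← AddChar.map_add_eq_mul]
    congr 1
    simp only [Equiv.coe_addRight]
    ring
  have h2 : ‖S‖ ^ 2 = ‖S * (starRingEnd ℂ) S‖ := by
    rw [norm_mul, RCLike.norm_conj, sq]
  rw [h2, h1]
  calc ‖∑ h : ZMod N, ψ (a * h + b * h ^ 2) * ∑ z : ZMod N, ψ (z * (2 * b * h))‖
      ≤ ∑ h : ZMod N, if m • h = 0 then (N : ℝ) else 0 := by
        refine (norm_sum_le _ _).trans (Finset.sum_le_sum fun h _ => ?_)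
        rw [norm_mul, AddChar.norm_apply, one_mul, AddChar.sum_mulShift _ hψ, ZMod.card]
        by_cases h0 : 2 * b * h = 0
        · rw [if_pos h0, if_pos (hb h h0)]
          simp
        · rw [if_neg h0]
          split_ifs <;> simp
    _ = (Finset.univ.filter fun h : ZMod N => m • h = 0).card * N := by
        rw [← Finset.sum_filter, Finset.sum_const, nsmul_eq_mul]
    _ ≤ N * m := by
        rw [mul_comm]
        gcongr
        exact IsAddCyclic.card_nsmul_eq_zero_le hm

/-- Stationary phase: an oscillating sum modulo `p ^ k` whose phase is, up to the factor `p ^ ν`,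
quadratic on balls of radius `p ^ l` is concentrated on the critical points of the phase. -/
lemma sq_norm_sum_le_of_stationary {p k ν l : ℕ} (hp : p.Prime) (hN : N = p ^ k)
    (hψ : ψ.IsPrimitive) (hl : ν + 2 * l ≤ k) (U : Finset (ZMod N)) (f f₁ f₂ : ZMod N → ZMod N)
    (hU : ∀ x ∈ U, ∀ z, x + p ^ l * z ∈ U)
    (hf : ∀ x ∈ U, ∀ z, f (x + p ^ l * z) =
      f x + p ^ ν * (f₁ x * (p ^ l * z) + f₂ x * (p ^ l * z) ^ 2))
    (hf₂ : ∀ x ∈ U, p ^ (k - l) * f₁ x = 0 → IsUnit (f₂ x))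
    (hsep : ∀ x ∈ U, ∀ y ∈ U, p ^ (k - l) * f₁ x = 0 → p ^ (k - l) * f₁ y = 0 →
      2 * p ^ (k - l) * (x - y) = 0 ∨ 2 * p ^ (k - l) * (x + y) = 0) :
    ‖∑ x ∈ U, ψ (f x)‖ ^ 2 ≤ 32 * (p : ℝ) ^ (k + ν) := by
  classical
  have hpN : ∀ j, k ≤ j → (p : ZMod N) ^ j = 0 := by
    intro j hj
    rw [← Nat.cast_pow, ZMod.natCast_eq_zero_iff, hN]
    exact pow_dvd_pow p hj
  have hp0 : (0 : ℝ) < p := by exact_mod_cast hp.pos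
  have hN0 : (0 : ℝ) < N := by exact_mod_cast Nat.pos_of_ne_zero (NeZero.ne N)
  let G : ZMod N → ℂ := fun x =>
    ∑ z : ZMod N, ψ (p ^ ν * f₁ x * p ^ l * z + p ^ ν * f₂ x * p ^ (2 * l) * z ^ 2)
  let St := U.filter fun x => p ^ (k - l) * f₁ x = 0
  have havg : (N : ℂ) * ∑ x ∈ U, ψ (f x) = ∑ x ∈ U, ψ (f x) * G x := by
    have h1 : ∀ z : ZMod N, ∑ x ∈ U, ψ (f x) = ∑ x ∈ U, ψ (f (x + p ^ l * z)) := by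
      intro z
      symm
      refine Finset.sum_bij (fun x _ => x + p ^ l * z) (fun x hx => hU x hx z)
        (fun x _ y _ h => add_right_cancel h)
        (fun x hx => ⟨x + p ^ l * (-z), hU x hx _, by ring⟩) (fun _ _ => rfl)
    calc (N : ℂ) * ∑ x ∈ U, ψ (f x) = ∑ z : ZMod N, ∑ x ∈ U, ψ (f (x + p ^ l * z)) := by
          rw [Finset.sum_congr rfl fun z _ => (h1 z).symm]
          simp [ZMod.card]
      _ = ∑ x ∈ U, ψ (f x) * G x := by
          rw [Finset.sum_comm]
          refine Finset.sum_congr rfl fun x hx => ?_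
          rw [Finset.mul_sum]
          refine Finset.sum_congr rfl fun z _ => ?_
          rw [hf x hx, ← AddChar.map_add_eq_mul]
          congr 1
          ring
  have hvan : ∀ x, p ^ (k - l) * f₁ x ≠ 0 → G x = 0 := by
    intro x hx
    obtain ⟨t, ht⟩ := AddChar.ne_one_iff.mp (hψ hx)
    rw [AddChar.mulShift_apply] at ht
    have hinv : G x = ψ (p ^ (k - l) * f₁ x * t) * G x := by
      simp only [G]
      rw [Finset.mul_sum]
      conv_lhs => rw [← Equiv.sum_comp (Equiv.addRight (p ^ (k - ν - 2 * l) * t))]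
      refine Finset.sum_congr rfl fun z _ => ?_
      rw [← AddChar.map_add_eq_mul]
      congr 1
      simp only [Equiv.coe_addRight]
      have e1 : (p : ZMod N) ^ ν * p ^ l * p ^ (k - ν - 2 * l) = p ^ (k - l) := by
        rw [← pow_add, ← pow_add]
        congr 1
        omega
      have e2 : (p : ZMod N) ^ ν * p ^ (2 * l) * p ^ (k - ν - 2 * l) = 0 := by
        rw [← pow_add, ← pow_add]
        exact hpN _ (by omega)
      linear_combination (f₁ x * t) * e1 +
        (2 * f₂ x * z * t + f₂ x * p ^ (k - ν - 2 * l) * t ^ 2) * e2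
    have h0 : (ψ (p ^ (k - l) * f₁ x * t) - 1) * G x = 0 := by linear_combination -hinv
    exact (mul_eq_zero.mp h0).resolve_left (sub_ne_zero.mpr ht)
  have hbound : ∀ x ∈ St, ‖G x‖ ^ 2 ≤ N * (2 * p ^ (ν + 2 * l) : ℕ) := by
    intro x hx
    obtain ⟨hxU, hx0⟩ := Finset.mem_filter.mp hx
    refine sq_norm_sum_quadratic_le hψ _ _ (by have := hp.pos; positivity) fun h hh => ?_
    rw [nsmul_eq_mul]
    push_cast
    have := (hf₂ x hxU hx0).mul_right_eq_zero.mp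
      (show f₂ x * (2 * p ^ (ν + 2 * l) * h) = 0 by rw [← hh]; ring)
    exact this
  have hcard : (St.card : ℝ) ≤ 4 * p ^ (k - l) := by
    rcases St.eq_empty_or_nonempty with h | ⟨x, hx⟩
    · rw [h]
      simp only [Finset.card_empty, Nat.cast_zero]
      positivity
    · have hm : 0 < 2 * p ^ (k - l) := by have := hp.pos; positivity
      have hker := IsAddCyclic.card_nsmul_eq_zero_le (α := ZMod N) hm
      have hsub : St ⊆ ((Finset.univ.filter fun h : ZMod N => (2 * p ^ (k - l)) • h = 0).image
          fun h => x - h) ∪ ((Finset.univ.filter fun h : ZMod N => (2 * p ^ (k - l)) • h = 0).image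
          fun h => h - x) := by
        intro y hy
        obtain ⟨hxU, hx0⟩ := Finset.mem_filter.mp hx
        obtain ⟨hyU, hy0⟩ := Finset.mem_filter.mp hy
        rw [Finset.mem_union, Finset.mem_image, Finset.mem_image]
        rcases hsep x hxU y hyU hx0 hy0 with h | h
        · refine Or.inl ⟨x - y, ?_, by ring⟩
          rw [Finset.mem_filter, nsmul_eq_mul]
          push_cast
          exact ⟨Finset.mem_univ _, h⟩
        · refine Or.inr ⟨x + y, ?_, by ring⟩
          rw [Finset.mem_filter, nsmul_eq_mul]
          push_cast
          exact ⟨Finset.mem_univ _, h⟩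
      have h1 := (Finset.card_le_card hsub).trans (Finset.card_union_le _ _)
      have h2 := Finset.card_image_le (s := Finset.univ.filter fun h : ZMod N =>
        (2 * p ^ (k - l)) • h = 0) (f := fun h => x - h)
      have h3 := Finset.card_image_le (s := Finset.univ.filter fun h : ZMod N =>
        (2 * p ^ (k - l)) • h = 0) (f := fun h => h - x)
      have h4 : St.card ≤ 4 * p ^ (k - l) := by omega
      exact_mod_cast h4
  have hfinal : (N : ℝ) * ‖∑ x ∈ U, ψ (f x)‖ ≤
      4 * p ^ (k - l) * √(N * (2 * p ^ (ν + 2 * l) : ℕ)) := by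
    calc (N : ℝ) * ‖∑ x ∈ U, ψ (f x)‖ = ‖∑ x ∈ U, ψ (f x) * G x‖ := by
          rw [← havg, norm_mul, Complex.norm_natCast]
      _ ≤ ∑ x ∈ U, ‖G x‖ := by
          refine (norm_sum_le _ _).trans (Finset.sum_le_sum fun x _ => ?_)
          rw [norm_mul, AddChar.norm_apply, one_mul]
      _ = ∑ x ∈ St, ‖G x‖ := by
          refine (Finset.sum_subset (Finset.filter_subset _ _) fun x hxU hx => ?_).symm
          rw [hvan x fun h => hx (Finset.mem_filter.mpr ⟨hxU, h⟩), norm_zero]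
      _ ≤ ∑ x ∈ St, √(N * (2 * p ^ (ν + 2 * l) : ℕ)) :=
          Finset.sum_le_sum fun x hx => Real.le_sqrt_of_sq_le (hbound x hx)
      _ = St.card * √(N * (2 * p ^ (ν + 2 * l) : ℕ)) := by
          rw [Finset.sum_const, nsmul_eq_mul]
      _ ≤ _ := by gcongr
  have hsq := pow_le_pow_left₀ (by positivity) hfinal 2
  rw [mul_pow, mul_pow, Real.sq_sqrt (by positivity)] at hsq
  have hNr : (N : ℝ) = p ^ k := by rw [hN]; push_cast; rfl
  have e3 : (4 * (p : ℝ) ^ (k - l)) ^ 2 * (N * (2 * p ^ (ν + 2 * l) : ℕ)) =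
      N ^ 2 * (32 * (p : ℝ) ^ (k + ν)) := by
    rw [hNr]
    push_cast
    have : ((p : ℝ) ^ (k - l)) ^ 2 * p ^ (ν + 2 * l) = p ^ k * p ^ (k + ν) := by
      rw [← pow_mul, ← pow_add, ← pow_add]
      congr 1
      omega
    have h' : ((p : ℝ) ^ k * p ^ k) * (((p : ℝ) ^ (k - l)) ^ 2 * p ^ (ν + 2 * l)) =
      (p ^ k * p ^ k) * (p ^ k * p ^ (k + ν)) := by rw [this]
    have hpk : (p : ℝ) ^ k ≠ 0 := by positivity
    field_simp at h' ⊢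
    linear_combination 32 * this
  rw [e3] at hsq
  exact le_of_mul_le_mul_left hsq (by positivity)

end StationaryPhase

section PrimePower

variable {N p k : ℕ}

lemma primePow_cast_eq_zero (hN : N = p ^ k) {j : ℕ} (hj : k ≤ j) : (p : ZMod N) ^ j = 0 := by
  rw [← Nat.cast_pow, ZMod.natCast_eq_zero_iff, hN]
  exact pow_dvd_pow p hj

lemma primePow_cast_ne_zero (hp : p.Prime) (hN : N = p ^ k) {j : ℕ} (hj : j < k) :
    (p : ZMod N) ^ j ≠ 0 := by
  rw [← Nat.cast_pow, Ne, ZMod.natCast_eq_zero_iff, hN, Nat.pow_dvd_pow_iff_le_right hp.one_lt]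
  omega

variable [NeZero N]

/-- Every residue modulo `p ^ k` is a power of `p` times a unit. -/
lemma exists_eq_primePow_mul_isUnit (hp : p.Prime) (hN : N = p ^ k) (x : ZMod N) :
    ∃ i ≤ k, ∃ y : ZMod N, IsUnit y ∧ x = p ^ i * y := by
  by_cases hx : x = 0
  · exact ⟨k, le_rfl, 1, isUnit_one, by rw [hx, primePow_cast_eq_zero hN le_rfl, zero_mul]⟩
  · have hv : x.val ≠ 0 := by rwa [Ne, ZMod.val_eq_zero]
    obtain ⟨i, m, hm, he⟩ := Nat.exists_eq_pow_mul_and_not_dvd hv p hp.ne_one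
    refine ⟨i, ?_, m, ?_, ?_⟩
    · have h1 : p ^ i ≤ x.val := by
        rw [he]
        exact Nat.le_mul_of_pos_right _ (Nat.pos_of_ne_zero fun h => hm (h ▸ dvd_zero p))
      have h2 : x.val < p ^ k := hN ▸ ZMod.val_lt x
      exact ((Nat.pow_lt_pow_iff_right hp.one_lt).mp (h1.trans_lt h2)).le
    · rw [ZMod.isUnit_iff_coprime, hN]
      exact (Nat.Coprime.pow_left k ((Nat.Prime.coprime_iff_not_dvd hp).mpr hm)).symm
    · rw [← ZMod.natCast_zmod_val x, he]
      push_cast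
      rfl

lemma isUnit_or_prime_dvd (hp : p.Prime) (hN : N = p ^ k) (x : ZMod N) :
    IsUnit x ∨ (p : ZMod N) ∣ x := by
  obtain ⟨i, -, y, hy, rfl⟩ := exists_eq_primePow_mul_isUnit hp hN x
  rcases i with _ | i
  · left
    simpa using hy
  · right
    exact ⟨p ^ i * y, by ring⟩

lemma not_isUnit_of_prime_dvd (hp : p.Prime) (hN : N = p ^ k) (hk : k ≠ 0) {x : ZMod N}
    (hx : (p : ZMod N) ∣ x) : ¬ IsUnit x := by
  obtain ⟨y, rfl⟩ := hx
  intro h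
  have h1 : IsUnit ((p : ZMod N) ^ k) := (isUnit_of_mul_isUnit_left h).pow k
  rw [primePow_cast_eq_zero hN le_rfl] at h1
  have h2 : (1 : ZMod N) = 0 := by
    obtain ⟨z, hz⟩ := h1.exists_right_inv
    rw [← hz, zero_mul]
  have h3 := primePow_cast_ne_zero hp hN (j := 0) (by omega)
  exact h3 (by rw [pow_zero, h2])

lemma isUnit_add_of_prime_dvd (hp : p.Prime) (hN : N = p ^ k) {x y : ZMod N}
    (hx : IsUnit x) (hy : (p : ZMod N) ∣ y) : IsUnit (x + y) := by
  rcases isUnit_or_prime_dvd hp hN (x + y) with h | h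
  · exact h
  · rcases Nat.eq_zero_or_pos k with rfl | hk
    · have : Subsingleton (ZMod N) := by
        rw [pow_zero] at hN
        subst hN
        infer_instance
      exact isUnit_of_subsingleton _
    · exact absurd hx (not_isUnit_of_prime_dvd hp hN hk.ne' ((dvd_add_left hy).mp h))

lemma dvd_or_dvd_of_primePow (hp : p.Prime) (hN : N = p ^ k) (x y : ZMod N) : x ∣ y ∨ y ∣ x := by
  obtain ⟨i, -, a, ha, rfl⟩ := exists_eq_primePow_mul_isUnit hp hN x
  obtain ⟨j, -, b, hb, rfl⟩ := exists_eq_primePow_mul_isUnit hp hN y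
  rcases le_total i j with h | h
  · left
    rw [ha.mul_right_dvd]
    exact (pow_dvd_pow _ h).mul_right _
  · right
    rw [hb.mul_right_dvd]
    exact (pow_dvd_pow _ h).mul_right _

lemma isUnit_of_primePow_mul_sub_eq_zero (hp : p.Prime) (hN : N = p ^ k) {j : ℕ} (hj : j < k)
    {x y : ZMod N} (hx : IsUnit x) (h : (p : ZMod N) ^ j * (x - y) = 0) : IsUnit y := by
  have h1 : ¬ IsUnit (x - y) := fun hu =>
    primePow_cast_ne_zero hp hN hj (hu.mul_left_eq_zero.mp h)
  have h2 := (isUnit_or_prime_dvd hp hN (x - y)).resolve_left h1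
  have h3 := isUnit_add_of_prime_dvd hp hN hx (dvd_neg.mpr h2)
  rwa [show x + -(x - y) = y by ring] at h3

lemma two_mul_mul_eq_zero_or (hp : p.Prime) (hN : N = p ^ k) {M a b s : ZMod N} (hs : IsUnit s)
    (h : M * a * b = 0) (hab : a + b = 2 * s) : 2 * M * a = 0 ∨ 2 * M * b = 0 := by
  rcases dvd_or_dvd_of_primePow hp hN a b with ⟨t, rfl⟩ | ⟨t, rfl⟩
  · right
    refine hs.mul_left_eq_zero.mp ?_
    linear_combination (-(M * a * t)) * hab + (1 + t) * h
  · left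
    refine hs.mul_left_eq_zero.mp ?_
    linear_combination (-(M * b * t)) * hab + (1 + t) * h

/-- Two units modulo a prime power differ by a multiple of `2`. -/
lemma two_dvd_sub_of_isUnit (hp : p.Prime) (hN : N = p ^ k) {x y : ZMod N}
    (hx : IsUnit x) (hy : IsUnit y) : (2 : ZMod N) ∣ x - y := by
  rcases hp.eq_two_or_odd' with rfl | hodd
  · rcases Nat.eq_zero_or_pos k with rfl | hk
    · have : Subsingleton (ZMod N) := by
        rw [pow_zero] at hN
        subst hN
        infer_instance
      exact ⟨0, Subsingleton.elim _ _⟩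
    · have hodd : ∀ z : ZMod N, IsUnit z → z.val % 2 = 1 := by
        intro z hz
        rw [← ZMod.natCast_zmod_val z] at hz
        generalize z.val = m at hz ⊢
        rw [ZMod.isUnit_iff_coprime, hN, Nat.coprime_pow_right_iff hk, Nat.coprime_two_right] at hz
        exact Nat.odd_iff.mp hz
      have h1 := hodd x hx
      have h2 := hodd y hy
      have h3 : (2 : ℤ) ∣ (x.val : ℤ) - y.val := by omega
      have h4 := map_dvd (Int.castRingHom (ZMod N)) h3
      simpa using h4
  · refine IsUnit.dvd ?_
    have := (ZMod.isUnit_iff_coprime 2 N).mpr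
      (hN ▸ Nat.Coprime.pow_right k (Nat.coprime_two_left.mpr hodd))
    simpa using this

end PrimePower

section PrimePowerPhases

variable {N p k : ℕ} [NeZero N] {ψ : AddChar (ZMod N) ℂ}

/-- Incomplete Kloosterman sums modulo `p ^ (k - ν)` with `k - ν ≥ 2`. -/
lemma sq_norm_sum_add_div_le (hp : p.Prime) (hN : N = p ^ k) (hψ : ψ.IsPrimitive) {ν : ℕ}
    (hν : ν + 2 ≤ k) (U : Finset (ZMod N)) (hUu : ∀ x ∈ U, IsUnit x)
    (hU : ∀ x ∈ U, ∀ z, x + p * z ∈ U) (a c : ZMod N) (ha : IsUnit a) :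
    ‖∑ r ∈ U, ψ (p ^ ν * (a * (r + c * r⁻¹)))‖ ^ 2 ≤ 32 * (p : ℝ) ^ (k + ν) := by
  set l := (k - ν) / 2 with hl
  have hl1 : l = l - 1 + 1 := by omega
  have hpl : ∀ z : ZMod N, (p : ZMod N) ^ l * z = p * (p ^ (l - 1) * z) := by
    intro z
    rw [hl1, pow_succ]
    simp only [Nat.add_sub_cancel]
    ring
  have h3l : (p : ZMod N) ^ ν * p ^ (3 * l) = 0 := by
    rw [← pow_add]
    exact primePow_cast_eq_zero hN (by omega)
  have hstat : ∀ x ∈ U, p ^ (k - l) * (a * (1 - c * x⁻¹ ^ 2)) = 0 →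
      p ^ (k - l) * (x ^ 2 - c) = 0 := by
    intro x hx h
    refine ha.mul_right_eq_zero.mp ?_
    linear_combination x ^ 2 * h + p ^ (k - l) * a * c * (1 + x * x⁻¹) *
      ZMod.mul_inv_of_unit x (hUu x hx)
  refine sq_norm_sum_le_of_stationary hp hN hψ (ν := ν) (l := l) (by omega) U _
    (fun x => a * (1 - c * x⁻¹ ^ 2)) (fun x => a * c * x⁻¹ ^ 3)
    (fun x hx z => by rw [hpl]; exact hU x hx _) ?_ ?_ ?_
  · intro x hx z
    have h1 := ZMod.mul_inv_of_unit x (hUu x hx)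
    have h2 := ZMod.mul_inv_of_unit _ (hUu _ (hU x hx (p ^ (l - 1) * z)))
    rw [← hpl] at h2
    set i := x⁻¹
    set j := (x + p ^ l * z)⁻¹
    set h := (p : ZMod N) ^ l * z with hh
    have h3 : (p : ZMod N) ^ ν * h ^ 3 = 0 := by
      rw [hh]
      linear_combination z ^ 3 * h3l
    have h4 : j = i - h * i ^ 2 + h ^ 2 * i ^ 3 - h ^ 3 * i ^ 3 * j := by
      linear_combination (i * h2 - j * h1) * (1 - h * i + h ^ 2 * i ^ 2)
    linear_combination p ^ ν * a * c * h4 - a * c * i ^ 3 * j * h3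
  · intro x hx h
    have hc : IsUnit c := isUnit_of_primePow_mul_sub_eq_zero hp hN (by omega)
      ((hUu x hx).pow 2) (hstat x hx h)
    have hi : IsUnit x⁻¹ := IsUnit.of_mul_eq_one x (ZMod.inv_mul_of_unit x (hUu x hx))
    exact (ha.mul hc).mul (hi.pow 3)
  · intro x hx y hy h1 h2
    refine two_mul_mul_eq_zero_or hp hN (hUu x hx) ?_ (show x - y + (x + y) = 2 * x by ring)
    linear_combination hstat x hx h1 - hstat y hy h2

/-- Stationary phase for `u * (n * u + (T₁ - T₂)) / (n * u + T₁)` when `p ^ ν` divides both `n`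
(exactly) and `T₁ - T₂`. -/
lemma sq_norm_sum_sub_div_le (hp : p.Prime) (hN : N = p ^ k) (hψ : ψ.IsPrimitive) {ν : ℕ}
    (hν0 : ν ≠ 0) (hν : ν + 2 ≤ k) (U : Finset (ZMod N)) (hUu : ∀ x ∈ U, IsUnit x)
    (hU : ∀ x ∈ U, ∀ z, x + p * z ∈ U) {n T₁ T₂ n' D : ZMod N} (hT₁ : IsUnit T₁) (hT₂ : IsUnit T₂)
    (hn' : IsUnit n') (hn : n = p ^ ν * n') (hD : T₁ - T₂ = p ^ ν * D) :
    ‖∑ u ∈ U, ψ (u - T₂ * u * (n * u + T₁)⁻¹)‖ ^ 2 ≤ 32 * (p : ℝ) ^ (k + ν) := by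
  set l := (k - ν) / 2 with hl
  have hl1 : l = l - 1 + 1 := by omega
  have hpl : ∀ z : ZMod N, (p : ZMod N) ^ l * z = p * (p ^ (l - 1) * z) := by
    intro z
    rw [hl1, pow_succ]
    simp only [Nat.add_sub_cancel]
    ring
  have h3l : (p : ZMod N) ^ ν * p ^ ν * p ^ (3 * l) = 0 := by
    rw [← pow_add, ← pow_add]
    exact primePow_cast_eq_zero hN (by omega)
  have hpn : (p : ZMod N) ∣ n := hn ▸ (dvd_pow_self _ hν0).mul_right _
  have hr : ∀ x, IsUnit (n * x + T₁) := fun x => by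
    rw [add_comm]
    exact isUnit_add_of_prime_dvd hp hN hT₁ (hpn.mul_right _)
  have hi : ∀ x, IsUnit (n * x + T₁)⁻¹ := fun x =>
    IsUnit.of_mul_eq_one _ (ZMod.inv_mul_of_unit _ (hr x))
  refine sq_norm_sum_le_of_stationary hp hN hψ (ν := ν) (l := l) (by omega) U _
    (fun x => (n' * n * x ^ 2 + 2 * n' * x * T₁ + T₁ * D) * (n * x + T₁)⁻¹ ^ 2)
    (fun x => n' * T₁ * T₂ * (n * x + T₁)⁻¹ ^ 3)
    (fun x hx z => by rw [hpl]; exact hU x hx _) ?_ ?_ ?_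
  · intro x hx z
    have h1 := ZMod.mul_inv_of_unit _ (hr x)
    have h2 := ZMod.mul_inv_of_unit _ (hr (x + p ^ l * z))
    set i := (n * x + T₁)⁻¹
    set j := (n * (x + p ^ l * z) + T₁)⁻¹
    set h := (p : ZMod N) ^ l * z with hh
    have h3 : n ^ 2 * h ^ 3 = 0 := by
      rw [hh, hn]
      linear_combination n' ^ 2 * z ^ 3 * h3l
    have h4 : j = i - n * h * i ^ 2 + (n * h) ^ 2 * i ^ 2 * j := by
      linear_combination (i * h2 - j * h1) * (1 - n * h * i)
    have h5 : (x + h) * j = x * i + h * T₁ * (i ^ 2 - n * h * i ^ 3) := by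
      linear_combination -(x + h) * j * h1 + x * i * h2 + h * T₁ * i * h4 + T₁ * i ^ 3 * j * h3
    have h6 : 1 - T₁ * T₂ * i ^ 2 =
        p ^ ν * (n' * n * x ^ 2 + 2 * n' * x * T₁ + T₁ * D) * i ^ 2 := by
      linear_combination -(1 + (n * x + T₁) * i) * h1 + i ^ 2 * (n * x ^ 2 + 2 * x * T₁) * hn +
        i ^ 2 * T₁ * hD
    linear_combination -T₂ * h5 + h * h6 + T₁ * T₂ * i ^ 3 * h ^ 2 * hn
  · intro x hx h
    exact ((hn'.mul hT₁).mul hT₂).mul ((hi x).pow 3)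
  · intro x hx y hy h1 h2
    left
    obtain ⟨s, hs⟩ := two_dvd_sub_of_isUnit hp hN (hUu x hx) (hUu y hy)
    have h3 : ∀ x, p ^ (k - l) * ((n' * n * x ^ 2 + 2 * n' * x * T₁ + T₁ * D) *
        (n * x + T₁)⁻¹ ^ 2) = 0 → p ^ (k - l) * (n' * n * x ^ 2 + 2 * n' * x * T₁ + T₁ * D) = 0 :=
      fun x h => ((hi x).pow 2).mul_left_eq_zero.mp (by rw [← h]; ring)
    have h4 : IsUnit (n * x + T₁ + -(n * s)) :=
      isUnit_add_of_prime_dvd hp hN (hr x) ((hpn.mul_right _).neg_right)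
    refine (hn'.mul h4).mul_left_eq_zero.mp ?_
    have h5 := h3 x h1
    have h6 := h3 y h2
    linear_combination h5 - h6 + p ^ (k - l) * n' * n * (x - y) * hs
end PrimePowerPhases

section Fibres

open scoped Classical in
/-- Summation over the fibres of a surjective homomorphism of finite groups. -/
@[to_additive]
lemma MonoidHom.sum_comp_of_surjective {G H : Type*} [Group G] [Fintype G] [Group H] [Fintype H]
    (φ : G →* H) (hφ : Function.Surjective φ) (F : H → ℂ) :
    ∑ x, F (φ x) = (Finset.univ.filter fun x => φ x = 1).card * ∑ y, F y := by
  rw [Finset.sum_comp, Finset.image_univ_of_surjective hφ, Finset.mul_sum]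
  refine Finset.sum_congr rfl fun y _ => ?_
  rw [nsmul_eq_mul, MonoidHom.card_fiber_eq_of_mem_range φ (hφ y) (hφ 1)]

end Fibres

section PrimeModulus

variable {N p k : ℕ}

lemma norm_sum_add_div_le_of_prime [Fact p.Prime] {χ : AddChar (ZMod p) ℂ} (hχ : χ ≠ 1)
    {a : ZMod p} (ha : a ≠ 0) (c w : ZMod p) :
    ‖∑ y : ZMod p, if y ≠ 0 ∧ y ≠ w then χ (a * (y + c / y)) else 0‖ ≤ 3 * √p := by
  have hp : p.Prime := Fact.out
  have h1 : (1 : ℝ) ≤ √p := Real.one_le_sqrt.mpr (by exact_mod_cast hp.one_le)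
  have hprim := AddChar.IsPrimitive.of_ne_one hχ
  have key : ‖∑ y : ZMod p, if y ≠ 0 then χ (a * (y + c / y)) else 0‖ ≤ 2 * √p := by
    by_cases hc : c = 0
    · have h2 := AddChar.sum_mulShift a hprim
      rw [if_neg ha, Nat.cast_zero] at h2
      have h3 : ∑ y : ZMod p, (if y ≠ 0 then χ (a * (y + c / y)) else 0) = -1 := by
        rw [Fintype.sum_eq_add_sum_compl 0] at h2 ⊢
        rw [zero_mul, AddChar.map_zero_eq_one] at h2
        rw [if_neg (by simp), zero_add]
        rw [← sub_eq_zero, sub_neg_eq_add, add_comm, ← h2]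
        congr 1
        refine Finset.sum_congr rfl fun y hy => ?_
        rw [if_pos (by simpa using hy), hc, zero_div, add_zero, mul_comm]
      rw [h3, norm_neg, norm_one]
      linarith
    · have h2 := norm_kloosterman_le (hprim ha) hc
      rw [Finset.sum_filter] at h2
      simpa only [AddChar.mulShift_apply] using h2
  have hsplit : ∑ y : ZMod p, (if y ≠ 0 ∧ y ≠ w then χ (a * (y + c / y)) else 0) =
      (∑ y : ZMod p, if y ≠ 0 then χ (a * (y + c / y)) else 0) -
        if w ≠ 0 then χ (a * (w + c / w)) else 0 := by
    rw [eq_sub_iff_add_eq, Fintype.sum_eq_add_sum_compl w, Fintype.sum_eq_add_sum_compl w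
      (fun y => if y ≠ 0 then χ (a * (y + c / y)) else 0), if_neg (by simp), zero_add, add_comm]
    congr 1
    refine Finset.sum_congr rfl fun y hy => ?_
    have : y ≠ w := by simpa using hy
    simp [this]
  rw [hsplit]
  refine (norm_sub_le _ _).trans ?_
  have : ‖if w ≠ 0 then χ (a * (w + c / w)) else 0‖ ≤ 1 := by
    split_ifs
    · rw [AddChar.norm_apply]
    · simp
  linarith

variable [NeZero N] {ψ : AddChar (ZMod N) ℂ}

lemma isUnit_iff_castHom_ne_zero [Fact p.Prime] (hN : N = p ^ k) (hpN : p ∣ N) (x : ZMod N) :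
    IsUnit x ↔ ZMod.castHom hpN (ZMod p) x ≠ 0 := by
  refine ⟨fun h => (h.map (ZMod.castHom hpN (ZMod p))).ne_zero, fun h => ?_⟩
  refine (isUnit_or_prime_dvd Fact.out hN x).resolve_right ?_
  rintro ⟨y, rfl⟩
  exact h (by rw [map_mul, map_natCast, ZMod.natCast_self, zero_mul])

lemma sum_comp_castHom [Fact p.Prime] {ν : ℕ} (hN : N = p ^ (ν + 1)) (hpN : p ∣ N)
    (F : ZMod p → ℂ) :
    ∑ x : ZMod N, F (ZMod.castHom hpN (ZMod p) x) = (p ^ ν : ℕ) * ∑ y, F y := by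
  obtain ⟨K, hfib⟩ : ∃ K : ℕ, ∀ F : ZMod p → ℂ,
      ∑ x : ZMod N, F (ZMod.castHom hpN (ZMod p) x) = K * ∑ y, F y :=
    ⟨_, AddMonoidHom.sum_comp_of_surjective (ZMod.castHom hpN (ZMod p)).toAddMonoidHom
      (ZMod.castHom_surjective hpN)⟩
  have h1 := hfib 1
  simp only [Pi.one_apply, Finset.sum_const, Finset.card_univ, ZMod.card, nsmul_eq_mul,
    mul_one] at h1
  have h2 : N = K * p := by exact_mod_cast h1
  rw [hN, pow_succ] at h2
  rw [hfib, Nat.eq_of_mul_eq_mul_right (Fact.out : p.Prime).pos h2]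

/-- Incomplete Kloosterman sums whose phase only depends on the residue modulo `p`. -/
lemma sq_norm_sum_add_div_le_of_succ (hp : p.Prime) (hN : N = p ^ k) (hψ : ψ.IsPrimitive) {ν : ℕ}
    (hν : ν + 1 = k) {a : ZMod N} (ha : IsUnit a) (c w : ZMod N) :
    ‖∑ r : ZMod N with IsUnit r ∧ IsUnit (r - w), ψ (p ^ ν * (a * (r + c * r⁻¹)))‖ ^ 2 ≤
      32 * (p : ℝ) ^ (k + ν) := by
  have : Fact p.Prime := ⟨hp⟩
  have hpN : p ∣ N := hN ▸ dvd_pow_self p (by omega)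
  set π := ZMod.castHom hpN (ZMod p) with hπ
  have hunit : ∀ x, IsUnit x ↔ π x ≠ 0 := isUnit_iff_castHom_ne_zero hN hpN
  have hker : ∀ x y, π x = π y → (p : ZMod N) ^ ν * x = p ^ ν * y := by
    intro x y h
    rcases isUnit_or_prime_dvd hp hN (x - y) with h1 | ⟨z, hz⟩
    · exact absurd (by rw [map_sub, h, sub_self]) ((hunit _).mp h1)
    · have h2 := primePow_cast_eq_zero (p := p) hN hν.ge
      rw [pow_succ] at h2
      linear_combination (p : ZMod N) ^ ν * hz + z * h2
  choose σ hσ using ZMod.castHom_surjective hpN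
  let χ : AddChar (ZMod p) ℂ :=
    { toFun := fun y => ψ (p ^ ν * σ y)
      map_zero_eq_one' := by
        rw [hker (σ 0) 0 (by rw [hσ, map_zero]), mul_zero, AddChar.map_zero_eq_one]
      map_add_eq_mul' := fun x y => by
        rw [hker (σ (x + y)) (σ x + σ y) (by rw [hσ, map_add, hσ, hσ]), mul_add,
          AddChar.map_add_eq_mul] }
  have hχπ : ∀ x, χ (π x) = ψ (p ^ ν * x) := fun x => by
    change ψ (p ^ ν * σ (π x)) = _
    rw [hker _ x (hσ _)]
  have hχ : χ ≠ 1 := by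
    obtain ⟨z, hz⟩ := AddChar.ne_one_iff.mp (hψ (primePow_cast_ne_zero hp hN (j := ν) (by omega)))
    rw [AddChar.mulShift_apply, ← hχπ] at hz
    exact AddChar.ne_one_iff.mpr ⟨_, hz⟩
  have hsum : ∑ r : ZMod N with IsUnit r ∧ IsUnit (r - w), ψ (p ^ ν * (a * (r + c * r⁻¹))) =
      (p ^ ν : ℕ) * ∑ y : ZMod p, if y ≠ 0 ∧ y ≠ π w then χ (π a * (y + π c / y)) else 0 := by
    rw [← sum_comp_castHom (hν ▸ hN) hpN, Finset.sum_filter]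
    refine Finset.sum_congr rfl fun r _ => ?_
    change _ = if π r ≠ 0 ∧ π r ≠ π w then χ (π a * (π r + π c / π r)) else 0
    have h0 : IsUnit r ∧ IsUnit (r - w) ↔ π r ≠ 0 ∧ π r ≠ π w := by
      rw [hunit, hunit, map_sub, sub_ne_zero]
    rw [if_congr h0 rfl rfl]
    by_cases h : π r ≠ 0 ∧ π r ≠ π w
    · rw [if_pos h, if_pos h, ← hχπ]
      have h1 : π r⁻¹ = (π r)⁻¹ := by
        refine eq_inv_of_mul_eq_one_right ?_
        rw [← map_mul, ZMod.mul_inv_of_unit _ ((hunit r).mpr h.1), map_one]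
      rw [π.map_mul, π.map_add, π.map_mul, h1, div_eq_mul_inv]
    · rw [if_neg h, if_neg h]
  have hb := norm_sum_add_div_le_of_prime hχ ((hunit a).mp ha) (π c) (π w)
  rw [hsum, norm_mul, Complex.norm_natCast, mul_pow]
  have h2 := pow_le_pow_left₀ (norm_nonneg _) hb 2
  rw [mul_pow, Real.sq_sqrt (Nat.cast_nonneg p)] at h2
  refine (mul_le_mul_of_nonneg_left h2 (by positivity)).trans ?_
  have h3 : (p : ℝ) ^ (k + ν) = ((p ^ ν : ℕ) : ℝ) ^ 2 * p := by
    rw [← hν]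
    push_cast
    ring
  rw [h3]
  have : (0 : ℝ) ≤ ((p ^ ν : ℕ) : ℝ) ^ 2 * p := by positivity
  linarith

lemma sum_units_eq_sub (hp : p.Prime) (hN : N = p ^ k) {ν : ℕ} (hν : ν + 1 = k)
    (q : ZMod N → ZMod N) (hq : ∀ x, q (p * x) = 0) :
    ∑ u : ZMod N with IsUnit u, ψ (q u) = ∑ u, ψ (q u) - (p ^ ν : ℕ) := by
  have : Fact p.Prime := ⟨hp⟩
  have hpN : p ∣ N := hN ▸ dvd_pow_self p (by omega)
  have h1 := sum_comp_castHom (hν ▸ hN) hpN (fun y => if y = 0 then 1 else 0)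
  rw [Finset.sum_ite_eq' Finset.univ, if_pos (Finset.mem_univ _), mul_one] at h1
  rw [eq_sub_iff_add_eq, ← h1, Finset.sum_filter, ← Finset.sum_add_distrib]
  refine Finset.sum_congr rfl fun x _ => ?_
  by_cases hx : IsUnit x
  · rw [if_pos hx, if_neg ((isUnit_iff_castHom_ne_zero hN hpN x).mp hx), add_zero]
  · have h2 : ZMod.castHom hpN (ZMod p) x = 0 := by
      by_contra h
      exact hx ((isUnit_iff_castHom_ne_zero hN hpN x).mpr h)
    obtain ⟨y, rfl⟩ := (isUnit_or_prime_dvd hp hN x).resolve_left hx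
    rw [if_neg hx, if_pos h2, zero_add, hq, AddChar.map_zero_eq_one]

/-- The quadratic phase sum over units modulo `p ^ k` for a phase divisible by `p ^ (k - 1)`. -/
lemma sq_norm_sum_units_quadratic_le (hp : p.Prime) (hN : N = p ^ k) (hψ : ψ.IsPrimitive) {ν : ℕ}
    (hν : ν + 1 = k) {a : ZMod N} (ha : IsUnit a) (b : ZMod N) :
    ‖∑ u : ZMod N with IsUnit u, ψ (p ^ ν * (b * u + a * u ^ 2))‖ ^ 2 ≤
      32 * (p : ℝ) ^ (k + ν) := by
  have hpk := primePow_cast_eq_zero (p := p) hN hν.ge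
  rw [pow_succ] at hpk
  rw [sum_units_eq_sub hp hN hν (fun u => p ^ ν * (b * u + a * u ^ 2))
    (fun x => by linear_combination (b * x + a * p * x ^ 2) * hpk)]
  have h1 := sq_norm_sum_quadratic_le hψ (p ^ ν * b) (p ^ ν * a) (m := 2 * p ^ ν)
    (by have := hp.pos; positivity) (fun h hh => by
      rw [nsmul_eq_mul]
      push_cast
      refine ha.mul_right_eq_zero.mp ?_
      rw [← hh]
      ring)
  have h2 : ∑ u, ψ (p ^ ν * (b * u + a * u ^ 2)) =
      ∑ z, ψ (p ^ ν * b * z + p ^ ν * a * z ^ 2) := by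
    refine Finset.sum_congr rfl fun z _ => ?_
    congr 1
    ring
  rw [h2]
  have h3 := norm_sub_le (∑ z, ψ (p ^ ν * b * z + p ^ ν * a * z ^ 2)) ((p ^ ν : ℕ) : ℂ)
  rw [Complex.norm_natCast] at h3
  set X := ‖∑ z, ψ (p ^ ν * b * z + p ^ ν * a * z ^ 2)‖
  have hX : 0 ≤ X := norm_nonneg _
  have hp1 : (1 : ℝ) ≤ p := by exact_mod_cast hp.one_le
  have h4 : (p : ℝ) ^ (k + ν) = ((p ^ ν : ℕ) : ℝ) ^ 2 * p := by
    rw [← hν]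
    push_cast
    ring
  have h5 : (N : ℝ) * (2 * p ^ ν : ℕ) = 2 * (((p ^ ν : ℕ) : ℝ) ^ 2 * p) := by
    rw [hN, ← hν]
    push_cast
    ring
  rw [h5] at h1
  rw [h4]
  have h6 : ((p ^ ν : ℕ) : ℝ) ^ 2 ≤ ((p ^ ν : ℕ) : ℝ) ^ 2 * p :=
    le_mul_of_one_le_right (by positivity) hp1
  have h7 := pow_le_pow_left₀ (norm_nonneg _) h3 2
  have h8 : (0 : ℝ) ≤ ((p ^ ν : ℕ) : ℝ) := by positivity
  nlinarith [sq_nonneg (X - ((p ^ ν : ℕ) : ℝ))]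

/-- The linear phase sum over units modulo `p ^ k` for a phase exactly divisible by
`p ^ (k - 1)`. -/
lemma norm_sum_units_linear (hp : p.Prime) (hN : N = p ^ k) (hψ : ψ.IsPrimitive) {ν : ℕ}
    (hν : ν + 1 = k) {b : ZMod N} (hb : IsUnit b) :
    ‖∑ u : ZMod N with IsUnit u, ψ (p ^ ν * (b * u))‖ = p ^ ν := by
  have hpk := primePow_cast_eq_zero (p := p) hN hν.ge
  rw [pow_succ] at hpk
  rw [sum_units_eq_sub hp hN hν (fun u => p ^ ν * (b * u))
    (fun x => by linear_combination (b * x) * hpk)]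
  have h1 := AddChar.sum_mulShift (p ^ ν * b) hψ
  rw [if_neg fun h => primePow_cast_ne_zero hp hN (show ν < k by omega)
    (hb.mul_left_eq_zero.mp h), Nat.cast_zero] at h1
  have h2 : ∑ u, ψ (p ^ ν * (b * u)) = ∑ u, ψ (u * (p ^ ν * b)) := by
    refine Finset.sum_congr rfl fun z _ => ?_
    congr 1
    ring
  rw [h2, h1, zero_sub, norm_neg, Complex.norm_natCast]
  push_cast
  rfl

end PrimeModulus

section PairSum

/-- The correlation of two Kloosterman sums, in terms of pairs of units on a curve. -/
noncomputable def pairSum {R : Type*} [CommRing R] [Fintype R] [DecidableEq R] (ψ : AddChar R ℂ)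
    (w₁ w₂ t₁ t₂ n : R) : ℂ :=
  ∑ u : Rˣ, ∑ v : Rˣ,
    if w₂ * t₁ * ↑u⁻¹ + w₁ * t₂ * ↑v⁻¹ + n = 0 then ψ (w₂ * u + w₁ * v) else 0

lemma pairSum_swap {R : Type*} [CommRing R] [Fintype R] [DecidableEq R] (ψ : AddChar R ℂ)
    (w₁ w₂ t₁ t₂ n : R) : pairSum ψ w₁ w₂ t₁ t₂ n = pairSum ψ w₂ w₁ t₂ t₁ n := by
  rw [pairSum, Finset.sum_comm]
  refine Finset.sum_congr rfl fun v _ => Finset.sum_congr rfl fun u _ => ?_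
  rw [add_comm (w₂ * t₁ * _), add_comm (w₂ * _)]

variable {N p k : ℕ} [NeZero N] {ψ : AddChar (ZMod N) ℂ}

lemma sum_units_eq_sum_filter (F : ZMod N → ℂ) :
    ∑ u : (ZMod N)ˣ, F u = ∑ x : ZMod N with IsUnit x, F x := by
  refine Finset.sum_bij (fun u _ => (u : ZMod N)) (fun u _ => by simp)
    (fun u _ v _ h => Units.ext h) (fun x hx => ?_) (fun _ _ => rfl)
  obtain ⟨u, rfl⟩ := (Finset.mem_filter.mp hx).2
  exact ⟨u, Finset.mem_univ _, rfl⟩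

omit [NeZero N] in
lemma sum_eq_zero_of_shift (U : Finset (ZMod N)) (h : ZMod N) (hU : ∀ x ∈ U, x + h ∈ U)
    (F : ZMod N → ℂ) {c : ℂ} (hc : c ≠ 1) (hF : ∀ x ∈ U, F (x + h) = c * F x) :
    ∑ x ∈ U, F x = 0 := by
  have hmap : U.map (Equiv.addRight h).toEmbedding = U := by
    refine Finset.eq_of_subset_of_card_le (fun y hy => ?_) (Finset.card_map _).ge
    obtain ⟨x, hx, rfl⟩ := Finset.mem_map.mp hy
    exact hU x hx
  have h1 : ∑ x ∈ U, F x = c * ∑ x ∈ U, F x := by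
    conv_lhs => rw [← hmap]
    rw [Finset.sum_map, Finset.mul_sum]
    exact Finset.sum_congr rfl hF
  have h2 : (c - 1) * ∑ x ∈ U, F x = 0 := by linear_combination -h1
  exact (mul_eq_zero.mp h2).resolve_left (sub_ne_zero.mpr hc)

omit [NeZero N] in
lemma exists_map_primePow_mul_ne_one (hp : p.Prime) (hN : N = p ^ k) (hψ : ψ.IsPrimitive) {ν : ℕ}
    (hν : ν < k) {b : ZMod N} (hb : IsUnit b) : ∃ z, ψ (p ^ ν * b * z) ≠ 1 := by
  obtain ⟨z, hz⟩ := AddChar.ne_one_iff.mp (hψ (a := p ^ ν * b) fun h =>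
    primePow_cast_ne_zero hp hN hν (hb.mul_left_eq_zero.mp h))
  exact ⟨z, by rwa [AddChar.mulShift_apply] at hz⟩

lemma add_prime_mul_mem_units (hp : p.Prime) (hN : N = p ^ k) :
    ∀ x ∈ Finset.univ.filter fun x : ZMod N => IsUnit x, ∀ z,
      x + p * z ∈ Finset.univ.filter fun x : ZMod N => IsUnit x := by
  intro x hx z
  rw [Finset.mem_filter] at hx ⊢
  exact ⟨Finset.mem_univ _, isUnit_add_of_prime_dvd hp hN hx.2 (dvd_mul_right _ _)⟩

lemma sum_units_ite_eq_zero (hp : p.Prime) (hN : N = p ^ k) (hψ : ψ.IsPrimitive) (hk : 2 ≤ k)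
    {T : ZMod N} (hT : ¬ IsUnit T) (a : ZMod N) :
    ∑ v : (ZMod N)ˣ, (if T * ↑v⁻¹ = a then ψ v else 0) = 0 := by
  obtain ⟨T', rfl⟩ := (isUnit_or_prime_dvd hp hN T).resolve_left hT
  obtain ⟨z, hz⟩ := exists_map_primePow_mul_ne_one hp hN hψ (show k - 1 < k by omega) isUnit_one
  have hpk := primePow_cast_eq_zero (p := p) hN (show k ≤ k - 1 + 1 by omega)
  rw [pow_succ] at hpk
  have hmem : ∀ x ∈ Finset.univ.filter fun x : ZMod N => IsUnit x,
      x + p ^ (k - 1) * 1 * z ∈ Finset.univ.filter fun x : ZMod N => IsUnit x := by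
    intro x hx
    have := add_prime_mul_mem_units hp hN x hx (p ^ (k - 2) * z)
    rwa [← mul_assoc, ← pow_succ', show k - 2 + 1 = k - 1 by omega, ← mul_one (_ ^ _)] at this
  simp_rw [← ZMod.inv_coe_unit]
  rw [sum_units_eq_sum_filter (fun x => if (p : ZMod N) * T' * x⁻¹ = a then ψ x else 0)]
  refine sum_eq_zero_of_shift _ _ hmem _ hz fun x hx => ?_
  have h1 := ZMod.mul_inv_of_unit _ (Finset.mem_filter.mp hx).2
  have h2 := ZMod.mul_inv_of_unit _ (Finset.mem_filter.mp (hmem x hx)).2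
  have h3 : (p : ZMod N) * T' * (x + p ^ (k - 1) * 1 * z)⁻¹ = p * T' * x⁻¹ := by
    set i := x⁻¹
    set j := (x + (p : ZMod N) ^ (k - 1) * 1 * z)⁻¹
    linear_combination p * T' * (i * h2 - j * h1) - T' * i * j * z * hpk
  rw [h3]
  split_ifs
  · rw [AddChar.map_add_eq_mul, mul_comm]
  · rw [mul_zero]

lemma norm_sum_units_ite_le_one (hp : p.Prime) (hN : N = p ^ k) (hψ : ψ.IsPrimitive)
    (hk : 1 ≤ k) (T a : ZMod N) :
    ‖∑ v : (ZMod N)ˣ, if T * ↑v⁻¹ = a then ψ v else 0‖ ≤ 1 := by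
  by_cases hT : IsUnit T
  · rw [← Finset.sum_filter]
    refine (norm_sum_le _ _).trans ?_
    simp only [AddChar.norm_apply, Finset.sum_const, nsmul_eq_mul, mul_one]
    have : (Finset.univ.filter fun v : (ZMod N)ˣ => T * ↑v⁻¹ = a).card ≤ 1 := by
      refine Finset.card_le_one.mpr fun v hv w hw => ?_
      have h := (Finset.mem_filter.mp hv).2.trans (Finset.mem_filter.mp hw).2.symm
      exact inv_injective (Units.ext (hT.mul_left_cancel h))
    exact_mod_cast this
  · rcases hk.lt_or_eq with hk2 | hk1
    · rw [sum_units_ite_eq_zero hp hN hψ hk2 hT, norm_zero]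
      exact zero_le_one
    · have hT0 : T = 0 := by
        obtain ⟨T', rfl⟩ := (isUnit_or_prime_dvd hp hN T).resolve_left hT
        have := primePow_cast_eq_zero (p := p) hN hk1.ge
        rw [pow_one] at this
        rw [this, zero_mul]
      simp_rw [hT0, zero_mul]
      split_ifs
      · rw [sum_units_eq_sum_filter (fun x => ψ x)]
        have := norm_sum_units_linear hp hN hψ (ν := 0) (by omega) isUnit_one
        simp only [pow_zero, one_mul] at this
        exact this.le
      · simp

lemma norm_pairSum_zero_le (hp : p.Prime) (hN : N = p ^ k) (hψ : ψ.IsPrimitive)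
    (hk : 1 ≤ k) (T₁ T₂ n : ZMod N) :
    ‖pairSum ψ 1 0 T₁ T₂ n‖ ≤ Fintype.card (ZMod N)ˣ := by
  refine (norm_sum_le _ _).trans ((Finset.sum_le_card_nsmul _ _ 1 fun u _ => ?_).trans_eq
    (by rw [nsmul_one, Finset.card_univ]))
  have h1 : ∀ v : (ZMod N)ˣ, (if 0 * T₁ * ↑u⁻¹ + 1 * T₂ * ↑v⁻¹ + n = 0 then
      ψ (0 * u + 1 * v) else 0) = if T₂ * ↑v⁻¹ = -n then ψ v else 0 := fun v => by
    refine if_congr ?_ (by rw [zero_mul, one_mul, zero_add]) rfl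
    rw [eq_neg_iff_add_eq_zero, zero_mul, zero_mul, zero_add, one_mul]
  rw [Finset.sum_congr rfl fun v _ => h1 v]
  exact norm_sum_units_ite_le_one hp hN hψ hk T₂ (-n)

lemma norm_pairSum_le_one_of_not_isUnit (hp : p.Prime) (hN : N = p ^ k) (hψ : ψ.IsPrimitive)
    (hk : 1 ≤ k) {w T₁ T₂ n : ZMod N} (hw : k = 1 → w = 1) (hT : ¬ IsUnit T₂) :
    ‖pairSum ψ 1 w T₁ T₂ n‖ ≤ 1 := by
  rcases hk.lt_or_eq with hk2 | hk1
  · have : pairSum ψ 1 w T₁ T₂ n = 0 := by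
      refine Finset.sum_eq_zero fun u _ => ?_
      have h1 := sum_units_ite_eq_zero hp hN hψ hk2 hT (-(w * T₁ * ↑u⁻¹ + n))
      have h2 : ∀ v : (ZMod N)ˣ, (if w * T₁ * ↑u⁻¹ + 1 * T₂ * ↑v⁻¹ + n = 0 then
          ψ (w * u + 1 * v) else 0) = ψ (w * u) *
            if T₂ * ↑v⁻¹ = -(w * T₁ * ↑u⁻¹ + n) then ψ v else 0 := by
        intro v
        have h3 : w * T₁ * ↑u⁻¹ + 1 * T₂ * ↑v⁻¹ + n = 0 ↔
            T₂ * ↑v⁻¹ = -(w * T₁ * ↑u⁻¹ + n) := by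
          rw [eq_neg_iff_add_eq_zero]
          ring_nf
        rw [if_congr h3 rfl rfl, mul_ite, mul_zero, one_mul, AddChar.map_add_eq_mul]
      rw [Finset.sum_congr rfl fun v _ => h2 v, ← Finset.mul_sum, h1, mul_zero]
    rw [this, norm_zero]
    exact zero_le_one
  · have hT0 : T₂ = 0 := by
      obtain ⟨T', rfl⟩ := (isUnit_or_prime_dvd hp hN T₂).resolve_left hT
      have := primePow_cast_eq_zero (p := p) hN hk1.ge
      rw [pow_one] at this
      rw [this, zero_mul]
    have h1 : pairSum ψ 1 w T₁ T₂ n = (∑ u : (ZMod N)ˣ, if T₁ * ↑u⁻¹ = -n then ψ u else 0) *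
        ∑ v : (ZMod N)ˣ, if (0 : ZMod N) * ↑v⁻¹ = 0 then ψ v else 0 := by
      rw [pairSum, Finset.sum_mul_sum]
      refine Finset.sum_congr rfl fun u _ => Finset.sum_congr rfl fun v _ => ?_
      rw [hT0, hw hk1.symm]
      simp only [eq_neg_iff_add_eq_zero, one_mul, zero_mul, add_zero, if_true, ite_mul,
        AddChar.map_add_eq_mul]
    rw [h1, norm_mul]
    exact mul_le_one₀ (norm_sum_units_ite_le_one hp hN hψ hk _ _) (norm_nonneg _)
      (norm_sum_units_ite_le_one hp hN hψ hk _ _)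

/-- Eliminating one of the variables. -/
lemma pairSum_eq_sum_filter {w T₁ T₂ n : ZMod N} (hT : IsUnit T₂) :
    pairSum ψ 1 w T₁ T₂ n = ∑ u : ZMod N with IsUnit u ∧ IsUnit (n * u + w * T₁),
      ψ (w * u - T₂ * u * (n * u + w * T₁)⁻¹) := by
  rw [← Finset.filter_filter, Finset.sum_filter, ← sum_units_eq_sum_filter
    (fun u => if IsUnit (n * u + w * T₁) then ψ (w * u - T₂ * u * (n * u + w * T₁)⁻¹) else 0)]
  refine Finset.sum_congr rfl fun u _ => ?_
  obtain ⟨T, rfl⟩ := hT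
  have hiff : ∀ v : (ZMod N)ˣ, w * T₁ * ↑u⁻¹ + 1 * ↑T * ↑v⁻¹ + n = 0 ↔
      (n * u + w * T₁) * v = -(T * u) := by
    intro v
    have hu : (u : ZMod N) * ↑u⁻¹ = 1 := u.mul_inv
    have hv : (v : ZMod N) * ↑v⁻¹ = 1 := v.mul_inv
    constructor
    · intro h
      linear_combination u * v * h - w * T₁ * v * hu - T * u * hv
    · intro h
      linear_combination ↑u⁻¹ * ↑v⁻¹ * h - (n * ↑u * ↑u⁻¹ + w * T₁ * ↑u⁻¹) * hv -
        (n + T * ↑v⁻¹) * hu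
  split_ifs with hr
  · obtain ⟨r, hr⟩ := hr
    rw [← hr] at hiff ⊢
    have hiff' : ∀ v : (ZMod N)ˣ, w * T₁ * ↑u⁻¹ + 1 * ↑T * ↑v⁻¹ + n = 0 ↔
        v = -(T * u * r⁻¹) := by
      intro v
      rw [hiff]
      constructor
      · intro h
        have : r * v = -(T * u) := Units.ext (by simpa using h)
        rw [← neg_mul, ← this]
        simp
      · rintro rfl
        have hr' : (r : ZMod N) * ↑r⁻¹ = 1 := r.mul_inv
        simp only [Units.val_neg, Units.val_mul]
        linear_combination (-(T * u : ZMod N)) * hr'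
    simp_rw [hiff']
    rw [Finset.sum_ite_eq' Finset.univ, if_pos (Finset.mem_univ _)]
    congr 1
    rw [ZMod.inv_coe_unit]
    simp only [Units.val_neg, Units.val_mul]
    ring
  · refine Finset.sum_eq_zero fun v _ => if_neg fun h => hr ?_
    have h1 := (hiff v).mp h
    have h2 : IsUnit ((n * u + w * T₁) * v) := h1 ▸ (T * u).isUnit.neg
    exact isUnit_of_mul_isUnit_left h2

end PairSum

section LocalBound

variable {N p k : ℕ} [NeZero N] {ψ : AddChar (ZMod N) ℂ}

lemma sq_norm_pairSum_le_of_isUnit (hp : p.Prime) (hN : N = p ^ k) (hψ : ψ.IsPrimitive)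
    {γ : ℕ} (hγ : γ < k) {T₁ T₂ n : ZMod N} (hT₂ : IsUnit T₂) (hn : IsUnit n) :
    ‖pairSum ψ 1 (p ^ γ) T₁ T₂ n‖ ^ 2 ≤ 32 * (p : ℝ) ^ (k + γ) := by
  set W := (p : ZMod N) ^ γ * T₁ with hW
  have hnn := ZMod.mul_inv_of_unit n hn
  have hn' : IsUnit n⁻¹ := IsUnit.of_mul_eq_one n (ZMod.inv_mul_of_unit n hn)
  have h1 : pairSum ψ 1 (p ^ γ) T₁ T₂ n = ψ (-(n⁻¹ * (p ^ γ * W + T₂))) *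
      ∑ r : ZMod N with IsUnit r ∧ IsUnit (r - W),
        ψ (p ^ γ * (n⁻¹ * (r + T₁ * T₂ * r⁻¹))) := by
    rw [pairSum_eq_sum_filter hT₂, Finset.mul_sum]
    refine Finset.sum_bij' (fun u _ => n * u + W) (fun r _ => n⁻¹ * (r - W)) ?_ ?_ ?_ ?_ ?_
    · intro u hu
      obtain ⟨-, h1, h2⟩ := Finset.mem_filter.mp hu
      exact Finset.mem_filter.mpr ⟨Finset.mem_univ _, h2, by
        rw [add_sub_cancel_right]
        exact hn.mul h1⟩
    · intro r hr
      obtain ⟨-, h1, h2⟩ := Finset.mem_filter.mp hr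
      refine Finset.mem_filter.mpr ⟨Finset.mem_univ _, hn'.mul h2, ?_⟩
      rwa [show n * (n⁻¹ * (r - W)) + W = r by linear_combination (r - W) * hnn]
    · intro u _
      linear_combination u * hnn
    · intro r _
      linear_combination (r - W) * hnn
    · intro u hu
      obtain ⟨-, h1, h2⟩ := Finset.mem_filter.mp hu
      have h3 := ZMod.mul_inv_of_unit _ h2
      rw [← AddChar.map_add_eq_mul]
      congr 1
      set j := (n * u + W)⁻¹
      linear_combination (-(p : ZMod N) ^ γ * u + T₂ * u * j) * hnn - n⁻¹ * T₂ * h3 +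
        n⁻¹ * T₂ * j * hW
  rw [h1, norm_mul, AddChar.norm_apply, one_mul]
  rcases (Nat.succ_le_of_lt hγ).lt_or_eq with h | h
  · refine sq_norm_sum_add_div_le hp hN hψ h _ (fun x hx => (Finset.mem_filter.mp hx).2.1)
      (fun x hx z => ?_) _ _ hn'
    obtain ⟨-, h1, h2⟩ := Finset.mem_filter.mp hx
    refine Finset.mem_filter.mpr ⟨Finset.mem_univ _,
      isUnit_add_of_prime_dvd hp hN h1 (dvd_mul_right _ _), ?_⟩
    rw [add_sub_right_comm]
    exact isUnit_add_of_prime_dvd hp hN h2 (dvd_mul_right _ _)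
  · exact sq_norm_sum_add_div_le_of_succ hp hN hψ h hn' _ _

lemma pairSum_eq_zero_of_prime_dvd (hp : p.Prime) (hN : N = p ^ k) (hk : k ≠ 0)
    {w T₁ T₂ n : ZMod N} (hT₂ : IsUnit T₂) (hn : (p : ZMod N) ∣ n) (hw : (p : ZMod N) ∣ w) :
    pairSum ψ 1 w T₁ T₂ n = 0 := by
  rw [pairSum_eq_sum_filter hT₂, Finset.filter_eq_empty_iff.mpr, Finset.sum_empty]
  rintro u - ⟨-, h⟩
  exact not_isUnit_of_prime_dvd hp hN hk (dvd_add (hn.mul_right _) (hw.mul_right _)) h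

lemma sq_norm_pairSum_le_of_prime_dvd (hp : p.Prime) (hN : N = p ^ k) (hψ : ψ.IsPrimitive)
    {ν δ : ℕ} (hν0 : 1 ≤ ν) (hν : ν ≤ k) (hδ : δ ≤ ν) {T₁ T₂ n n' D : ZMod N}
    (hT₁ : IsUnit T₁) (hT₂ : IsUnit T₂) (hn : n = p ^ ν * n') (hn' : ν < k → IsUnit n')
    (hD : T₁ - T₂ = p ^ δ * D) (hD' : δ < ν → IsUnit D) :
    ‖pairSum ψ 1 1 T₁ T₂ n‖ ^ 2 * p ^ ν ≤ 32 * (p : ℝ) ^ k * p ^ (2 * δ) := by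
  have hp1 : (1 : ℝ) ≤ p := by exact_mod_cast hp.one_le
  have hpn : (p : ZMod N) ∣ n := hn ▸ (dvd_pow_self _ (by omega)).mul_right _
  have hr : ∀ x, IsUnit (n * x + T₁) := fun x => by
    rw [add_comm]
    exact isUnit_add_of_prime_dvd hp hN hT₁ (hpn.mul_right _)
  have hT₁' := ZMod.mul_inv_of_unit _ hT₁
  have hi₁ : IsUnit T₁⁻¹ := IsUnit.of_mul_eq_one T₁ (ZMod.inv_mul_of_unit T₁ hT₁)
  have hsum : pairSum ψ 1 1 T₁ T₂ n =
      ∑ u : ZMod N with IsUnit u, ψ (u - T₂ * u * (n * u + T₁)⁻¹) := by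
    rw [pairSum_eq_sum_filter hT₂]
    refine Finset.sum_congr (Finset.filter_congr fun u _ => ?_) fun u _ => ?_
    · rw [one_mul]
      exact and_iff_left (hr u)
    · rw [one_mul, one_mul]
  have hpk : ∀ j, k ≤ j → (p : ZMod N) ^ j = 0 := fun j hj => primePow_cast_eq_zero hN hj
  rw [hsum]
  by_cases hcase : δ < ν ∧ δ + 2 ≤ k
  · -- translation by `p ^ (k - δ - 1)` changes the phase by a constant
    obtain ⟨hδν, hδk⟩ := hcase
    obtain ⟨z, hz⟩ := exists_map_primePow_mul_ne_one hp hN hψ (show k - 1 < k by omega)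
      ((hD' hδν).mul hi₁)
    set h := (p : ZMod N) ^ (k - δ - 1) * z with hh
    have hhp : h = p * (p ^ (k - δ - 2) * z) := by
      rw [hh, ← mul_assoc, ← pow_succ']
      congr 2
      omega
    have hnh : n * h = 0 := by
      rw [hn, hh]
      have := hpk (ν + (k - δ - 1)) (by omega)
      rw [pow_add] at this
      linear_combination n' * z * this
    have hph : (p : ZMod N) ^ δ * h = p ^ (k - 1) * z := by
      rw [hh, ← mul_assoc, ← pow_add]
      congr 2
      omega
    have h0 : ∑ u : ZMod N with IsUnit u, ψ (u - T₂ * u * (n * u + T₁)⁻¹) = 0 := by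
      refine sum_eq_zero_of_shift _ h (fun x hx => ?_) _ hz fun x hx => ?_
      · rw [hhp]
        exact add_prime_mul_mem_units hp hN x hx _
      · rw [← AddChar.map_add_eq_mul]
        congr 1
        rw [show n * (x + h) + T₁ = n * x + T₁ by linear_combination hnh]
        have h1 := ZMod.mul_inv_of_unit _ (hr x)
        set i := (n * x + T₁)⁻¹
        have h2 : h * i = h * T₁⁻¹ := by
          linear_combination h * T₁⁻¹ * h1 - h * i * hT₁' - x * i * T₁⁻¹ * hnh
        linear_combination -T₂ * h2 - h * hT₁' + T₁⁻¹ * h * hD + D * T₁⁻¹ * hph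
    rw [h0, norm_zero, zero_pow two_ne_zero, zero_mul]
    positivity
  rcases hν.lt_or_eq with hνk | rfl
  · have hδν : δ = ν := by omega
    subst hδν
    have hmul : ∀ {S : ℝ}, S ≤ 32 * (p : ℝ) ^ (k + δ) → S * p ^ δ ≤ 32 * (p : ℝ) ^ k * p ^ (2 * δ) := by
      intro S hS
      calc S * (p : ℝ) ^ δ ≤ 32 * (p : ℝ) ^ (k + δ) * p ^ δ := by gcongr
        _ = _ := by ring
    refine hmul ?_
    rcases (Nat.succ_le_of_lt hνk).lt_or_eq with h | h
    · exact sq_norm_sum_sub_div_le hp hN hψ (by omega) h _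
        (fun x hx => (Finset.mem_filter.mp hx).2) (add_prime_mul_mem_units hp hN)
        hT₁ hT₂ (hn' hνk) hn hD
    · have h2 := sq_norm_sum_units_quadratic_le hp hN hψ h ((hn' hνk).mul hi₁) (D * T₁⁻¹)
      have h3 : ∑ u : ZMod N with IsUnit u, ψ (u - T₂ * u * (n * u + T₁)⁻¹) =
          ∑ u : ZMod N with IsUnit u, ψ (p ^ δ * (D * T₁⁻¹ * u + n' * T₁⁻¹ * u ^ 2)) := by
        refine Finset.sum_congr rfl fun u _ => ?_
        congr 1
        have h1 := ZMod.mul_inv_of_unit _ (hr u)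
        set i := (n * u + T₁)⁻¹
        have h4 := hpk (δ + δ) (by omega)
        rw [pow_add] at h4
        have h5 : (p : ZMod N) ^ δ * i = p ^ δ * T₁⁻¹ := by
          linear_combination (p : ZMod N) ^ δ * (T₁⁻¹ * h1 - i * hT₁') -
            p ^ δ * u * i * T₁⁻¹ * hn - u * i * T₁⁻¹ * n' * h4
        linear_combination -u * h1 + u ^ 2 * i * hn + u * i * hD + (u ^ 2 * n' + u * D) * h5
      rw [h3]
      exact h2
  · have hn0 : n = 0 := by rw [hn, hpk _ le_rfl, zero_mul]
    rcases hδ.lt_or_eq with h | rfl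
    · have h2 := norm_sum_units_linear hp hN hψ (show δ + 1 = ν by omega) ((hD' h).mul hi₁)
      have h3 : ∑ u : ZMod N with IsUnit u, ψ (u - T₂ * u * (n * u + T₁)⁻¹) =
          ∑ u : ZMod N with IsUnit u, ψ (p ^ δ * (D * T₁⁻¹ * u)) := by
        refine Finset.sum_congr rfl fun u _ => ?_
        congr 1
        rw [hn0, zero_mul, zero_add]
        linear_combination -u * hT₁' + u * T₁⁻¹ * hD
      rw [h3, h2]
      have : (0 : ℝ) ≤ (p : ℝ) ^ ν * p ^ (2 * δ) := by positivity
      rw [← pow_mul, mul_comm δ 2]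
      linarith
    · have h1 : ‖∑ u : ZMod N with IsUnit u, ψ (u - T₂ * u * (n * u + T₁)⁻¹)‖ ≤ p ^ δ := by
        refine (norm_sum_le _ _).trans ?_
        simp only [AddChar.norm_apply, Finset.sum_const, nsmul_eq_mul, mul_one]
        have := Finset.card_le_univ (Finset.univ.filter fun u : ZMod N => IsUnit u)
        rw [ZMod.card] at this
        exact_mod_cast this.trans hN.le
      have h2 := pow_le_pow_left₀ (norm_nonneg _) h1 2
      rw [← pow_mul, mul_comm δ 2] at h2
      have h3 : (0 : ℝ) ≤ (p : ℝ) ^ δ * p ^ (2 * δ) := by positivity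
      have h4 := mul_le_mul_of_nonneg_right h2 (show (0 : ℝ) ≤ (p : ℝ) ^ δ by positivity)
      linarith

/-- The bound for pair sums modulo a prime power. -/
lemma sq_norm_pairSum_le_of_primePow (hp : p.Prime) (hN : N = p ^ k) (hψ : ψ.IsPrimitive)
    {γ α ν δ : ℕ} (hα : 1 ≤ α) (hγα : γ + α = k) (hν : ν ≤ α) (hδ : δ ≤ ν) {T₁ T₂ n n' D : ZMod N}
    (hn : n = p ^ ν * n') (hn' : ν < α → IsUnit n')
    (hD : p ^ (2 * γ) * T₁ - T₂ = p ^ δ * D) (hD' : δ < ν → IsUnit D) :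
    ‖pairSum ψ 1 (p ^ γ) T₁ T₂ n‖ ^ 2 * p ^ ν ≤
      32 * ((p : ℝ) ^ γ) ^ 2 * p ^ α * p ^ (2 * δ) := by
  have hp1 : (1 : ℝ) ≤ p := by exact_mod_cast hp.one_le
  have htriv : ‖pairSum ψ 1 (p ^ γ) T₁ T₂ n‖ ≤ 1 → ‖pairSum ψ 1 (p ^ γ) T₁ T₂ n‖ ^ 2 * p ^ ν ≤
      32 * ((p : ℝ) ^ γ) ^ 2 * p ^ α * p ^ (2 * δ) := by
    intro h
    calc ‖pairSum ψ 1 (p ^ γ) T₁ T₂ n‖ ^ 2 * (p : ℝ) ^ ν ≤ 1 ^ 2 * (p : ℝ) ^ α := by gcongr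
      _ = 1 * 1 ^ 2 * (p : ℝ) ^ α * 1 := by ring
      _ ≤ _ := by
        gcongr
        · norm_num
        · exact one_le_pow₀ hp1
        · exact one_le_pow₀ hp1
  by_cases hT₂ : IsUnit T₂
  swap
  · refine htriv (norm_pairSum_le_one_of_not_isUnit hp hN hψ (by omega) (fun h => ?_) hT₂)
    rw [show γ = 0 by omega, pow_zero]
  rcases Nat.eq_zero_or_pos ν with rfl | hν0
  · have hn1 : IsUnit n := by
      rw [hn, pow_zero, one_mul]
      exact hn' (by omega)
    have h1 := sq_norm_pairSum_le_of_isUnit hp hN hψ (T₁ := T₁) (show γ < k by omega) hT₂ hn1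
    have h2 : (p : ℝ) ^ (k + γ) = (p ^ γ) ^ 2 * p ^ α := by
      rw [← hγα]
      ring
    obtain rfl : δ = 0 := by omega
    rw [h2] at h1
    simp only [mul_zero, pow_zero, mul_one]
    linarith
  have hpn : (p : ZMod N) ∣ n := hn ▸ (dvd_pow_self _ (by omega)).mul_right _
  rcases Nat.eq_zero_or_pos γ with rfl | hγ
  · have hαk : α = k := by omega
    subst hαk
    by_cases hT₁ : IsUnit T₁
    · simp only [mul_zero, pow_zero, one_mul, one_pow, mul_one] at hD ⊢
      exact sq_norm_pairSum_le_of_prime_dvd hp hN hψ hν0 hν hδ hT₁ hT₂ hn hn' hD hD'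
    · refine htriv ?_
      rw [pow_zero, pairSum_swap]
      exact norm_pairSum_le_one_of_not_isUnit hp hN hψ (by omega) (fun _ => rfl) hT₁
  · rw [pairSum_eq_zero_of_prime_dvd hp hN (by omega) hT₂ hpn (dvd_pow_self _ (by omega)),
      norm_zero, zero_pow two_ne_zero, zero_mul]
    positivity

end LocalBound

section Multiplicativity

/-- The number of units fixing `w`. -/
def stabCard {R : Type*} [CommRing R] [Fintype R] [DecidableEq R] (w : R) : ℕ :=
  Fintype.card {u : Rˣ // w * u = w}

variable {R S T : Type*} [CommRing R] [CommRing S] [CommRing T]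

/-- Units of a ring that is a product. -/
def unitsEquivOfProd (f : R ≃+* S × T) : Rˣ ≃* Sˣ × Tˣ :=
  (Units.mapEquiv f.toMulEquiv).trans MulEquiv.prodUnits

lemma coe_unitsEquivOfProd (f : R ≃+* S × T) (u : Rˣ) :
    f u = (((unitsEquivOfProd f u).1 : S), ((unitsEquivOfProd f u).2 : T)) := rfl

/-- The restriction of an additive character to the first factor of a product. -/
def AddChar.prodFst (f : R ≃+* S × T) (ψ : AddChar R ℂ) : AddChar S ℂ :=
  ψ.compAddMonoidHom (f.symm.toAddMonoidHom.comp (AddMonoidHom.inl S T))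

/-- The restriction of an additive character to the second factor of a product. -/
def AddChar.prodSnd (f : R ≃+* S × T) (ψ : AddChar R ℂ) : AddChar T ℂ :=
  ψ.compAddMonoidHom (f.symm.toAddMonoidHom.comp (AddMonoidHom.inr S T))

lemma AddChar.apply_eq_prodFst_mul_prodSnd (f : R ≃+* S × T) (ψ : AddChar R ℂ) (x : R) :
    ψ x = ψ.prodFst f (f x).1 * ψ.prodSnd f (f x).2 := by
  have h1 : ψ.prodFst f (f x).1 = ψ (f.symm ((f x).1, 0)) := rfl
  have h2 : ψ.prodSnd f (f x).2 = ψ (f.symm (0, (f x).2)) := rfl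
  rw [h1, h2, ← AddChar.map_add_eq_mul, ← map_add, Prod.mk_add_mk, add_zero, zero_add,
    Prod.mk.eta, f.symm_apply_apply]

lemma AddChar.IsPrimitive.prodFst (f : R ≃+* S × T) {ψ : AddChar R ℂ} (hψ : ψ.IsPrimitive) :
    (ψ.prodFst f).IsPrimitive := by
  intro a ha
  have h1 : f.symm (a, 0) ≠ 0 := by simpa using ha
  obtain ⟨y, hy⟩ := AddChar.ne_one_iff.mp (hψ h1)
  refine AddChar.ne_one_iff.mpr ⟨(f y).1, fun h => hy ?_⟩
  rw [AddChar.mulShift_apply] at h ⊢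
  rw [← h, AddChar.apply_eq_prodFst_mul_prodSnd f, map_mul, f.apply_symm_apply, Prod.fst_mul,
    Prod.snd_mul, zero_mul, AddChar.map_zero_eq_one, mul_one]

lemma AddChar.IsPrimitive.prodSnd (f : R ≃+* S × T) {ψ : AddChar R ℂ} (hψ : ψ.IsPrimitive) :
    (ψ.prodSnd f).IsPrimitive := by
  intro a ha
  have h1 : f.symm (0, a) ≠ 0 := by simpa using ha
  obtain ⟨y, hy⟩ := AddChar.ne_one_iff.mp (hψ h1)
  refine AddChar.ne_one_iff.mpr ⟨(f y).2, fun h => hy ?_⟩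
  rw [AddChar.mulShift_apply] at h ⊢
  rw [← h, AddChar.apply_eq_prodFst_mul_prodSnd f, map_mul, f.apply_symm_apply, Prod.fst_mul,
    Prod.snd_mul, zero_mul, AddChar.map_zero_eq_one, one_mul]

variable [Fintype R] [DecidableEq R] [Fintype S] [DecidableEq S] [Fintype T] [DecidableEq T]

lemma one_le_stabCard (w : R) : 1 ≤ stabCard w :=
  Fintype.card_pos_iff.mpr ⟨⟨1, by rw [Units.val_one, mul_one]⟩⟩

lemma stabCard_zero : stabCard (0 : R) = Fintype.card Rˣ :=
  Fintype.card_congr (Equiv.subtypeUnivEquiv fun _ => zero_mul _)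

lemma stabCard_of_prod (f : R ≃+* S × T) (w : R) :
    stabCard w = stabCard (f w).1 * stabCard (f w).2 := by
  unfold stabCard
  rw [← Fintype.card_prod]
  refine Fintype.card_congr ?_
  refine ((unitsEquivOfProd f).toEquiv.subtypeEquiv
    (q := fun u : Sˣ × Tˣ => (f w).1 * u.1 = (f w).1 ∧ (f w).2 * u.2 = (f w).2) fun u => ?_).trans
    (Equiv.subtypeProdEquivProd (p := fun u : Sˣ => (f w).1 * u = (f w).1)
      (q := fun u : Tˣ => (f w).2 * u = (f w).2))
  rw [← f.injective.eq_iff, map_mul, coe_unitsEquivOfProd, Prod.ext_iff]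
  rfl

lemma pairSum_of_prod (f : R ≃+* S × T) (ψ : AddChar R ℂ) (w₁ w₂ t₁ t₂ n : R) :
    pairSum ψ w₁ w₂ t₁ t₂ n =
      pairSum (ψ.prodFst f) (f w₁).1 (f w₂).1 (f t₁).1 (f t₂).1 (f n).1 *
        pairSum (ψ.prodSnd f) (f w₁).2 (f w₂).2 (f t₁).2 (f t₂).2 (f n).2 := by
  unfold pairSum
  rw [Fintype.sum_mul_sum]
  refine (Fintype.sum_equiv (unitsEquivOfProd f).toEquiv _ _ fun u => ?_).trans
    (Fintype.sum_prod_type' _)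
  rw [Fintype.sum_mul_sum]
  refine (Fintype.sum_equiv (unitsEquivOfProd f).toEquiv _ _ fun v => ?_).trans
    (Fintype.sum_prod_type' _)
  rw [ite_zero_mul_ite_zero, AddChar.apply_eq_prodFst_mul_prodSnd f]
  simp only [← f.map_eq_zero_iff, map_add, map_mul,  coe_unitsEquivOfProd, Prod.ext_iff]
  rfl

end Multiplicativity

section PrimePower

lemma pairSum_units_mul {R : Type*} [CommRing R] [Fintype R] [DecidableEq R] (ψ : AddChar R ℂ)
    (a b : Rˣ) (w t₁ t₂ n : R) :
    pairSum ψ a (w * b) t₁ t₂ n = pairSum ψ 1 w (b ^ 2 * t₁) (a ^ 2 * t₂) n := by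
  refine Fintype.sum_equiv (Equiv.mulLeft b) _ _ fun u => ?_
  refine Fintype.sum_equiv (Equiv.mulLeft a) _ _ fun v => ?_
  have ha := a.mul_inv
  have hb := b.mul_inv
  simp only [Equiv.coe_mulLeft, mul_inv, Units.val_mul, one_mul]
  rw [show w * (b ^ 2 * t₁) * ((↑b⁻¹ : R) * ↑u⁻¹) + a ^ 2 * t₂ * (↑a⁻¹ * ↑v⁻¹) + n =
      w * b * t₁ * ↑u⁻¹ + a * t₂ * ↑v⁻¹ + n by
    linear_combination w * b * t₁ * ↑u⁻¹ * hb + a * t₂ * ↑v⁻¹ * ha,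
    mul_assoc w (b : R) u]

lemma exists_gcd_primePow {p : ℕ} (hp : p.Prime) (x : ℤ) (a : ℕ) :
    ∃ i ≤ a, x.natAbs.gcd (p ^ a) = p ^ i ∧
      ∃ y : ℤ, x = p ^ i * y ∧ (i < a → ¬ (p : ℤ) ∣ y) := by
  obtain ⟨i, hi, h⟩ := (Nat.dvd_prime_pow hp).mp (x.natAbs.gcd_dvd_right (p ^ a))
  obtain ⟨y, hy⟩ : ((p ^ i : ℕ) : ℤ) ∣ x := by
    rw [← h, Int.natCast_dvd]
    exact Nat.gcd_dvd_left _ _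
  rw [Nat.cast_pow] at hy
  refine ⟨i, hi, h, y, hy, fun hia => ?_⟩
  rintro ⟨z, rfl⟩
  have h1 : p ^ (i + 1) ∣ x.natAbs.gcd (p ^ a) := by
    refine Nat.dvd_gcd ?_ (pow_dvd_pow _ hia)
    rw [← Int.natCast_dvd, hy, ← mul_assoc, ← pow_succ, Nat.cast_pow]
    exact dvd_mul_right _ _
  rw [h] at h1
  exact absurd ((Nat.pow_dvd_pow_iff_le_right hp.one_lt).mp h1) (by omega)

variable {N p k : ℕ} [NeZero N] {ψ : AddChar (ZMod N) ℂ}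

omit [NeZero N] in
lemma isUnit_intCast_of_not_dvd (hp : p.Prime) (hN : N = p ^ k) {y : ℤ} (hy : ¬ (p : ℤ) ∣ y) :
    IsUnit (y : ZMod N) := by
  rw [ZMod.coe_int_isUnit_iff_isCoprime, hN, Nat.cast_pow]
  exact ((Nat.prime_iff_prime_int.mp hp).coprime_iff_not_dvd.mpr hy).pow_left

lemma primePow_le_stabCard (hp : p.Prime) (hN : N = p ^ k) {γ : ℕ} (hγ : γ < k) (c : ZMod N) :
    p ^ γ ≤ stabCard (p ^ γ * c) := by
  have hu : ∀ j : Fin (p ^ γ), IsUnit ((1 : ZMod N) + p ^ (k - γ) * (j : ℕ)) := fun j =>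
    isUnit_add_of_prime_dvd hp hN isUnit_one ((dvd_pow_self _ (by omega)).mul_right _)
  have hpk := primePow_cast_eq_zero (p := p) hN (show k ≤ γ + (k - γ) by omega)
  rw [pow_add] at hpk
  calc p ^ γ = Fintype.card (Fin (p ^ γ)) := (Fintype.card_fin _).symm
    _ ≤ _ := by
      refine Fintype.card_le_of_injective (fun j => ⟨(hu j).unit, ?_⟩) fun i j hij => ?_
      · rw [IsUnit.unit_spec]
        linear_combination c * (j : ℕ) * hpk
      · have h1 : (1 : ZMod N) + p ^ (k - γ) * (i : ℕ) = 1 + p ^ (k - γ) * (j : ℕ) := by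
          simpa using congrArg (fun u => ((u.1 : (ZMod N)ˣ) : ZMod N)) hij
        have hlt : ∀ j : Fin (p ^ γ), p ^ (k - γ) * (j : ℕ) < N := fun j => by
          rw [hN, ← Nat.sub_add_cancel hγ.le, pow_add, Nat.add_sub_cancel]
          exact Nat.mul_lt_mul_of_pos_left j.2 (pow_pos hp.pos _)
        have h2 : ((p ^ (k - γ) * (i : ℕ) : ℕ) : ZMod N) = ((p ^ (k - γ) * (j : ℕ) : ℕ) : ZMod N) := by
          push_cast
          exact add_left_cancel h1
        rw [ZMod.natCast_eq_natCast_iff, Nat.ModEq, Nat.mod_eq_of_lt (hlt i),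
          Nat.mod_eq_of_lt (hlt j)] at h2
        exact Fin.ext (Nat.eq_of_mul_eq_mul_left (pow_pos hp.pos _) h2)

lemma sq_norm_pairSum_le_of_not_dvd (hp : p.Prime) (hN : N = p ^ k) (hk : 1 ≤ k)
    (hψ : ψ.IsPrimitive) {w₁ w₂ g : ℕ} (hw₁ : ¬ p ∣ w₁) (hw₂ : w₂ ≠ 0) (hg : g ≠ 0)
    (h : w₂.factorization p + g.factorization p = k) (t₁ t₂ n : ℤ) :
    ‖pairSum ψ w₁ w₂ t₁ t₂ n‖ ^ 2 * (n.natAbs.gcd (g.gcd N) : ℕ) ≤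
      32 * (stabCard (w₁ : ZMod N) : ℝ) ^ 2 * (stabCard (w₂ : ZMod N) : ℝ) ^ 2 * (g.gcd N : ℕ) *
        ((w₂ ^ 2 * t₁ - w₁ ^ 2 * t₂).natAbs.gcd (n.natAbs.gcd (g.gcd N)) : ℕ) ^ 2 := by
  obtain ⟨γ, ε, hε, rfl⟩ := Nat.exists_eq_pow_mul_and_not_dvd hw₂ p hp.ne_one
  obtain ⟨α, g', hg', rfl⟩ := Nat.exists_eq_pow_mul_and_not_dvd hg p hp.ne_one
  have hfac : ∀ (i x : ℕ), ¬ p ∣ x → (p ^ i * x).factorization p = i := fun i x hx => by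
    have hx0 : x ≠ 0 := by
      rintro rfl
      exact hx (dvd_zero p)
    rw [Nat.factorization_mul (pow_ne_zero _ hp.ne_zero) hx0]
    simp [hp.factorization_self, Nat.factorization_eq_zero_of_not_dvd hx]
  rw [hfac _ _ hε, hfac _ _ hg'] at h
  have hgN : (p ^ α * g').gcd N = p ^ α := by
    rw [hN, ← h, add_comm, pow_add, Nat.gcd_mul_left,
      ((Nat.Prime.coprime_iff_not_dvd hp).mpr hg').symm.pow_right γ, mul_one]
  rw [hgN]
  have hu₁ : IsUnit (w₁ : ZMod N) := by
    have := isUnit_intCast_of_not_dvd hp hN (y := w₁) (by exact_mod_cast hw₁)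
    simpa using this
  have hu₂ : IsUnit (ε : ZMod N) := by
    have := isUnit_intCast_of_not_dvd hp hN (y := ε) (by exact_mod_cast hε)
    simpa using this
  have hJ : pairSum ψ (w₁ : ZMod N) ((p ^ γ * ε : ℕ) : ZMod N) t₁ t₂ n =
      pairSum ψ 1 (p ^ γ) (ε ^ 2 * t₁) (w₁ ^ 2 * t₂) n := by
    have := pairSum_units_mul ψ hu₁.unit hu₂.unit (p ^ γ : ZMod N) t₁ t₂ n
    rw [IsUnit.unit_spec, IsUnit.unit_spec] at this
    rw [← this]
    push_cast
    rfl
  rw [hJ]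
  have hm₁ : (1 : ℝ) ≤ stabCard (w₁ : ZMod N) := by exact_mod_cast one_le_stabCard _
  rcases Nat.eq_zero_or_pos α with rfl | hα
  · have hγ : γ = k := by omega
    subst hγ
    have h0 : (p : ZMod N) ^ γ = 0 := primePow_cast_eq_zero hN le_rfl
    have h1 := norm_pairSum_zero_le hp hN hψ hk (ε ^ 2 * t₁) (w₁ ^ 2 * t₂) (n : ZMod N)
    rw [Nat.cast_mul, Nat.cast_pow, h0, zero_mul, stabCard_zero, pow_zero]
    simp only [Nat.gcd_one_right, Nat.cast_one, mul_one, one_pow]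
    calc ‖pairSum ψ 1 0 (ε ^ 2 * t₁) (w₁ ^ 2 * t₂) (n : ZMod N)‖ ^ 2
        ≤ 1 * 1 ^ 2 * (Fintype.card (ZMod N)ˣ : ℝ) ^ 2 := by
          rw [one_pow, one_mul, one_mul]
          gcongr
      _ ≤ _ := by
        gcongr
        norm_num
  · obtain ⟨ν, hν, hν1, n', hn, hn'⟩ := exists_gcd_primePow hp n α
    rw [hν1]
    obtain ⟨δ, hδ, hδ1, D, hD, hD'⟩ :=
      exists_gcd_primePow hp (((p ^ γ * ε : ℕ) : ℤ) ^ 2 * t₁ - w₁ ^ 2 * t₂) ν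
    rw [hδ1]
    have hm₂ : (p : ℝ) ^ γ ≤ stabCard ((p ^ γ * ε : ℕ) : ZMod N) := by
      rw [Nat.cast_mul, Nat.cast_pow]
      exact_mod_cast primePow_le_stabCard hp hN (show γ < k by omega) (ε : ZMod N)
    have h1 := sq_norm_pairSum_le_of_primePow hp hN hψ hα h hν hδ
      (T₁ := ε ^ 2 * t₁) (T₂ := w₁ ^ 2 * t₂) (n := n) (n' := n') (D := D)
      (by rw [hn]; push_cast; rfl) (fun h => isUnit_intCast_of_not_dvd hp hN (hn' h))
      (by
        have := congrArg (Int.cast : ℤ → ZMod N) hD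
        push_cast at this
        rw [← this]
        ring)
      (fun h => isUnit_intCast_of_not_dvd hp hN (hD' h))
    push_cast
    push_cast at hm₂
    calc _ ≤ 32 * ((p : ℝ) ^ γ) ^ 2 * p ^ α * p ^ (2 * δ) := h1
      _ = 32 * 1 ^ 2 * ((p : ℝ) ^ γ) ^ 2 * p ^ α * (p ^ δ) ^ 2 := by ring
      _ ≤ _ := by gcongr

end PrimePower

section Composite

/-- The bound for pair sums modulo an arbitrary modulus. -/
lemma sq_norm_pairSum_le {w₁ w₂ g : ℕ} (hw₁ : w₁ ≠ 0) (hw₂ : w₂ ≠ 0) (hg : g ≠ 0) (t₁ t₂ n : ℤ)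
    (L : ℕ) : ∀ [NeZero L] {ψ : AddChar (ZMod L) ℂ}, ψ.IsPrimitive →
    (∀ p, p.Prime → p ∣ L → w₁.factorization p + w₂.factorization p + g.factorization p =
      L.factorization p ∧ (¬ p ∣ w₁ ∨ ¬ p ∣ w₂)) →
    ‖pairSum ψ w₁ w₂ t₁ t₂ n‖ ^ 2 * (n.natAbs.gcd (g.gcd L) : ℕ) ≤
      32 ^ L.primeFactors.card * (stabCard (w₁ : ZMod L) : ℝ) ^ 2 *
        (stabCard (w₂ : ZMod L) : ℝ) ^ 2 * (g.gcd L : ℕ) *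
        ((w₂ ^ 2 * t₁ - w₁ ^ 2 * t₂).natAbs.gcd (n.natAbs.gcd (g.gcd L)) : ℕ) ^ 2 := by
  induction L using Nat.recOnPosPrimePosCoprime with
  | prime_pow p k hp hk =>
    intro _ ψ hψ hL
    obtain ⟨h1, h2⟩ := hL p hp (dvd_pow_self _ hk.ne')
    rw [hp.factorization_pow, Finsupp.single_eq_same] at h1
    rw [Nat.primeFactors_prime_pow hk.ne' hp, Finset.card_singleton, pow_one]
    rcases h2 with h2 | h2
    · rw [Nat.factorization_eq_zero_of_not_dvd h2, zero_add] at h1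
      exact sq_norm_pairSum_le_of_not_dvd hp rfl hk hψ h2 hw₂ hg h1 t₁ t₂ n
    · rw [Nat.factorization_eq_zero_of_not_dvd h2, add_zero] at h1
      have := sq_norm_pairSum_le_of_not_dvd hp rfl hk hψ h2 hw₁ hg h1 t₂ t₁ n
      rw [pairSum_swap, ← neg_sub, Int.natAbs_neg] at this
      refine this.trans_eq ?_
      ring
  | zero =>
    intro h
    exact absurd rfl h.out
  | one =>
    intro _ ψ _ _
    have h1 : ‖pairSum ψ w₁ w₂ t₁ t₂ n‖ ≤ 1 := by
      have hc : Fintype.card (ZMod 1)ˣ = 1 := Fintype.card_unique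
      refine (norm_sum_le_of_le _ (n := fun _ => 1) fun u _ => ?_).trans (by simp)
      refine (norm_sum_le_of_le _ (n := fun _ => 1) fun v _ => ?_).trans (by simp)
      split_ifs
      · rw [AddChar.norm_apply]
      · simp
    have h2 : (1 : ℝ) ≤ stabCard (w₁ : ZMod 1) := by exact_mod_cast one_le_stabCard _
    have h3 : (1 : ℝ) ≤ stabCard (w₂ : ZMod 1) := by exact_mod_cast one_le_stabCard _
    simp only [Nat.gcd_one_right, Nat.cast_one, mul_one, Nat.primeFactors_one, Finset.card_empty,
      pow_zero, one_mul, one_pow]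
    calc ‖pairSum ψ w₁ w₂ t₁ t₂ n‖ ^ 2 ≤ 1 ^ 2 * 1 ^ 2 := by
          rw [one_pow (M := ℝ), mul_one]
          exact pow_le_one₀ (norm_nonneg _) h1
      _ ≤ _ := by gcongr
  | coprime a b ha hb hab iha ihb =>
    intro _ ψ hψ hL
    have : NeZero a := ⟨by omega⟩
    have : NeZero b := ⟨by omega⟩
    let f := ZMod.chineseRemainder hab
    have ha' := iha (hψ.prodFst f) fun p hp hpa => by
      have h := hL p hp (hpa.mul_right b)
      rwa [Nat.factorization_eq_of_coprime_left hab
        (Nat.mem_primeFactorsList (NeZero.ne a) |>.mpr ⟨hp, hpa⟩)] at h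
    have hb' := ihb (hψ.prodSnd f) fun p hp hpb => by
      have h := hL p hp (hpb.mul_left a)
      rwa [Nat.factorization_eq_of_coprime_right hab
        (Nat.mem_primeFactorsList (NeZero.ne b) |>.mpr ⟨hp, hpb⟩)] at h
    have hg₁ : (g.gcd (a * b)) = g.gcd a * g.gcd b := hab.gcd_mul g
    have hc₁ : (g.gcd a).Coprime (g.gcd b) :=
      (hab.coprime_dvd_left (Nat.gcd_dvd_right _ _)).coprime_dvd_right (Nat.gcd_dvd_right _ _)
    have hc₂ : (n.natAbs.gcd (g.gcd a)).Coprime (n.natAbs.gcd (g.gcd b)) :=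
      (hc₁.coprime_dvd_left (Nat.gcd_dvd_right _ _)).coprime_dvd_right (Nat.gcd_dvd_right _ _)
    rw [hg₁, hc₁.gcd_mul, hc₂.gcd_mul, hab.primeFactors_mul,
      Finset.card_union_of_disjoint hab.disjoint_primeFactors, pairSum_of_prod f,
      stabCard_of_prod f, stabCard_of_prod f, norm_mul]
    simp only [map_natCast, map_intCast, Prod.fst_natCast, Prod.snd_natCast, Prod.fst_intCast,
      Prod.snd_intCast]
    push_cast
    have h := mul_le_mul ha' hb' (by positivity) (by positivity)
    rw [mul_pow, pow_add]
    refine le_trans (le_of_eq ?_) (h.trans_eq ?_) <;> ring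

end Composite

section KloostermanCorrelation

lemma sum_range_natCast {c : ℕ} [NeZero c] (F : ZMod c → ℂ) :
    ∑ x ∈ Finset.range c, F (x : ZMod c) = ∑ y, F y :=
  Finset.sum_bij' (fun x _ => (x : ZMod c)) (fun y _ => y.val) (fun _ _ => Finset.mem_univ _)
    (fun y _ => Finset.mem_range.mpr y.val_lt)
    (fun _ hx => ZMod.val_cast_of_lt (Finset.mem_range.mp hx))
    (fun y _ => ZMod.natCast_zmod_val y) fun _ _ => rfl

lemma e_div_natCast {c : ℕ} [NeZero c] (j : ℤ) :
    e ((j : ℝ) / (c : ℝ)) = ZMod.stdAddChar (j : ZMod c) := by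
  rw [ZMod.stdAddChar_coe, e]
  congr 1
  push_cast
  ring

lemma klo_eq_sum_units {c : ℕ} [NeZero c] (a : ℤ) :
    klo a 1 c = ∑ u : (ZMod c)ˣ, ZMod.stdAddChar (a * ↑u⁻¹ + u : ZMod c) := by
  let F : ZMod c → ℂ := fun y => if IsUnit y then
    ZMod.stdAddChar (a * y + y⁻¹ : ZMod c) else 0
  have h1 : klo a 1 c = ∑ x ∈ Finset.range c, F x := by
    refine Finset.sum_congr rfl fun x _ => ?_
    simp only [F, ZMod.isUnit_iff_coprime, Nat.Coprime, e_div_natCast]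
    push_cast
    rw [ZMod.natCast_zmod_val, one_mul]
  rw [h1, sum_range_natCast F, ← Finset.sum_filter, ← sum_units_eq_sum_filter
    (fun y : ZMod c => ZMod.stdAddChar (a * y + y⁻¹ : ZMod c))]
  refine Fintype.sum_equiv (Equiv.inv _) _ _ fun u => ?_
  rw [Equiv.inv_apply, inv_inv, ZMod.inv_coe_unit]

/-- Lifting the summation variable of a Kloosterman sum to a larger modulus. -/
lemma stabCard_mul_klo {L s w : ℕ} [NeZero L] (hL : L = s * w) (a : ℤ) :
    (stabCard (w : ZMod L) : ℂ) * klo a 1 s =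
      ∑ u : (ZMod L)ˣ, ZMod.stdAddChar (w * (a * ↑u⁻¹ + u) : ZMod L) := by
  have : NeZero s := ⟨fun h => NeZero.ne L (by rw [hL, h, zero_mul])⟩
  have hw : (w : ℂ) ≠ 0 := fun h => NeZero.ne L (by rw [hL, Nat.cast_eq_zero.mp h, mul_zero])
  have hs : (s : ℂ) ≠ 0 := NeZero.ne _
  have hsL : s ∣ L := ⟨w, hL⟩
  have hψ : ∀ x : ZMod L, (ZMod.stdAddChar ((w : ZMod L) * x) : ℂ) =
      ZMod.stdAddChar (ZMod.castHom hsL (ZMod s) x) := by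
    intro x
    obtain ⟨j, rfl⟩ := ZMod.intCast_surjective x
    rw [map_intCast, ZMod.stdAddChar_coe, ← Int.cast_natCast, ← Int.cast_mul, ZMod.stdAddChar_coe]
    congr 1
    rw [hL]
    push_cast
    field_simp
  have hcard : stabCard (w : ZMod L) =
      (Finset.univ.filter fun u => ZMod.unitsMap hsL u = 1).card := by
    rw [stabCard, Fintype.card_subtype]
    congr 1
    refine Finset.filter_congr fun u _ => ?_
    obtain ⟨j, hj⟩ := ZMod.intCast_surjective (u : ZMod L)
    rw [← Units.val_inj, Units.val_one, ZMod.unitsMap_def, Units.coe_map, MonoidHom.coe_coe, ← hj,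
      map_intCast, ← Int.cast_natCast, ← Int.cast_mul, ← sub_eq_zero, ← Int.cast_sub,
      ZMod.intCast_zmod_eq_zero_iff_dvd, ← sub_eq_zero (a := (j : ZMod s)), ← Int.cast_one,
      ← Int.cast_sub, ZMod.intCast_zmod_eq_zero_iff_dvd, hL, Nat.cast_mul, mul_comm (s : ℤ),
      ← mul_sub_one]
    refine mul_dvd_mul_iff_left fun h => hw ?_
    exact_mod_cast h
  have hsum := MonoidHom.sum_comp_of_surjective (ZMod.unitsMap hsL) (ZMod.unitsMap_surjective hsL)
    fun u : (ZMod s)ˣ => ZMod.stdAddChar (a * ↑u⁻¹ + u : ZMod s)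
  rw [klo_eq_sum_units, hcard]
  convert hsum.symm using 2 with u
  · congr
  · rw [hψ, map_add, map_mul, map_intCast, ← map_inv]
    rfl

lemma stabCard_mul_correlation {L s₁ s₂ w₁ w₂ : ℕ} [NeZero L] (h₁ : L = s₁ * w₂) (h₂ : L = s₂ * w₁)
    (t₁ t₂ n : ℤ) :
    (stabCard (w₂ : ZMod L) : ℂ) * stabCard (w₁ : ZMod L) *
      ∑ x ∈ Finset.range L, klo (t₁ * x) 1 s₁ * klo (t₂ * x) 1 s₂ *
        e (((n * x : ℤ) : ℝ) / (L : ℝ)) =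
      L * pairSum (ZMod.stdAddChar : AddChar (ZMod L) ℂ) w₁ w₂ t₁ t₂ n := by
  set ψ : AddChar (ZMod L) ℂ := ZMod.stdAddChar
  let F : ZMod L → ℂ := fun y => ∑ u : (ZMod L)ˣ, ∑ v : (ZMod L)ˣ, ψ (w₂ * u + w₁ * v) *
    ψ (y * (w₂ * t₁ * ↑u⁻¹ + w₁ * t₂ * ↑v⁻¹ + n))
  have h3 : ∀ x : ℕ, (stabCard (w₂ : ZMod L) : ℂ) * stabCard (w₁ : ZMod L) *
      (klo (t₁ * x) 1 s₁ * klo (t₂ * x) 1 s₂ * e (((n * x : ℤ) : ℝ) / (L : ℝ))) =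
      F x := by
    intro x
    rw [e_div_natCast]
    calc _ = (stabCard (w₂ : ZMod L) : ℂ) * klo (t₁ * x) 1 s₁ *
          (stabCard (w₁ : ZMod L) * klo (t₂ * x) 1 s₂) * ψ ((n * x : ℤ) : ZMod L) := by ring
      _ = _ := by
        rw [stabCard_mul_klo h₁, stabCard_mul_klo h₂, Fintype.sum_mul_sum, Finset.sum_mul]
        refine Finset.sum_congr rfl fun u _ => ?_
        rw [Finset.sum_mul]
        refine Finset.sum_congr rfl fun v _ => ?_
        rw [← AddChar.map_add_eq_mul, ← AddChar.map_add_eq_mul, ← AddChar.map_add_eq_mul]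
        congr 1
        push_cast
        ring
  rw [Finset.mul_sum, Finset.sum_congr rfl fun x _ => h3 x, sum_range_natCast F, Finset.sum_comm,
    pairSum, Finset.mul_sum]
  refine Finset.sum_congr rfl fun u _ => ?_
  rw [Finset.sum_comm, Finset.mul_sum]
  refine Finset.sum_congr rfl fun v _ => ?_
  rw [← Finset.mul_sum, AddChar.sum_mulShift _ (ZMod.isPrimitive_stdAddChar L), ZMod.card]
  split_ifs
  · ring
  · simp

end KloostermanCorrelation

/-- **Lemma 2 of Holowinsky–Nelson.** There is an absolute constant `c₀ > 0`
such that for all positive integers `s₁, s₂` and integers `t₁, t₂, n`, writing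
`𝒞 = ∑_{x mod [s₁,s₂]} S(t₁x,1;s₁) S(t₂x,1;s₂) e(nx/[s₁,s₂])`, `s_i = w_i (s₁,s₂)` and
`Δ = w₂² t₁ − w₁² t₂`, one has
`|𝒞| ≤ 2^{c₀ ω([s₁,s₂])} (s₁ s₂ [s₁,s₂])^{1/2} (Δ,n,s₁,s₂)/(n,s₁,s₂)^{1/2}`. -/
theorem statement4 :
    ∃ c₀ : ℝ, 0 < c₀ ∧
      ∀ s₁ s₂ : ℕ, 0 < s₁ → 0 < s₂ → ∀ t₁ t₂ n : ℤ,
        ‖∑ x ∈ Finset.range (Nat.lcm s₁ s₂),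
            klo (t₁ * x) 1 s₁ * klo (t₂ * x) 1 s₂ *
              e (((n * x : ℤ) : ℝ) / (Nat.lcm s₁ s₂ : ℝ))‖
          ≤ (2 : ℝ) ^ (c₀ * ((Nat.lcm s₁ s₂).primeFactors.card : ℝ)) *
              ((s₁ * s₂ * Nat.lcm s₁ s₂ : ℕ) : ℝ) ^ ((1 : ℝ) / 2) *
              ((Int.gcd (Delta s₁ s₂ t₁ t₂) ((Int.gcd n ((Nat.gcd s₁ s₂ : ℕ) : ℤ) : ℕ) : ℤ) : ℕ) : ℝ) /
              (((Int.gcd n ((Nat.gcd s₁ s₂ : ℕ) : ℤ) : ℕ) : ℝ)) ^ ((1 : ℝ) / 2) := by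
  refine ⟨5 / 2, by norm_num, fun s₁ s₂ hs₁ hs₂ t₁ t₂ n => ?_⟩
  set L := Nat.lcm s₁ s₂ with hL
  set g := Nat.gcd s₁ s₂ with hg
  set w₁ := s₁ / g with hw₁
  set w₂ := s₂ / g with hw₂
  have hg0 : 0 < g := Nat.gcd_pos_of_pos_left _ hs₁
  have : NeZero L := ⟨Nat.lcm_ne_zero hs₁.ne' hs₂.ne'⟩
  have hs₁' : s₁ = w₁ * g := (Nat.div_mul_cancel (Nat.gcd_dvd_left _ _)).symm
  have hs₂' : s₂ = w₂ * g := (Nat.div_mul_cancel (Nat.gcd_dvd_right _ _)).symm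
  have hgL : g * L = s₁ * s₂ := Nat.gcd_mul_lcm s₁ s₂
  have hL₁ : L = s₁ * w₂ := Nat.eq_of_mul_eq_mul_left hg0 (by rw [hgL, hs₂']; ring)
  have hL₂ : L = s₂ * w₁ := Nat.eq_of_mul_eq_mul_left hg0 (by rw [hgL, hs₁']; ring)
  have hw₁0 : w₁ ≠ 0 := fun h => NeZero.ne L (by rw [hL₂, h, mul_zero])
  have hw₂0 : w₂ ≠ 0 := fun h => NeZero.ne L (by rw [hL₁, h, mul_zero])
  have hgcd : g.gcd L = g := Nat.gcd_eq_left ((Nat.gcd_dvd_left _ _).trans ⟨w₂, hL₁⟩)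
  have hbound := sq_norm_pairSum_le hw₁0 hw₂0 hg0.ne' t₁ t₂ n L (ZMod.isPrimitive_stdAddChar L)
    fun p hp _ => by
      constructor
      · rw [hL₁, hs₁', Nat.factorization_mul (mul_ne_zero hw₁0 hg0.ne') hw₂0,
          Nat.factorization_mul hw₁0 hg0.ne', Finsupp.add_apply, Finsupp.add_apply]
        ring
      · rw [← not_and_or]
        rintro ⟨h1, h2⟩
        exact hp.ne_one (Nat.dvd_one.mp
          ((Nat.coprime_div_gcd_div_gcd hg0).gcd_eq_one ▸ Nat.dvd_gcd h1 h2))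
  rw [hgcd] at hbound
  have hC := congrArg norm (stabCard_mul_correlation hL₁ hL₂ t₁ t₂ n)
  rw [norm_mul, norm_mul, norm_mul, norm_natCast, norm_natCast, norm_natCast] at hC
  set C := ‖∑ x ∈ Finset.range L, klo (t₁ * x) 1 s₁ * klo (t₂ * x) 1 s₂ *
    e (((n * x : ℤ) : ℝ) / (L : ℝ))‖
  set J := ‖pairSum (ZMod.stdAddChar : AddChar (ZMod L) ℂ) w₁ w₂ t₁ t₂ n‖
  have hG : Int.gcd n (g : ℤ) = n.natAbs.gcd g := rfl
  have hD : Int.gcd (Delta s₁ s₂ t₁ t₂) ((n.natAbs.gcd g : ℕ) : ℤ) =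
    (w₂ ^ 2 * t₁ - w₁ ^ 2 * t₂).natAbs.gcd (n.natAbs.gcd g) := rfl
  rw [hG, hD]
  have hG0 : 0 < n.natAbs.gcd g := Nat.gcd_pos_of_pos_right _ hg0
  set G := n.natAbs.gcd g
  set D := (w₂ ^ 2 * t₁ - w₁ ^ 2 * t₂).natAbs.gcd G
  have hm₁ : (0 : ℝ) < stabCard (w₁ : ZMod L) := by exact_mod_cast one_le_stabCard (w₁ : ZMod L)
  have hm₂ : (0 : ℝ) < stabCard (w₂ : ZMod L) := by exact_mod_cast one_le_stabCard (w₂ : ZMod L)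
  set m₁ := (stabCard (w₁ : ZMod L) : ℝ)
  set m₂ := (stabCard (w₂ : ZMod L) : ℝ)
  set ω := L.primeFactors.card
  have hG0' : (0 : ℝ) < G := by exact_mod_cast hG0
  have hsq : C ^ 2 * G ≤ 32 ^ ω * g * L ^ 2 * D ^ 2 := by
    refine le_of_mul_le_mul_left ?_ (show 0 < (m₂ * m₁) ^ 2 by positivity)
    calc (m₂ * m₁) ^ 2 * (C ^ 2 * G) = (m₂ * m₁ * C) ^ 2 * G := by ring
      _ = L ^ 2 * (J ^ 2 * G) := by rw [hC]; ring
      _ ≤ L ^ 2 * (32 ^ ω * m₁ ^ 2 * m₂ ^ 2 * g * D ^ 2) := by gcongr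
      _ = _ := by ring
  rw [← Real.sqrt_eq_rpow, ← Real.sqrt_eq_rpow]
  refine (sq_le_sq₀ (norm_nonneg _) (by positivity)).mp ?_
  have hpow : ((2 : ℝ) ^ (5 / 2 * (ω : ℝ))) ^ 2 = 32 ^ ω := by
    rw [← Real.rpow_natCast, ← Real.rpow_mul (by norm_num), show (5 / 2 * (ω : ℝ) * (2 : ℕ)) =
      ((5 * ω : ℕ) : ℝ) by push_cast; ring, Real.rpow_natCast, pow_mul]
    norm_num
  rw [div_pow, mul_pow, mul_pow, Real.sq_sqrt (by positivity), Real.sq_sqrt (by positivity), hpow,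
    le_div_iff₀ hG0', ← hgL]
  refine hsq.trans_eq ?_
  push_cast
  ring
end

section
/- Let M be a prime number and χ a primitive Dirichlet character modulo M. Let p₁, p₂, ℓ₁, ℓ₂ be integers coprime to M and let r₁, r₂ be integers. Then ∑_{a mod M} S_χ(r₁, a p₁ \bar{ℓ₁}; M) · \overline{ S_χ(r₂, a p₂ \bar{ℓ₂}; M) } = M · χ(p₁ \bar{p₂} \bar{ℓ₁} ℓ₂) · ( M·δ − 1 ), where δ = 1 if ℓ₂ r₁ p₁ ≡ ℓ₁ r₂ p₂ (mod M) and δ = 0 otherwise, and where \bar{p₂}, \bar{ℓ₁}, \bar{ℓ₂} denote multiplicative inverses modulo M. -/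
open Complex

/-- The generalized Kloosterman sum
`S_χ(a,b;M) = ∑_{x mod M, (x,M)=1} χ(x) e((ax + b x̄)/M)`. -/
noncomputable def SgenChi (M : ℕ) (χ : DirichletCharacter ℂ M) (a b : ℤ) : ℂ :=
  ∑ x ∈ Finset.range M, if Nat.gcd x M = 1 then
    χ (x : ZMod M) * e (((a * x + b * ((((x : ZMod M))⁻¹).val : ℤ) : ℤ) : ℝ) / (M : ℝ))
  else 0

/-- A sum over `0 ≤ a < M` of a function of the residue of `a` is a sum over `ZMod M`. -/
theorem sum_range_natCast_zmod (M : ℕ) [NeZero M] (f : ZMod M → ℂ) :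
    ∑ a ∈ Finset.range M, f (a : ZMod M) = ∑ a : ZMod M, f a :=
  Finset.sum_nbij' (fun a => (a : ZMod M)) ZMod.val (fun _ _ => Finset.mem_univ _)
    (fun a _ => Finset.mem_range.mpr (ZMod.val_lt a))
    (fun _ ha => ZMod.val_cast_of_lt (Finset.mem_range.mp ha))
    (fun a _ => ZMod.natCast_zmod_val a) (fun _ _ => rfl)

theorem e_intCast_div (M : ℕ) [NeZero M] (n : ℤ) :
    e ((n : ℝ) / (M : ℝ)) = ZMod.stdAddChar (n : ZMod M) := by
  rw [ZMod.stdAddChar_coe, e]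
  congr 1
  push_cast
  ring

/-- The generalized Kloosterman sum as a complete sum over `ZMod M`. -/
theorem SgenChi_eq_sum_zmod (M : ℕ) [NeZero M] (χ : DirichletCharacter ℂ M) (a b : ℤ) :
    SgenChi M χ a b =
      ∑ x : ZMod M, χ x * ZMod.stdAddChar ((a : ZMod M) * x + (b : ZMod M) * x⁻¹) := by
  rw [← sum_range_natCast_zmod, SgenChi]
  refine Finset.sum_congr rfl fun x _ => ?_
  split_ifs with h
  · rw [e_intCast_div]
    congr 2
    push_cast
    rw [ZMod.natCast_zmod_val]
  · rw [χ.map_nonunit, zero_mul]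
    rwa [ZMod.isUnit_iff_coprime]

theorem conj_dirichletCharacter {M : ℕ} [Fact M.Prime] (χ : DirichletCharacter ℂ M)
    (x : ZMod M) : (starRingEnd ℂ) (χ x) = χ x⁻¹ := by
  rw [← MulChar.inv_apply', ← MulChar.star_apply']
  rfl

/-- Correlation of two families of Kloosterman sums over the second parameter. -/
theorem sum_kloosterman_mul_conj {M : ℕ} [Fact M.Prime] (χ : DirichletCharacter ℂ M)
    {u v : ZMod M} (hu : u ≠ 0) (hv : v ≠ 0) (r s : ZMod M) :
    ∑ a : ZMod M, (∑ x : ZMod M, χ x * ZMod.stdAddChar (r * x + a * u * x⁻¹)) *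
        (starRingEnd ℂ) (∑ y : ZMod M, χ y * ZMod.stdAddChar (s * y + a * v * y⁻¹)) =
      (M : ℂ) * χ (u * v⁻¹) * ((if r * u = s * v then (M : ℂ) else 0) - 1) := by
  have orth (b : ZMod M) : ∑ x : ZMod M, (ZMod.stdAddChar (x * b) : ℂ) =
      if b = 0 then (M : ℂ) else 0 := by
    rw [AddChar.sum_mulShift b (ZMod.isPrimitive_stdAddChar M), ZMod.card]
    split_ifs <;> simp
  have map_zero : χ 0 = 0 := χ.map_nonunit not_isUnit_zero
  calc
    _ = ∑ x : ZMod M, ∑ y : ZMod M, χ x * χ y⁻¹ * ZMod.stdAddChar (r * x - s * y) *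
        ∑ a : ZMod M, (ZMod.stdAddChar (a * (u * x⁻¹ - v * y⁻¹)) : ℂ) := by
      simp_rw [map_sum, Finset.sum_mul_sum, Finset.mul_sum]
      rw [Finset.sum_comm]
      refine Finset.sum_congr rfl fun x _ => ?_
      rw [Finset.sum_comm]
      refine Finset.sum_congr rfl fun y _ => Finset.sum_congr rfl fun a _ => ?_
      have h : (ZMod.stdAddChar (r * x + a * u * x⁻¹) : ℂ) *
          ZMod.stdAddChar (-(s * y + a * v * y⁻¹)) =
          ZMod.stdAddChar (r * x - s * y) *
            ZMod.stdAddChar (a * (u * x⁻¹ - v * y⁻¹)) := by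
        rw [← AddChar.map_add_eq_mul, ← AddChar.map_add_eq_mul]
        congr 1
        ring
      rw [map_mul, conj_dirichletCharacter, ← AddChar.map_neg_eq_conj]
      linear_combination χ x * χ y⁻¹ * h
    _ = ∑ x : ZMod M, if x = 0 then 0 else
        (M : ℂ) * χ (u * v⁻¹) * ZMod.stdAddChar (x * (r - s * (v * u⁻¹))) := by
      refine Finset.sum_congr rfl fun x _ => ?_
      split_ifs with hx
      · simp [hx, map_zero]
      · rw [Finset.sum_eq_single (v * u⁻¹ * x)]
        · rw [orth, if_pos (by field_simp; simp), ← map_mul,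
            show x * (v * u⁻¹ * x)⁻¹ = u * v⁻¹ by field_simp,
            show r * x - s * (v * u⁻¹ * x) = x * (r - s * (v * u⁻¹)) by ring]
          ring
        · intro y _ hy
          rcases eq_or_ne y 0 with rfl | hy0
          · simp [map_zero]
          · rw [orth, if_neg, mul_zero]
            intro h
            apply hy
            field_simp at h ⊢
            linear_combination h
        · simp
    _ = (M : ℂ) * χ (u * v⁻¹) *
        (∑ x : ZMod M, (ZMod.stdAddChar (x * (r - s * (v * u⁻¹))) : ℂ) - 1) := by
      rw [← Finset.add_sum_erase _ _ (Finset.mem_univ (0 : ZMod M)),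
        ← Finset.add_sum_erase _ (fun x : ZMod M => (ZMod.stdAddChar (x * _) : ℂ))
          (Finset.mem_univ (0 : ZMod M))]
      simp only [if_true, zero_mul, AddChar.map_zero_eq_one, zero_add, add_sub_cancel_left,
        Finset.mul_sum]
      exact Finset.sum_congr rfl fun x hx => if_neg (Finset.ne_of_mem_erase hx)
    _ = _ := by
      rw [orth]
      congr 3
      rw [eq_iff_iff, sub_eq_zero]
      field_simp

/-- Let `M` be prime, `χ` primitive mod `M`, `p₁,p₂,ℓ₁,ℓ₂` integers coprime
to `M` and `r₁,r₂` integers. Then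
`∑_{a mod M} S_χ(r₁, a p₁ ℓ₁̄; M) · conj S_χ(r₂, a p₂ ℓ₂̄; M)
  = M χ(p₁ p₂̄ ℓ₁̄ ℓ₂)(M δ_{ℓ₂r₁p₁ ≡ ℓ₁r₂p₂ (M)} − 1)`. -/
theorem statement5 (M : ℕ) (hM : Nat.Prime M) (χ : DirichletCharacter ℂ M)
    (hχ : χ.IsPrimitive) (p₁ p₂ ℓ₁ ℓ₂ : ℤ)
    (hp₁ : IsCoprime p₁ (M : ℤ)) (hp₂ : IsCoprime p₂ (M : ℤ))
    (hℓ₁ : IsCoprime ℓ₁ (M : ℤ)) (hℓ₂ : IsCoprime ℓ₂ (M : ℤ)) (r₁ r₂ : ℤ) :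
    (∑ a ∈ Finset.range M,
        SgenChi M χ r₁ ((((a : ZMod M) * (p₁ : ZMod M) * ((ℓ₁ : ZMod M))⁻¹).val : ℤ)) *
          (starRingEnd ℂ)
            (SgenChi M χ r₂ ((((a : ZMod M) * (p₂ : ZMod M) * ((ℓ₂ : ZMod M))⁻¹).val : ℤ))))
      = (M : ℂ) * χ ((p₁ : ZMod M) * ((p₂ : ZMod M))⁻¹ * ((ℓ₁ : ZMod M))⁻¹ * (ℓ₂ : ZMod M)) *
          ((if (M : ℤ) ∣ (ℓ₂ * r₁ * p₁ - ℓ₁ * r₂ * p₂) then (M : ℂ) else 0) - 1) := by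
  have : Fact M.Prime := ⟨hM⟩
  have ne_zero {n : ℤ} (h : IsCoprime n (M : ℤ)) : (n : ZMod M) ≠ 0 :=
    ((ZMod.coe_int_isUnit_iff_isCoprime n M).mpr h.symm).ne_zero
  have hp₁0 := ne_zero hp₁
  have hp₂0 := ne_zero hp₂
  have hℓ₁0 := ne_zero hℓ₁
  have hℓ₂0 := ne_zero hℓ₂
  have key := sum_kloosterman_mul_conj χ (mul_ne_zero hp₁0 (inv_ne_zero hℓ₁0))
    (mul_ne_zero hp₂0 (inv_ne_zero hℓ₂0)) (r₁ : ZMod M) (r₂ : ZMod M)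
  rw [← sum_range_natCast_zmod] at key
  simp only [SgenChi_eq_sum_zmod, Int.cast_natCast, ZMod.natCast_zmod_val, mul_assoc] at key ⊢
  rw [key]
  congr 2
  · rw [mul_inv, inv_inv]
    congr 1
    ring
  · congr 2
    rw [eq_iff_iff, ← ZMod.intCast_zmod_eq_zero_iff_dvd]
    push_cast
    rw [sub_eq_zero]
    field_simp
end

section
/- Let V be a smooth function compactly supported in (0,∞) all of whose derivatives are bounded. There exists a constant C depending only on V such that for all real t ≥ 2, all reals N, M ≥ 1, and all positive integers n, p, ℓ, r: | ∫_ℝ x^{−it} e(−nt/(Nx)) V(x) e(−rNpx/(M²ℓt)) dx | ≤ C · t^{−1/2}. -/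
open Complex MeasureTheory

/-- `x^{-it}` for `x > 0`, i.e. `exp(−it·log x)`. -/
noncomputable def nit (x t : ℝ) : ℂ := Complex.exp (-(Complex.I * (t : ℂ)) * (Real.log x : ℂ))

/-- Second-derivative test in the variable `1/x`: if `‖f‖ ≤ 1` and
`f' = -i q f / x²` with `q(x) = t x - s + b x²`, then `∫ f V = O(t^{-1/2})` uniformly in `s`
and `b ≥ 0`. -/
lemma norm_integral_mul_le_of_hasDerivAt_phase {f V : ℝ → ℂ} {t s b β K₀ K₁ K₂ : ℝ}
    (ht : 0 < t) (hb : 0 ≤ b) (hβ : 0 < β)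
    (hf : Measurable f) (hf1 : ∀ x, ‖f x‖ ≤ 1)
    (hfd : ∀ x, 0 < x →
      HasDerivAt f (-Complex.I * ((t * x - s + b * x ^ 2 : ℝ) : ℂ) / (x : ℂ) ^ 2 * f x) x)
    (hV : ContDiff ℝ 1 V) (hVβ : V β = 0)
    (hK₀ : ∀ x : ℝ, ‖(x : ℂ) ^ 2 * V x‖ ≤ K₀)
    (hK₁ : ∀ x : ℝ, ‖2 * (x : ℂ) * V x + (x : ℂ) ^ 2 * deriv V x‖ ≤ K₁)
    (hK₂ : ∀ x, ‖V x‖ ≤ K₂) :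
    ‖∫ x in (0 : ℝ)..β, f x * V x‖ ≤ (K₁ * β + (K₀ + K₂) * Real.pi) / √t := by
  set q : ℝ → ℝ := fun x => t * x - s + b * x ^ 2 with hq
  set q' : ℝ → ℝ := fun x => t + 2 * b * x with hq'
  have hqd : ∀ x, HasDerivAt q (q' x) x := by
    intro x
    have h := (((hasDerivAt_id x).const_mul t).sub_const s).add
      (((hasDerivAt_id x).pow 2).const_mul b)
    refine h.congr_deriv ?_
    simp [hq']; ring
  have hqc : Continuous q := by fun_prop
  have hq'c : Continuous q' := by fun_prop
  have hD : ∀ x, 0 < q x ^ 2 + t := fun x => by positivity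
  have hst : 0 < √t := Real.sqrt_pos.2 ht
  have hss : √t ^ 2 = t := Real.sq_sqrt ht.le
  set g : ℝ → ℝ := fun x => q x / (q x ^ 2 + t) with hg
  set g' : ℝ → ℝ := fun x => q' x * (t - q x ^ 2) / (q x ^ 2 + t) ^ 2 with hg'
  have hgd : ∀ x, HasDerivAt g (g' x) x := by
    intro x
    have h := (hqd x).div (((hqd x).pow 2).add_const t) (hD x).ne'
    refine h.congr_deriv ?_
    simp only [hg']
    congr 1
    simp
    ring
  have hgc : Continuous g := hqc.div (by fun_prop) fun x => (hD x).ne'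
  have hg'c : Continuous g' :=
    Continuous.div (by fun_prop) (by fun_prop) fun x => (pow_pos (hD x) 2).ne'
  have hg_le : ∀ x, |g x| ≤ 1 / √t := by
    intro x
    rw [hg, abs_div, abs_of_pos (hD x), div_le_div_iff₀ (hD x) hst, one_mul]
    nlinarith [sq_nonneg (|q x| - √t), sq_abs (q x), abs_nonneg (q x)]
  have hg'_le : ∀ x, 0 ≤ x → |g' x| ≤ q' x / (q x ^ 2 + t) := by
    intro x hx
    have hq'0 : 0 ≤ q' x := by simp only [hq']; positivity
    rw [hg', abs_div, abs_mul, abs_of_nonneg hq'0, abs_of_pos (pow_pos (hD x) 2),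
      div_le_div_iff₀ (pow_pos (hD x) 2) (hD x)]
    have h : |t - q x ^ 2| ≤ q x ^ 2 + t := by
      rw [abs_le]; constructor <;> nlinarith [sq_nonneg (q x)]
    calc q' x * |t - q x ^ 2| * (q x ^ 2 + t) ≤ q' x * (q x ^ 2 + t) * (q x ^ 2 + t) := by
          gcongr
      _ = _ := by ring
  set G : ℝ → ℂ := fun x => (x : ℂ) ^ 2 * V x with hG
  set G' : ℝ → ℂ := fun x => 2 * (x : ℂ) * V x + (x : ℂ) ^ 2 * deriv V x with hG'
  have hVc : Continuous V := hV.continuous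
  have hV'c : Continuous (deriv V) := hV.continuous_deriv le_rfl
  have hGd : ∀ x, HasDerivAt G (G' x) x := by
    intro x
    have h := (((hasDerivAt_id x).ofReal_comp).pow 2).mul
      ((hV.differentiable one_ne_zero x).hasDerivAt)
    refine h.congr_deriv ?_
    simp [hG']
  have hGc : Continuous G := by fun_prop
  have hG'c : Continuous G' := by fun_prop
  have hgC : Continuous fun x => (g x : ℂ) := Complex.continuous_ofReal.comp hgc
  have hg'C : Continuous fun x => (g' x : ℂ) := Complex.continuous_ofReal.comp hg'c
  set c : ℝ → ℂ := fun x =>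
    -Complex.I * q x * g x * V x + G' x * g x + G x * g' x with hc
  have hcc : Continuous c := by
    have : Continuous fun x => (q x : ℂ) := Complex.continuous_ofReal.comp hqc
    fun_prop
  have hint : ∀ k : ℝ → ℂ, Continuous k →
      IntervalIntegrable (fun x => f x * k x) volume 0 β := by
    intro k hk
    rw [intervalIntegrable_iff]
    exact ((intervalIntegrable_iff.1 (hk.intervalIntegrable 0 β)).bdd_mul
      hf.aestronglyMeasurable (Filter.Eventually.of_forall hf1))
  set F : ℝ → ℂ := fun x => f x * (G x * g x) with hF
  have hFd : ∀ x ∈ Set.Ioo 0 β, HasDerivAt F (f x * c x) x := by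
    intro x hx
    have h := (hfd x hx.1).mul ((hGd x).mul (hgd x).ofReal_comp)
    refine h.congr_deriv ?_
    rw [Pi.mul_apply]
    have hx0 : (x : ℂ) ≠ 0 := by exact_mod_cast hx.1.ne'
    simp only [hc, hG, hq]
    field_simp
    ring
  have hF0 : F 0 = 0 := by simp [hF, hG]
  have hFβ : F β = 0 := by simp [hF, hG, hVβ]
  have hFc : ContinuousOn F (Set.Icc 0 β) := by
    intro x hx
    rcases hx.1.eq_or_lt with rfl | hx0
    · apply ContinuousAt.continuousWithinAt
      have hlim : Filter.Tendsto (fun x => G x * (g x : ℂ)) (nhds 0) (nhds 0) := by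
        have := (hGc.mul hgC).tendsto 0
        rwa [Pi.mul_apply, show G 0 = 0 by simp [hG], zero_mul] at this
      rw [ContinuousAt, hF0]
      refine squeeze_zero_norm (a := fun x => ‖G x * (g x : ℂ)‖) (fun x => ?_)
        (by simpa only [norm_zero] using hlim.norm)
      rw [hF, norm_mul]
      exact (mul_le_mul_of_nonneg_right (hf1 x) (norm_nonneg _)).trans (by rw [one_mul])
    · exact ((hfd x hx0).continuousAt.mul
        ((hGc.mul hgC).continuousAt)).continuousWithinAt
  have hzero : ∫ x in (0 : ℝ)..β, f x * c x = 0 := by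
    rw [intervalIntegral.integral_eq_sub_of_hasDerivAt_of_le hβ.le hFc hFd (hint c hcc),
      hF0, hFβ, sub_zero]
  have hshift : ∫ x in (0 : ℝ)..β, f x * V x
      = ∫ x in (0 : ℝ)..β, (f x * V x - Complex.I * (f x * c x)) := by
    rw [intervalIntegral.integral_sub (hint V hVc) ((hint c hcc).const_mul _),
      intervalIntegral.integral_const_mul, hzero, mul_zero, sub_zero]
  set B : ℝ → ℝ := fun x => K₁ * (1 / √t) + (K₀ + K₂) * (q' x / (q x ^ 2 + t)) with hB
  have hBc : Continuous B := by
    have : Continuous fun x => q' x / (q x ^ 2 + t) :=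
      hq'c.div (by fun_prop) fun x => (hD x).ne'
    fun_prop
  have hK₀0 : 0 ≤ K₀ := (norm_nonneg _).trans (hK₀ 0)
  have hK₁0 : 0 ≤ K₁ := (norm_nonneg _).trans (hK₁ 0)
  have hK₂0 : 0 ≤ K₂ := (norm_nonneg _).trans (hK₂ 0)
  have hle : ∀ x ∈ Set.Ioc 0 β, ‖f x * V x - Complex.I * (f x * c x)‖ ≤ B x := by
    intro x hx
    have hDC : (q x : ℂ) ^ 2 + t ≠ 0 := by exact_mod_cast (hD x).ne'
    have hgq : (q x : ℂ) * g x = 1 - (t / (q x ^ 2 + t) : ℝ) := by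
      simp only [hg]
      push_cast
      field_simp
      ring
    have heq : f x * V x - Complex.I * (f x * c x)
        = f x * (V x * (t / (q x ^ 2 + t) : ℝ)
          - Complex.I * (G' x * g x + G x * g' x)) := by
      simp only [hc]
      linear_combination (-f x * V x) * hgq + f x * q x * g x * V x * Complex.I_sq
    have h1 : ‖V x * ((t / (q x ^ 2 + t) : ℝ) : ℂ)‖ ≤ K₂ * (q' x / (q x ^ 2 + t)) := by
      rw [norm_mul, Complex.norm_real, Real.norm_of_nonneg (div_nonneg ht.le (hD x).le)]
      have : t ≤ q' x := by
        have := mul_nonneg hb hx.1.le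
        simp only [hq']; linarith
      have := hD x
      gcongr
      exact hK₂ x
    have h2 : ‖G' x * (g x : ℂ)‖ ≤ K₁ * (1 / √t) := by
      rw [norm_mul, Complex.norm_real, Real.norm_eq_abs]
      exact mul_le_mul (hK₁ x) (hg_le x) (abs_nonneg _) hK₁0
    have h3 : ‖G x * (g' x : ℂ)‖ ≤ K₀ * (q' x / (q x ^ 2 + t)) := by
      rw [norm_mul, Complex.norm_real, Real.norm_eq_abs]
      exact mul_le_mul (hK₀ x) (hg'_le x hx.1.le) (abs_nonneg _) hK₀0
    rw [heq, norm_mul]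
    refine (mul_le_mul_of_nonneg_right (hf1 x) (norm_nonneg _)).trans ?_
    rw [one_mul]
    refine (norm_sub_le _ _).trans ?_
    rw [norm_mul Complex.I, Complex.norm_I, one_mul]
    have h4 := norm_add_le (G' x * (g x : ℂ)) (G x * (g' x : ℂ))
    simp only [hB]
    linarith
  have hprim : ∀ x, HasDerivAt
      (fun x => K₁ * (1 / √t) * x + (K₀ + K₂) * (1 / √t * Real.arctan (q x / √t))) (B x) x := by
    intro x
    have h := ((hasDerivAt_id x).const_mul (K₁ * (1 / √t))).add
      (((((hqd x).div_const √t).arctan).const_mul (1 / √t)).const_mul (K₀ + K₂))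
    refine h.congr_deriv ?_
    have hD' := (hD x).ne'
    have : 1 + (q x / √t) ^ 2 = (q x ^ 2 + t) / t := by
      rw [div_pow, hss]; field_simp; ring
    simp only [hB, this, mul_one]
    congr 2
    rw [← hss] at hD' ⊢
    simp only [Real.sqrt_sq hst.le]
    field_simp
  rw [hshift]
  refine (intervalIntegral.norm_integral_le_of_norm_le hβ.le
    (Filter.Eventually.of_forall hle) (hBc.intervalIntegrable 0 β)).trans ?_
  rw [intervalIntegral.integral_eq_sub_of_hasDerivAt (fun x _ => hprim x)
    (hBc.intervalIntegrable 0 β)]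
  have ha := Real.arctan_lt_pi_div_two (q β / √t)
  have ha' := Real.neg_pi_div_two_lt_arctan (q 0 / √t)
  calc _ = (K₁ * β + (K₀ + K₂) * (Real.arctan (q β / √t) - Real.arctan (q 0 / √t))) / √t := by
        ring
    _ ≤ _ := by
        gcongr
        linarith

lemma norm_e (x : ℝ) : ‖e x‖ = 1 := by
  rw [e, Complex.norm_exp]
  simp

lemma norm_nit (x t : ℝ) : ‖nit x t‖ = 1 := by
  rw [nit, Complex.norm_exp]
  simp

lemma HasDerivAt.e_comp {u : ℝ → ℝ} {u' x : ℝ} (hu : HasDerivAt u u' x) :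
    HasDerivAt (fun y => e (u y)) (2 * Real.pi * Complex.I * u' * e (u x)) x := by
  refine ((hu.ofReal_comp.const_mul (2 * Real.pi * Complex.I)).cexp).congr_deriv ?_
  simp only [e]
  ring

lemma hasDerivAt_nit {x : ℝ} (hx : x ≠ 0) (t : ℝ) :
    HasDerivAt (fun y => nit y t) (-(Complex.I * t) / x * nit x t) x := by
  refine (((Real.hasDerivAt_log hx).ofReal_comp.const_mul (-(Complex.I * t))).cexp).congr_deriv ?_
  simp only [nit]
  push_cast
  ring

/-- **second-derivative bound.** Let `V` be smooth, compactly supported in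
`(0,∞)`, with all derivatives bounded. There is `C = C(V)` such that for all `t ≥ 2`,
`N, M ≥ 1` and positive integers `n, p, ℓ, r`:
`|∫ x^{−it} e(−nt/(Nx)) V(x) e(−rNpx/(M²ℓt)) dx| ≤ C t^{−1/2}`. -/
theorem statement9 (V : ℝ → ℂ) (hVsm : ContDiff ℝ (⊤ : ℕ∞) V) (hVcs : HasCompactSupport V)
    (hVsupp : Function.support V ⊆ Set.Ioi 0)
    (hVder : ∀ j : ℕ, ∃ Cj : ℝ, ∀ x : ℝ, ‖iteratedDeriv j V x‖ ≤ Cj) :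
    ∃ C : ℝ, 0 < C ∧
      ∀ t : ℝ, 2 ≤ t → ∀ N M : ℝ, 1 ≤ N → 1 ≤ M →
        ∀ n p ℓ r : ℕ, 0 < n → 0 < p → 0 < ℓ → 0 < r →
          ‖∫ x : ℝ, nit x t * e (-((n : ℝ) * t) / (N * x)) * V x *
              e (-((r : ℝ) * N * p * x) / (M ^ 2 * ℓ * t))‖
            ≤ C * t ^ (-(1 : ℝ) / 2) := by
  have hV1 : ContDiff ℝ 1 V := hVsm.of_le (by exact_mod_cast le_top)
  have hV'c : Continuous (deriv V) := hV1.continuous_deriv le_rfl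
  have hVc : Continuous V := hV1.continuous
  obtain ⟨K₀, hK₀⟩ := (hVcs.mul_left (f := fun x : ℝ => (x : ℂ) ^ 2)).exists_bound_of_continuous
    (by fun_prop)
  obtain ⟨K₁, hK₁⟩ := ((hVcs.mul_left (f := fun x : ℝ => 2 * (x : ℂ))).add
    (hVcs.deriv.mul_left (f := fun x : ℝ => (x : ℂ) ^ 2))).exists_bound_of_continuous
    (by fun_prop)
  obtain ⟨K₂, hK₂⟩ := hVcs.exists_bound_of_continuous hVc
  obtain ⟨R, hR⟩ := hVcs.isCompact.isBounded.subset_closedBall 0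
  set β : ℝ := max R 0 + 1 with hβdef
  have hβ : 0 < β := by positivity
  have hVβ : ∀ x, β ≤ x → V x = 0 := by
    intro x hx
    by_contra h
    have h1 := hR (subset_tsupport V h)
    rw [mem_closedBall_zero_iff, Real.norm_eq_abs] at h1
    linarith [le_abs_self x, le_max_left R 0]
  have hV0 : ∀ x, x ≤ 0 → V x = 0 := by
    intro x hx
    by_contra h
    exact absurd (hVsupp h) (not_lt.2 hx)
  have hK₀0 : 0 ≤ K₀ := (norm_nonneg _).trans (hK₀ 0)
  have hK₁0 : 0 ≤ K₁ := (norm_nonneg _).trans (hK₁ 0)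
  have hK₂0 : 0 ≤ K₂ := (norm_nonneg _).trans (hK₂ 0)
  refine ⟨K₁ * β + (K₀ + K₂) * Real.pi + 1, by positivity, ?_⟩
  intro t ht N M hN hM n p ℓ r _ _ hℓ _
  have ht0 : 0 < t := by linarith
  have hN0 : 0 < N := by linarith
  have hM0 : 0 < M := by linarith
  set f : ℝ → ℂ := fun x => nit x t * e (-((n : ℝ) * t) / (N * x)) *
    e (-((r : ℝ) * N * p * x) / (M ^ 2 * ℓ * t)) with hf
  set b : ℝ := 2 * Real.pi * (r * N * p / (M ^ 2 * ℓ * t)) with hb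
  have hfm : Measurable f := by
    simp only [hf, nit, e]
    fun_prop
  have hf1 : ∀ x, ‖f x‖ ≤ 1 := fun x => by simp [hf, norm_e, norm_nit]
  have hfd : ∀ x, 0 < x → HasDerivAt f (-Complex.I *
      ((t * x - 2 * Real.pi * (n * t / N) + b * x ^ 2 : ℝ) : ℂ) / (x : ℂ) ^ 2 * f x) x := by
    intro x hx
    have h1 : HasDerivAt (fun x : ℝ => -((n : ℝ) * t) / (N * x)) (n * t / N / x ^ 2) x := by
      refine ((hasDerivAt_inv hx.ne').const_mul (-(n * t / N))).congr_of_eventuallyEq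
        (Filter.Eventually.of_forall fun y => ?_) |>.congr_deriv ?_
      · simp only [div_eq_mul_inv, mul_inv]; ring
      · ring
    have h2 : HasDerivAt (fun x : ℝ => -((r : ℝ) * N * p * x) / (M ^ 2 * ℓ * t))
        (-(r * N * p / (M ^ 2 * ℓ * t))) x := by
      refine ((hasDerivAt_id x).const_mul (-(r * N * p / (M ^ 2 * ℓ * t)))).congr_of_eventuallyEq
        (Filter.Eventually.of_forall fun y => ?_) |>.congr_deriv ?_
      · simp only [id]; ring
      · ring
    refine (((hasDerivAt_nit hx.ne' t).mul h1.e_comp).mul h2.e_comp).congr_deriv ?_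
    have hx0 : (x : ℂ) ≠ 0 := by exact_mod_cast hx.ne'
    rw [Pi.mul_apply]
    simp only [hf, hb]
    generalize (n : ℝ) * t / N = A
    generalize (r : ℝ) * N * p / (M ^ 2 * ℓ * t) = A'
    push_cast
    field_simp
    ring
  have hmain := norm_integral_mul_le_of_hasDerivAt_phase ht0 (by positivity) hβ hfm hf1 hfd hV1
    (hVβ β le_rfl) hK₀ hK₁ hK₂
  have hint : ∫ x : ℝ, nit x t * e (-((n : ℝ) * t) / (N * x)) * V x *
      e (-((r : ℝ) * N * p * x) / (M ^ 2 * ℓ * t)) = ∫ x in (0 : ℝ)..β, f x * V x := by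
    rw [intervalIntegral.integral_of_le hβ.le, setIntegral_eq_integral_of_forall_compl_eq_zero]
    · refine integral_congr_ae (Filter.Eventually.of_forall fun x => ?_)
      simp only [hf]
      ring
    · intro x hx
      rw [Set.mem_Ioc, not_and_or, not_lt, not_le] at hx
      rcases hx with hx | hx
      · rw [hV0 x hx, mul_zero]
      · rw [hVβ x hx.le, mul_zero]
  rw [hint]
  refine hmain.trans ?_
  rw [neg_div, Real.rpow_neg ht0.le, ← Real.sqrt_eq_rpow, ← div_eq_mul_inv]
  exact div_le_div_of_nonneg_right (by linarith) (Real.sqrt_nonneg t)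
end
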